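/- arXiv:1910.01893 — 2 statements merged into one kernel-verified Lean document; each statement's English description precedes it below -/
import Mathlib

section
/- Let D be the ring of integers of a real quadratic number field. If x, y in D generate a principal ideal of D, then the 2×2 matrix with first row (x, y) and second row (0, 0) is a product of idempotent matrices over D. (One may use Vaserstein's theorem that SL_2(D) is generated by elementary matrices.) -/
open scoped IntermediateField

def IsIdemProd {R : Type*} [CommRing R] (M : Matrix (Fin 2) (Fin 2) R) : Prop :=
  ∃ l : List (Matrix (Fin 2) (Fin 2) R), (∀ T ∈ l, T * T = T) ∧ M = l.prod

namespace S7

open Matrix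

section idem
variable {R : Type*} [CommRing R]

theorem idem_conj {M P Q : Matrix (Fin 2) (Fin 2) R} (h : Q * P = 1) (hM : IsIdemProd M) :
    IsIdemProd (P * M * Q) := by
  have h' : P * Q = 1 := mul_eq_one_comm.mp h
  obtain ⟨l, hl, rfl⟩ := hM
  refine ⟨l.map (fun T => P * T * Q), ?_, ?_⟩
  · intro T hT
    obtain ⟨S, hS, rfl⟩ := List.mem_map.mp hT
    calc P * S * Q * (P * S * Q) = P * S * (Q * P) * S * Q := by simp only [mul_assoc]
      _ = P * (S * S) * Q := by rw [h]; simp only [mul_assoc, mul_one]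
      _ = _ := by rw [hl S hS]
  · clear hl
    induction l with
    | nil => simp [h']
    | cons S l ih =>
      simp only [List.map_cons, List.prod_cons, ← ih]
      calc P * (S * l.prod) * Q = P * S * 1 * l.prod * Q := by simp only [mul_assoc, mul_one]
        _ = _ := by rw [← h]; simp only [mul_assoc]

theorem idem_mul {M N : Matrix (Fin 2) (Fin 2) R} (hM : IsIdemProd M) (hN : IsIdemProd N) :
    IsIdemProd (M * N) := by
  obtain ⟨l, hl, rfl⟩ := hM
  obtain ⟨l', hl', rfl⟩ := hN
  refine ⟨l ++ l', ?_, by simp⟩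
  intro T hT
  rcases List.mem_append.mp hT with h | h
  · exact hl T h
  · exact hl' T h

theorem idem_of {M : Matrix (Fin 2) (Fin 2) R} (h : M * M = M) : IsIdemProd M :=
  ⟨[M], by simpa using h, by simp⟩

/-- all multiples of the row are products of idempotents -/
def Good (a b : R) : Prop := ∀ g : R, IsIdemProd !![g * a, g * b; 0, 0]

theorem good_one_zero : Good (1 : R) 0 := by
  intro g
  have h1 : IsIdemProd (!![1, 1; 0, 0] : Matrix (Fin 2) (Fin 2) R) :=
    idem_of (by ext i j; fin_cases i <;> fin_cases j <;> simp)
  have h2 : IsIdemProd (!![1, 0; g - 1, 0] : Matrix (Fin 2) (Fin 2) R) :=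
    idem_of (by ext i j; fin_cases i <;> fin_cases j <;> simp)
  have := idem_mul h1 h2
  convert this using 1
  ext i j; fin_cases i <;> fin_cases j <;> simp

theorem Good.add_right {a b : R} (h : Good a b) (t : R) : Good a (b + t * a) := by
  intro g
  have := idem_conj (P := !![1, -t; 0, 1]) (Q := !![1, t; 0, 1])
    (by simp [Matrix.one_fin_two]) (h g)
  convert this using 1
  simp
  ring

theorem Good.add_left {a b : R} (h : Good a b) (t : R) : Good (a + t * b) b := by
  intro g
  have h1 := idem_conj (P := !![1, 0; -t, 1]) (Q := !![1, 0; t, 1])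
    (by simp [Matrix.one_fin_two]) (h g)
  have h2 : IsIdemProd (!![1, 0; 0, 0] : Matrix (Fin 2) (Fin 2) R) :=
    idem_of (by ext i j; fin_cases i <;> fin_cases j <;> simp)
  have := idem_mul h2 h1
  convert this using 1
  simp
  ring

theorem Good.unit_right {a b : R} (h : Good a b) {u v : R} (huv : u * v = 1) :
    Good a (u * b) := by
  intro g
  have := idem_conj (P := !![1, 0; 0, v]) (Q := !![1, 0; 0, u])
    (by simp [Matrix.one_fin_two, huv]) (h g)
  convert this using 1
  simp
  ring

theorem Good.congr {a b a' b' : R} (h : Good a b) (h1 : a = a') (h2 : b = b') : Good a' b' := by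
  subst h1 h2; exact h

theorem Good.swap {a b : R} (h : Good a b) : Good b a := by
  have n1 : ∀ {x y : R}, Good x y → Good (-y) x := fun {x y} h =>
    (((h.add_right 1).add_left (-1)).add_right 1).congr (by ring) (by ring)
  have h3 : Good b (-a) := (n1 (n1 (n1 h))).congr (by ring) rfl
  exact (h3.unit_right (u := -1) (v := -1) (by ring)).congr rfl (by ring)

/-- replace the second entry by a congruent one -/
theorem Good.mod_right {a b b' : R} (h : Good a b) (h1 : a ∣ b' - b) : Good a b' := by
  obtain ⟨t, ht⟩ := h1
  exact (h.add_right t).congr rfl (by linear_combination -ht)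

theorem Good.mod_left {a b a' : R} (h : Good a b) (h1 : b ∣ a' - a) : Good a' b :=
  (h.swap.mod_right h1).swap

theorem Good.neg_left {a b : R} (h : Good a b) : Good (-a) b :=
  ((h.swap.unit_right (u := -1) (v := -1) (by ring)).swap).congr (by ring) rfl

theorem good_int (m n : ℤ) (h : IsCoprime m n) : Good (m : R) (n : R) := by
  have key : ∀ k : ℕ, ∀ m n : ℤ, n.natAbs ≤ k → IsCoprime m n → Good (m : R) (n : R) := by
    intro k
    induction k with
    | zero =>
      intro m n hn h
      have : n = 0 := by omega
      subst this
      have hm : IsUnit m := isCoprime_zero_right.mp h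
      rcases Int.isUnit_iff.mp hm with rfl | rfl
      · simpa using good_one_zero
      · simpa using (good_one_zero (R := R)).neg_left
    | succ k ih =>
      intro m n hn h
      by_cases hn0 : n = 0
      · exact ih m n (by omega) h
      have h1 : IsCoprime n (m % n) := by
        have := h.symm
        rw [← Int.emod_add_mul_ediv m n] at this
        exact IsCoprime.of_add_mul_left_right this
      have h2 := ih n (m % n) (by
        have h3 := Int.emod_lt_abs m hn0
        have h4 := Int.emod_nonneg m hn0
        rw [Int.abs_eq_natAbs] at h3
        omega) h1
      refine (h2.mod_right (b' := (m : R)) ?_).swap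
      exact_mod_cast (Int.cast_dvd_cast (α := R) n (m - m % n) (Int.dvd_self_sub_emod))
  exact key _ m n le_rfl h

end idem
end S7
namespace S7

theorem pow_expand {A : Type*} [CommRing A] (x z : A) (n : ℕ) :
    ∃ κ, (x + z) ^ (n + 1) = x ^ (n + 1) + (n + 1 : ℕ) * x ^ n * z + κ * z ^ 2 := by
  induction n with
  | zero => exact ⟨0, by simp⟩
  | succ n ih =>
    obtain ⟨κ, hκ⟩ := ih
    refine ⟨κ * (x + z) + (n + 1 : ℕ) * x ^ n, ?_⟩
    rw [pow_succ, hκ]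
    push_cast
    ring

theorem one_add_pow_expand {A : Type*} [CommRing A] (z : A) (n : ℕ) :
    ∃ κ, (1 + z) ^ n = 1 + n * z + κ * z ^ 2 := by
  cases n with
  | zero => exact ⟨0, by simp⟩
  | succ n =>
    obtain ⟨κ, h⟩ := pow_expand (1 : A) z n
    exact ⟨κ, by rw [h]; simp⟩

theorem decomp (R : ℕ) (W : ℕ) (hW : W ≠ 0) :
    ∃ A B J : ℕ, W = A * B ∧ A ∣ R ^ J ∧ B.Coprime R := by
  induction W using Nat.recOnMul with
  | zero => exact absurd rfl hW
  | one => exact ⟨1, 1, 0, by simp⟩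
  | prime p hp =>
    by_cases h : p ∣ R
    · exact ⟨p, 1, 1, by simp, by simpa using h, by simp⟩
    · exact ⟨1, p, 0, by simp, by simp, (Nat.Prime.coprime_iff_not_dvd hp).mpr h⟩
  | mul a b iha ihb =>
    obtain ⟨A, B, J, h1, h2, h3⟩ := iha (by rintro rfl; simp at hW)
    obtain ⟨A', B', J', h1', h2', h3'⟩ := ihb (by rintro rfl; simp at hW)
    refine ⟨A * A', B * B', J + J', by rw [h1, h1']; ring, ?_, Nat.Coprime.mul_left h3 h3'⟩
    rw [pow_add]; exact mul_dvd_mul h2 h2'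

/-- Lemma B -/
theorem lemmaB (R q : ℕ) (hR : R ≠ 0) (hq : 2 ≤ q) (hqR : q.Coprime R) :
    ∃ W' J : ℕ, W' ≠ 0 ∧ W' ∣ R ^ J ∧ ∀ p : ℤ, ((W' * R : ℕ) : ℤ) ∣ p - q →
      ∀ i : ℕ, ∃ k : ℕ, (R : ℤ) ^ i ∣ p ^ k - q := by
  set N := Nat.totient (R ^ 2) with hN
  have hNpos : 0 < N := Nat.totient_pos.mpr (by positivity)
  have hmod : q ^ N ≡ 1 [MOD R ^ 2] := Nat.ModEq.pow_totient (hqR.pow_right 2)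
  have hqN : 1 < q ^ N := Nat.one_lt_pow (by omega) (by omega)
  have hdvd : R ^ 2 ∣ q ^ N - 1 := (Nat.modEq_iff_dvd' hqN.le).mp hmod.symm
  obtain ⟨W, j0, J, h1, h2, h3⟩ := decomp R (q ^ N - 1) (by omega)
  have hW0 : W ≠ 0 := by rintro rfl; simp at h1; omega
  refine ⟨W, J, hW0, h2, ?_⟩
  intro p hp
  have hRW : (R : ℤ) ^ 2 ∣ W := by
    rw [h1] at hdvd
    exact_mod_cast (Nat.Coprime.pow_right 2 h3).symm.dvd_of_dvd_mul_right hdvd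
  obtain ⟨V, hV⟩ := hRW
  have hqNW : (q : ℤ) ^ N = 1 + W * j0 := by
    have : q ^ N = 1 + W * j0 := by omega
    exact_mod_cast this
  have hj0 : IsCoprime (j0 : ℤ) R := Nat.isCoprime_iff_coprime.mpr h3
  have hq' : IsCoprime (q : ℤ) R := Nat.isCoprime_iff_coprime.mpr hqR
  have hC : ∀ i : ℕ, ∃ n : ℕ, ∃ j : ℤ, p ^ n = 1 + W * R ^ i * j ∧ IsCoprime j (R : ℤ) := by
    intro i
    induction i with
    | zero =>
      obtain ⟨t, ht⟩ := hp.trans (sub_dvd_pow_sub_pow p (q : ℤ) N)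
      refine ⟨N, j0 + R * t, ?_, ?_⟩
      · push_cast at ht; rw [hqNW] at ht; linear_combination ht
      · exact IsCoprime.add_mul_left_left hj0 t
    | succ i ih =>
      obtain ⟨n, j, hn, hj⟩ := ih
      obtain ⟨κ, hκ⟩ := one_add_pow_expand ((W : ℤ) * R ^ i * j) R
      refine ⟨n * R, j + R * (κ * j ^ 2 * R ^ i * V), ?_, IsCoprime.add_mul_left_left hj _⟩
      rw [pow_mul, hn, hκ]
      have : (W : ℤ) ^ 2 = W * (R ^ 2 * V) := by rw [← hV]; ring
      linear_combination κ * (R : ℤ) ^ (2 * i) * j ^ 2 * this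
  have hD : ∀ i : ℕ, ∃ k : ℕ, (W : ℤ) * R ^ i ∣ p ^ k - q := by
    intro i
    induction i with
    | zero => exact ⟨1, by simpa using (Dvd.intro _ (by push_cast; rfl)).trans hp⟩
    | succ i ih =>
      obtain ⟨k, h, hk⟩ := ih
      obtain ⟨n, j, hn, hj⟩ := hC i
      obtain ⟨x, y, hxy⟩ := IsCoprime.mul_left hq' hj
      have hRpos : (0 : ℤ) < R := by positivity
      obtain ⟨s, hs⟩ : ∃ s : ℕ, (R : ℤ) ∣ s - (-h * x) := by
        refine ⟨((-h * x) % R).toNat, ?_⟩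
        rw [Int.toNat_of_nonneg (Int.emod_nonneg _ hRpos.ne')]
        exact (Int.mod_modEq (-h * x) R).symm.dvd
      obtain ⟨r, hr⟩ := hs
      obtain ⟨κ, hκ⟩ := one_add_pow_expand ((W : ℤ) * R ^ i * j) s
      refine ⟨k + n * s, ?_⟩
      rw [pow_add p, pow_mul p, hn, hκ]
      have hk' : p ^ k = q + W * R ^ i * h := by linear_combination hk
      have hs' : (s : ℤ) = R * r - h * x := by linear_combination hr
      have hx' : x * q * j = 1 - y * R := by linear_combination hxy
      refine ⟨q * j * r + h * y + (h * j * s + p ^ k * κ * j ^ 2) * (R * V * R ^ i), ?_⟩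
      rw [hk']
      have e1 : (W : ℤ) ^ 2 = W * (R ^ 2 * V) := by rw [← hV]; ring
      have e2 : h + q * j * s = R * (q * j * r + h * y) := by
        rw [hs']; linear_combination (-h) * hx'
      linear_combination (W : ℤ) * R ^ i * e2 +
        (h * j * s + (q + W * R ^ i * h) * κ * j ^ 2) * R ^ (2 * i) * e1
  intro i
  obtain ⟨k, hk⟩ := hD i
  exact ⟨k, (Dvd.intro_left _ rfl).trans hk⟩

end S7
namespace S7

open QuadraticAlgebra

section quad
variable {a b : ℤ}

theorem int_dvd_iff (n : ℤ) (z : QuadraticAlgebra ℤ a b) :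
    (n : QuadraticAlgebra ℤ a b) ∣ z ↔ n ∣ z.re ∧ n ∣ z.im := by
  constructor
  · rintro ⟨w, rfl⟩
    simp
  · rintro ⟨⟨x, hx⟩, ⟨y, hy⟩⟩
    exact ⟨⟨x, y⟩, by ext <;> simp [hx, hy]⟩

theorem exists_nat_solve (n : ℤ) (hn : n ≠ 0) (c e : ℤ) (he : IsCoprime e n) :
    ∃ s : ℕ, n ∣ c + s * e := by
  obtain ⟨x, y, hxy⟩ := he
  refine ⟨((-c * x) % n).toNat, ?_⟩
  rw [Int.toNat_of_nonneg (Int.emod_nonneg _ hn)]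
  obtain ⟨r, hr⟩ := (Int.mod_modEq (-c * x) n).symm.dvd
  have : (-c * x) % n = -c * x + n * r := by linear_combination hr
  rw [this]
  exact ⟨c * y + r * e, by linear_combination c * (-hxy)⟩

theorem prime_not_dvd_add {p x y : ℤ} (h : ¬ p ∣ x) : ¬ p ∣ x + p * y := by
  rwa [dvd_add_left (dvd_mul_right p y)]

theorem unit_ladder (p : ℕ) (hp : p.Prime) (w : ℕ) (hw : 2 ≤ w)
    (u v : QuadraticAlgebra ℤ a b) (huv : u * v = 1) (j : ℤ) (hre : ¬ (p : ℤ) ∣ u.re)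
    (him : u.im = p ^ w * j) (hj : ¬ (p : ℤ) ∣ j) (k : ℕ) :
    ∃ (u v : QuadraticAlgebra ℤ a b) (j : ℤ), u * v = 1 ∧ ¬ (p : ℤ) ∣ u.re ∧
      u.im = p ^ (w + k) * j ∧ ¬ (p : ℤ) ∣ j := by
  have hpp : Prime (p : ℤ) := Nat.prime_iff_prime_int.mp hp
  induction k with
  | zero => exact ⟨u, v, j, huv, hre, him, hj⟩
  | succ k ih =>
    obtain ⟨u, v, j, huv, hre, him, hj⟩ := ih
    obtain ⟨n, rfl⟩ : ∃ n, p = n + 1 := ⟨p - 1, by have := hp.pos; omega⟩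
    have hu : u = ((u.re : ℤ) : QuadraticAlgebra ℤ a b) + ⟨0, u.im⟩ := by ext <;> simp
    obtain ⟨κ, hκ⟩ := pow_expand ((u.re : ℤ) : QuadraticAlgebra ℤ a b) ⟨0, u.im⟩ n
    rw [← hu] at hκ
    obtain ⟨t, rfl⟩ : ∃ t, w = t + 2 := ⟨w - 2, by omega⟩
    set P : ℤ := ((n + 1 : ℕ) : ℤ) with hP
    have hz2 : κ * (⟨0, u.im⟩ : QuadraticAlgebra ℤ a b) ^ 2 =
        ((P ^ (t + 2 + k + 1) * P * (P ^ (t + k) * j ^ 2) : ℤ) : QuadraticAlgebra ℤ a b) *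
          (κ * ⟨a, b⟩) := by
      rw [him]
      have : (⟨0, P ^ (t + 2 + k) * j⟩ : QuadraticAlgebra ℤ a b) ^ 2 =
        ((P ^ (t + 2 + k + 1) * P * (P ^ (t + k) * j ^ 2) : ℤ) : QuadraticAlgebra ℤ a b) *
          ⟨a, b⟩ := by
        ext
        · simp only [pow_two, re_mul, re_intCast, im_intCast]; simp; ring
        · simp only [pow_two, im_mul, re_intCast, im_intCast]; simp; ring
      rw [this]; ring
    rw [hz2] at hκ
    set M := κ * (⟨a, b⟩ : QuadraticAlgebra ℤ a b) with hM
    have hpw : ∀ m : ℕ, ((u.re : ℤ) : QuadraticAlgebra ℤ a b) ^ m = ((u.re ^ m : ℤ) : _) := by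
      intro m; push_cast; rfl
    rw [hpw, hpw] at hκ
    have hre' := congrArg QuadraticAlgebra.re hκ
    have him' := congrArg QuadraticAlgebra.im hκ
    simp only [re_add, im_add, re_mul, im_mul, re_intCast, im_intCast, re_natCast, im_natCast]
      at hre' him'
    refine ⟨u ^ (n + 1), v ^ (n + 1),
      u.re ^ n * j + P * (P ^ (t + k) * j ^ 2 * M.im), ?_, ?_, ?_, ?_⟩
    · rw [← mul_pow, huv, one_pow]
    · rw [hre']
      have := prime_not_dvd_add (p := P)
        (y := P ^ (t + 2 + k + 1) * (P ^ (t + k) * j ^ 2) * M.re)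
        (fun h => hre (hpp.dvd_of_dvd_pow (n := n + 1) h))
      convert this using 2
      simp only [Int.cast_id]
      ring
    · rw [him', him]
      have : ((n + 1 : ℕ) : ℤ) = P := rfl
      simp only [Int.cast_id]
      rw [this]
      ring
    · apply prime_not_dvd_add
      intro h
      rcases hpp.dvd_or_dvd h with h | h
      · exact hre (hpp.dvd_of_dvd_pow h)
      · exact hj h

theorem unit_kill (p : ℕ) (hp : p.Prime) (w : ℕ) (hw : 2 ≤ w)
    (u v : QuadraticAlgebra ℤ a b) (huv : u * v = 1) (j : ℤ) (hre : ¬ (p : ℤ) ∣ u.re)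
    (him : u.im = p ^ w * j) (hj : ¬ (p : ℤ) ∣ j) (E : QuadraticAlgebra ℤ a b)
    (hEre : ¬ (p : ℤ) ∣ E.re) (hEim : (p : ℤ) ^ w ∣ E.im) (k : ℕ) :
    ∃ (x y : QuadraticAlgebra ℤ a b), x * y = 1 ∧ ¬ (p : ℤ) ∣ (x * E).re ∧
      (p : ℤ) ^ (w + k) ∣ (x * E).im := by
  have hpp : Prime (p : ℤ) := Nat.prime_iff_prime_int.mp hp
  induction k with
  | zero => exact ⟨1, 1, by simp, by simpa using hEre, by simpa using hEim⟩
  | succ k ih =>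
    obtain ⟨x, y, hxy, hxre, f, hf⟩ := ih
    obtain ⟨g, h, j, hgh, hgre, hgim, hj⟩ := unit_ladder p hp w hw u v huv j hre him hj k
    set F := x * E with hF
    obtain ⟨s, r, hs⟩ := exists_nat_solve (p : ℤ) hpp.ne_zero (g.re * f + F.re * j) (F.re * j)
      (((Prime.coprime_iff_not_dvd hpp).mpr (fun h => by
        rcases hpp.dvd_or_dvd h with h | h
        · exact hxre h
        · exact hj h)).symm)
    have hu : g = ((g.re : ℤ) : QuadraticAlgebra ℤ a b) + ⟨0, g.im⟩ := by ext <;> simp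
    obtain ⟨κ, hκ⟩ := pow_expand ((g.re : ℤ) : QuadraticAlgebra ℤ a b) ⟨0, g.im⟩ s
    rw [← hu] at hκ
    obtain ⟨t, rfl⟩ : ∃ t, w = t + 2 := ⟨w - 2, by omega⟩
    set P : ℤ := (p : ℤ) with hP
    have hz2 : κ * (⟨0, g.im⟩ : QuadraticAlgebra ℤ a b) ^ 2 =
        ((P ^ (t + 2 + k + 1) * (P * P ^ (t + k) * j ^ 2) : ℤ) : QuadraticAlgebra ℤ a b) *
          (κ * ⟨a, b⟩) := by
      rw [hgim]
      have : (⟨0, P ^ (t + 2 + k) * j⟩ : QuadraticAlgebra ℤ a b) ^ 2 =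
        ((P ^ (t + 2 + k + 1) * (P * P ^ (t + k) * j ^ 2) : ℤ) : QuadraticAlgebra ℤ a b) *
          ⟨a, b⟩ := by
        ext
        · simp only [pow_two, re_mul, re_intCast, im_intCast]; simp; ring
        · simp only [pow_two, im_mul, re_intCast, im_intCast]; simp; ring
      rw [this]; ring
    rw [hz2] at hκ
    set M := κ * (⟨a, b⟩ : QuadraticAlgebra ℤ a b) with hM
    have hpw : ∀ m : ℕ, ((g.re : ℤ) : QuadraticAlgebra ℤ a b) ^ m = ((g.re ^ m : ℤ) : _) := by
      intro m; push_cast; rfl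
    rw [hpw, hpw] at hκ
    have hre' := congrArg QuadraticAlgebra.re hκ
    have him' := congrArg QuadraticAlgebra.im hκ
    simp only [re_add, im_add, re_mul, im_mul, re_intCast, im_intCast, re_natCast, im_natCast]
      at hre' him'
    simp at hre' him'
    set Q := P * P ^ (t + k) * j ^ 2
    refine ⟨g ^ (s + 1) * x, h ^ (s + 1) * y, ?_, ?_, ?_⟩
    · rw [mul_mul_mul_comm, ← mul_pow, hgh, hxy]; simp
    · rw [mul_assoc, ← hF, re_mul, hre', hf]
      have := prime_not_dvd_add (p := P)
        (y := P ^ (t + 2 + k) * Q * M.re * F.re + a * (g ^ (s + 1)).im * (P ^ (t + 1 + k) * f))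
        (x := g.re ^ (s + 1) * F.re) (fun h => by
          rcases hpp.dvd_or_dvd h with h | h
          · exact hgre (hpp.dvd_of_dvd_pow h)
          · exact hxre h)
      convert this using 2
      ring
    · rw [mul_assoc, ← hF, im_mul, hre', him', hf, hgim]
      refine ⟨g.re ^ s * r + Q * M.re * (P ^ (t + 2 + k) * f) + Q * M.im * F.re
        + b * (((s : ℤ) + 1) * g.re ^ s * (P * P ^ (t + k) * j) + P ^ (t + 2 + k) * Q * M.im) * f, ?_⟩
      have : g.re * f + (s + 1) * (F.re * j) = P * r := by linear_combination hs
      linear_combination g.re ^ s * P ^ (t + 2 + k) * this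

end quad
end S7
namespace S7

open QuadraticAlgebra

section quad2
variable {a b : ℤ}

theorem pell_pow (x y : ℤ) (hx : 0 < x) (hy : 0 < y) (hD : 0 < b ^ 2 + 4 * a) (n : ℕ) :
    ∃ X Y : ℤ, 0 < X ∧ 0 < Y ∧
      (⟨x - b * y, 2 * y⟩ : QuadraticAlgebra ℤ a b) ^ (n + 1) = ⟨X - b * Y, 2 * Y⟩ := by
  induction n with
  | zero => exact ⟨x, y, hx, hy, by simp⟩
  | succ n ih =>
    obtain ⟨X, Y, hX, hY, h⟩ := ih
    refine ⟨X * x + (b ^ 2 + 4 * a) * Y * y, X * y + Y * x, by positivity, by positivity, ?_⟩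
    rw [pow_succ, h]
    ext <;> simp <;> ring

theorem lemmaA (hD : 0 < b ^ 2 + 4 * a) (hsq : ¬ IsSquare (b ^ 2 + 4 * a)) (p : ℕ)
    (hp : p.Prime) :
    ∃ w : ℕ, ∀ E : QuadraticAlgebra ℤ a b, ¬ (p : ℤ) ∣ E.re → (p : ℤ) ^ w ∣ E.im → ∀ k : ℕ,
      ∃ (x y : QuadraticAlgebra ℤ a b), x * y = 1 ∧ ¬ (p : ℤ) ∣ (x * E).re ∧
      (p : ℤ) ^ k ∣ (x * E).im := by
  have hpp : Prime (p : ℤ) := Nat.prime_iff_prime_int.mp hp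
  obtain ⟨x, y, hxy, hx1, hy1⟩ : ∃ x y : ℤ, x ^ 2 - (b ^ 2 + 4 * a) * y ^ 2 = 1 ∧ 0 < x ∧ 0 < y := by
    obtain ⟨x, y, h, hy⟩ := Pell.exists_of_not_isSquare hD hsq
    refine ⟨|x|, |y|, by simpa [sq_abs] using h, ?_, abs_pos.mpr hy⟩
    apply abs_pos.mpr
    rintro rfl
    have : 0 < y ^ 2 := by positivity
    nlinarith
  set ε : QuadraticAlgebra ℤ a b := ⟨x - b * y, 2 * y⟩ with hε
  set ε' : QuadraticAlgebra ℤ a b := ⟨x + b * y, - (2 * y)⟩ with hε'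
  have hεε' : ε * ε' = 1 := by
    ext
    · simp [hε, hε']; linear_combination hxy
    · simp [hε, hε']; ring
  have hfin : Finite (ZMod (p ^ 2) × ZMod (p ^ 2)) := by
    have : NeZero (p ^ 2) := ⟨pow_ne_zero 2 hp.ne_zero⟩
    infer_instance
  obtain ⟨m, n, hmn, hf⟩ := Finite.exists_ne_map_eq_of_infinite
    (fun n : ℕ => ((((ε ^ n).re : ℤ) : ZMod (p ^ 2)), (((ε ^ n).im : ℤ) : ZMod (p ^ 2))))
  have key : ∃ K : ℕ, ((p ^ 2 : ℤ) : QuadraticAlgebra ℤ a b) ∣ ε ^ (K + 1) - 1 := by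
    wlog hlt : m < n generalizing m n
    · exact this n m (Ne.symm hmn) hf.symm (by omega)
    obtain ⟨K, rfl⟩ : ∃ K, n = m + (K + 1) := ⟨n - m - 1, by omega⟩
    refine ⟨K, ?_⟩
    simp only [Prod.mk.injEq] at hf
    have h1 := (ZMod.intCast_eq_intCast_iff_dvd_sub _ _ _).mp hf.1
    have h2 := (ZMod.intCast_eq_intCast_iff_dvd_sub _ _ _).mp hf.2
    have h3 : ((p ^ 2 : ℤ) : QuadraticAlgebra ℤ a b) ∣ ε ^ (m + (K + 1)) - ε ^ m := by
      rw [int_dvd_iff]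
      exact ⟨by simpa using h1, by simpa using h2⟩
    have h4 : ε ^ (K + 1) - 1 = ε' ^ m * (ε ^ (m + (K + 1)) - ε ^ m) := by
      rw [pow_add ε m, mul_sub, ← mul_assoc, ← mul_pow, mul_comm ε' ε, hεε']; simp
    rw [h4]; exact h3.mul_left _
  obtain ⟨K, hK⟩ := key
  rw [int_dvd_iff] at hK
  obtain ⟨X, Y, hX, hY, hXY⟩ := pell_pow (a := a) (b := b) x y hx1 hy1 hD K
  have him0 : (ε ^ (K + 1)).im ≠ 0 := by rw [hε, hXY]; simp; omega
  obtain ⟨⟨r, hr⟩, ⟨i, hi⟩⟩ := hK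
  simp only [re_sub, im_sub, re_one, im_one, sub_zero] at hr hi
  have hi0 : i ≠ 0 := by rintro rfl; simp at hi; exact him0 hi
  obtain ⟨w, j, hj, hij⟩ : ∃ (w : ℕ) (j : ℤ), i = p ^ w * j ∧ ¬ (p : ℤ) ∣ j := ⟨_, (Int.finiteMultiplicity_iff.mpr ⟨by simpa using hp.ne_one, hi0⟩ :
    FiniteMultiplicity (p : ℤ) i).exists_eq_pow_mul_and_not_dvd⟩
  refine ⟨w + 2, fun E h1 h2 k => ?_⟩
  have := unit_kill p hp (w + 2) (by omega) (ε ^ (K + 1)) (ε' ^ (K + 1))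
    (by rw [← mul_pow, hεε', one_pow]) j ?_ ?_ ?_ E h1 h2 k
  · obtain ⟨x, y, hxy, h3, h4⟩ := this
    exact ⟨x, y, hxy, h3, (pow_dvd_pow _ (by omega)).trans h4⟩
  · have : (ε ^ (K + 1)).re = 1 + p * (p * r) := by linear_combination hr
    rw [this]
    exact prime_not_dvd_add (fun h => hpp.not_isUnit (isUnit_of_dvd_one h))
  · rw [hi]; rw [hj]; ring
  · exact hij

end quad2
end S7
namespace S7

open QuadraticAlgebra

section frob
variable {a b : ℤ}

theorem int_dvd_of_mul {n m : ℤ} (h : IsCoprime n m) {z : QuadraticAlgebra ℤ a b}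
    (hz : (n : QuadraticAlgebra ℤ a b) ∣ m * z) : (n : QuadraticAlgebra ℤ a b) ∣ z := by
  rw [int_dvd_iff] at hz ⊢
  simp at hz
  exact ⟨h.dvd_of_dvd_mul_left hz.1, h.dvd_of_dvd_mul_left hz.2⟩

theorem fermat_int (p : ℕ) (hp : p.Prime) (x : ℤ) : (p : ℤ) ∣ x ^ p - x := by
  have : Fact p.Prime := ⟨hp⟩
  rw [← ZMod.intCast_zmod_eq_zero_iff_dvd]
  push_cast
  rw [ZMod.pow_card, sub_self]

theorem euler_int (p : ℕ) (hp : p.Prime) (x : ℤ) : (p : ℤ) ∣ x ^ (p / 2) - jacobiSym x p := by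
  have : Fact p.Prime := ⟨hp⟩
  rw [← ZMod.intCast_zmod_eq_zero_iff_dvd, ← jacobiSym.legendreSym.to_jacobiSym]
  push_cast
  rw [legendreSym.eq_pow, sub_self]

theorem frob (p : ℕ) (hp : p.Prime) (hodd : Odd p) (e : QuadraticAlgebra ℤ a b) :
    ((p : ℤ) : QuadraticAlgebra ℤ a b) ∣ 2 * e ^ p -
      (((2 * e.re + b * e.im : ℤ) : QuadraticAlgebra ℤ a b) +
        ((e.im * jacobiSym (b ^ 2 + 4 * a) p : ℤ) : QuadraticAlgebra ℤ a b) * ⟨-b, 2⟩) := by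
  set θ : QuadraticAlgebra ℤ a b := ⟨-b, 2⟩ with hθ
  set T : ℤ := 2 * e.re + b * e.im with hT
  set Y : ℤ := e.im with hY
  set D : ℤ := b ^ 2 + 4 * a with hD
  set s : ℤ := jacobiSym D p with hs
  have h2e : (2 : QuadraticAlgebra ℤ a b) * e = (T : QuadraticAlgebra ℤ a b) + (Y : QuadraticAlgebra ℤ a b) * θ := by
    ext
    · simp [hT, hθ, hY, -Int.cast_mul]; ring
    · simp [hT, hθ, hY, -Int.cast_mul]; ring
  have hθ2 : θ ^ 2 = (D : QuadraticAlgebra ℤ a b) := by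
    ext
    · simp [hθ, hD, pow_two, -Int.cast_mul]; ring
    · simp [hθ, hD, pow_two, -Int.cast_mul]; ring
  have hθp : θ ^ p = ((D ^ (p / 2) : ℤ) : QuadraticAlgebra ℤ a b) * θ := by
    obtain ⟨k, hk⟩ := hodd
    have : p / 2 = k := by omega
    rw [this, hk, pow_succ, pow_mul, hθ2]; push_cast; rfl
  obtain ⟨r, hr⟩ := exists_add_pow_prime_eq hp (T : QuadraticAlgebra ℤ a b) ((Y : QuadraticAlgebra ℤ a b) * θ)
  rw [← h2e, mul_pow, mul_pow, hθp] at hr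
  have cast : ∀ {x : ℤ}, (p : ℤ) ∣ x → ((p : ℤ) : QuadraticAlgebra ℤ a b) ∣ (x : QuadraticAlgebra ℤ a b) := fun h => Int.cast_dvd_cast _ _ h
  have c1 := cast (fermat_int p hp T)
  have c2 := cast (fermat_int p hp Y)
  have c3 := cast (fermat_int p hp 2)
  have c4 := cast (euler_int p hp D)
  have c5 : ((p : ℤ) : QuadraticAlgebra ℤ a b) ∣ ((p : ℕ) : QuadraticAlgebra ℤ a b) := by simp
  obtain ⟨t1, h1⟩ := c1
  obtain ⟨t2, h2⟩ := c2
  obtain ⟨t3, h3⟩ := c3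
  obtain ⟨t4, h4⟩ := c4
  push_cast at *
  refine ⟨-t3 * e ^ p + t1 + t2 * D ^ (p / 2) * θ + Y * t4 * θ + (T * (Y * θ) * r), ?_⟩
  linear_combination (-e ^ p) * h3 + h1 + (D : QuadraticAlgebra ℤ a b) ^ (p / 2) * θ * h2 + Y * θ * h4 + hr

theorem two_coprime_odd {p : ℕ} (h : Odd p) : IsCoprime (p : ℤ) 2 := by
  obtain ⟨k, hk⟩ := h
  exact ⟨1, -k, by rw [hk]; push_cast; ring⟩

theorem norm_val (e : QuadraticAlgebra ℤ a b) :
    norm e = e.re ^ 2 + b * e.re * e.im - a * e.im ^ 2 := by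
  rw [norm_def]; ring

theorem mul_star_eq (e : QuadraticAlgebra ℤ a b) :
    e * star e = ((norm e : ℤ) : QuadraticAlgebra ℤ a b) := by
  rw [norm_val]
  ext <;> simp only [re_mul, im_mul, re_star, im_star, re_intCast, im_intCast, Int.cast_id] <;> ring

theorem frob_inert (p : ℕ) (hp : p.Prime) (hodd : Odd p)
    (hJ : jacobiSym (b ^ 2 + 4 * a) p = -1) (e : QuadraticAlgebra ℤ a b) :
    ((p : ℤ) : QuadraticAlgebra ℤ a b) ∣ e ^ (p + 1) - ((norm e : ℤ) : QuadraticAlgebra ℤ a b) := by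
  have h := frob p hp hodd e
  rw [hJ] at h
  have h1 : ((p : ℤ) : QuadraticAlgebra ℤ a b) ∣ ((2 : ℤ) : QuadraticAlgebra ℤ a b) *
      (e ^ p - star e) := by
    convert h using 1
    have : ((2 : ℤ) : QuadraticAlgebra ℤ a b) * star e =
      ((2 * e.re + b * e.im : ℤ) : QuadraticAlgebra ℤ a b) +
        ((e.im * -1 : ℤ) : QuadraticAlgebra ℤ a b) * ⟨-b, 2⟩ := by
      ext <;> simp <;> ring
    rw [mul_sub, this]; push_cast; rfl
  have h2 := int_dvd_of_mul (two_coprime_odd hodd) h1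
  rw [← mul_star_eq]
  have : e ^ (p + 1) - e * star e = e * (e ^ p - star e) := by ring
  rw [this]
  exact h2.mul_left _

theorem frob_split (p : ℕ) (hp : p.Prime) (hodd : Odd p)
    (hJ : jacobiSym (b ^ 2 + 4 * a) p = 1) (e : QuadraticAlgebra ℤ a b)
    (he : IsCoprime (p : ℤ) (norm e)) :
    ((p : ℤ) : QuadraticAlgebra ℤ a b) ∣ e ^ (p - 1) - 1 := by
  have h := frob p hp hodd e
  rw [hJ] at h
  have h1 : ((p : ℤ) : QuadraticAlgebra ℤ a b) ∣ ((2 : ℤ) : QuadraticAlgebra ℤ a b) *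
      (e ^ p - e) := by
    convert h using 1
    have : ((2 : ℤ) : QuadraticAlgebra ℤ a b) * e =
      ((2 * e.re + b * e.im : ℤ) : QuadraticAlgebra ℤ a b) +
        ((e.im * 1 : ℤ) : QuadraticAlgebra ℤ a b) * ⟨-b, 2⟩ := by
      ext <;> simp <;> ring
    rw [mul_sub, this]; push_cast; rfl
  have h2 := int_dvd_of_mul (two_coprime_odd hodd) h1
  apply int_dvd_of_mul he
  rw [← mul_star_eq]
  have : e * star e * (e ^ (p - 1) - 1) = star e * (e ^ p - e) := by
    obtain ⟨k, rfl⟩ : ∃ k, p = k + 1 := ⟨p - 1, by have := hp.pos; omega⟩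
    simp only [Nat.add_sub_cancel]
    ring
  rw [this]
  exact h2.mul_left _

end frob
end S7
namespace S7

open QuadraticAlgebra

theorem crt_int {A B : ℤ} (h : IsCoprime A B) (u v : ℤ) : ∃ c : ℤ, A ∣ c - u ∧ B ∣ c - v := by
  obtain ⟨x, y, hxy⟩ := h
  refine ⟨u * (y * B) + v * (x * A), ⟨x * (v - u), ?_⟩, ⟨y * (u - v), ?_⟩⟩
  · linear_combination u * hxy
  · linear_combination v * hxy

theorem isCoprime_of_dvd_sub {A c u : ℤ} (h : A ∣ c - u) (hu : IsCoprime u A) : IsCoprime c A := by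
  obtain ⟨t, ht⟩ := h
  have : c = u + A * t := by linear_combination ht
  rw [this]; exact IsCoprime.add_mul_left_left hu t

theorem dirichlet1 {A : ℤ} (hA : A ≠ 0) (u : ℤ) (hu : IsCoprime u A) (n : ℕ) :
    ∃ p : ℕ, n < p ∧ p.Prime ∧ A ∣ p - u := by
  obtain ⟨p, h1, h2, h3⟩ := Nat.forall_exists_prime_gt_and_zmodEq n (q := A.natAbs) (a := u)
    (by simpa using hA) (by
      rcases Int.natAbs_eq A with h | h
      · rwa [← h]
      · rw [h] at hu; exact (IsCoprime.neg_right_iff _ _).mp hu)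
  refine ⟨p, h1, h2, ?_⟩
  have := h3.symm.dvd
  rwa [Int.natAbs_dvd] at this

theorem dirichlet2 {A B : ℤ} (hA : A ≠ 0) (hB : B ≠ 0) (hAB : IsCoprime A B) (u v : ℤ)
    (hu : IsCoprime u A) (hv : IsCoprime v B) (n : ℕ) :
    ∃ p : ℕ, n < p ∧ p.Prime ∧ A ∣ p - u ∧ B ∣ p - v := by
  obtain ⟨c, h1, h2⟩ := crt_int hAB u v
  have hc : IsCoprime c (A * B) :=
    IsCoprime.mul_right (isCoprime_of_dvd_sub h1 hu) (isCoprime_of_dvd_sub h2 hv)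
  obtain ⟨p, h3, h4, h5⟩ := dirichlet1 (mul_ne_zero hA hB) c hc n
  refine ⟨p, h3, h4, ?_, ?_⟩
  · have := dvd_add ((dvd_mul_right A B).trans h5) h1
    simpa using this
  · have := dvd_add ((dvd_mul_left B A).trans h5) h2
    simpa using this

theorem jac_congr {D : ℤ} {p r : ℕ} (hp : Odd p) (hr : Odd r) (h : (4 * D) ∣ (p : ℤ) - r) :
    jacobiSym D p = jacobiSym D r := by
  rw [jacobiSym.mod_right D hp, jacobiSym.mod_right D hr]
  congr 1
  have : r ≡ p [MOD 4 * D.natAbs] := by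
    rw [Nat.modEq_iff_dvd]
    push_cast
    have h4 : (4 : ℤ) * |D| = |4 * D| := by rw [abs_mul]; rfl
    rw [h4, abs_dvd]; exact h
  exact this.symm

theorem jac_neg_one {D : ℤ} (hD : 0 < D) {p : ℕ} (h : (4 * D) ∣ (p : ℤ) + 1) :
    jacobiSym D p = 1 := by
  obtain ⟨d, rfl⟩ : ∃ d : ℕ, D = d := ⟨D.toNat, by omega⟩
  have hd : 0 < d := by exact_mod_cast hD
  have hp : Odd p := by
    obtain ⟨t, ht⟩ := h
    have : Odd (p : ℤ) := ⟨2 * d * t - 1, by linear_combination ht⟩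
    exact_mod_cast this
  have hr : Odd (4 * d - 1) := ⟨2 * d - 1, by omega⟩
  have hcast : ((4 * d - 1 : ℕ) : ℤ) = 4 * d - 1 := by
    rw [Nat.cast_sub (by omega)]; push_cast; ring
  rw [jac_congr hp hr (by
    rw [hcast]
    obtain ⟨t, ht⟩ := h
    exact ⟨t - 1, by linear_combination ht⟩)]
  have h4 : jacobiSym (4 * d : ℤ) (4 * d - 1) = 1 := by
    rw [jacobiSym.mod_left' (a₂ := 1), jacobiSym.one_left]
    have : (4 * d : ℤ) = 1 + ((4 * d - 1 : ℕ) : ℤ) := by rw [hcast]; ring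
    rw [this, Int.add_emod_right]
  have h2 : jacobiSym 2 (4 * d - 1) * jacobiSym 2 (4 * d - 1) = 1 := by
    have : (2 : ℤ).gcd ((4 * d - 1 : ℕ) : ℤ) = 1 := by
      rw [← Int.isCoprime_iff_gcd_eq_one]
      exact (two_coprime_odd hr).symm
    rcases jacobiSym.eq_one_or_neg_one this with h | h <;> rw [h] <;> norm_num
  have : (4 * d : ℤ) = 2 * 2 * d := by ring
  rw [this, jacobiSym.mul_left, jacobiSym.mul_left, h2, one_mul] at h4
  exact h4

section core
variable {a b : ℤ}

theorem dvd_norm_self (e : QuadraticAlgebra ℤ a b) :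
    e ∣ ((norm e : ℤ) : QuadraticAlgebra ℤ a b) := ⟨star e, (mul_star_eq e).symm⟩

theorem core (hD : 0 < b ^ 2 + 4 * a) (hsq : ¬ IsSquare (b ^ 2 + 4 * a)) (q : ℕ) (hq : q.Prime)
    (hqodd : Odd q) (hJ : jacobiSym (b ^ 2 + 4 * a) q = -1) (e : QuadraticAlgebra ℤ a b) (m : ℤ)
    (hR4 : IsCoprime (m * norm e) (4 * (b ^ 2 + 4 * a))) (hRq : IsCoprime (m * norm e) q) :
    Good (q : QuadraticAlgebra ℤ a b) (m * e ^ 2) := by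
  set D : ℤ := b ^ 2 + 4 * a with hDdef
  set Ne : ℤ := norm e with hNe
  set R : ℕ := (m * Ne).natAbs with hR
  have hRabs : (R : ℤ) ∣ m * Ne ∧ m * Ne ∣ (R : ℤ) := by
    constructor
    · rw [hR, Int.natAbs_dvd]
    · rw [hR, Int.dvd_natAbs]
  have hcopR : ∀ {x : ℤ}, IsCoprime (m * Ne) x → IsCoprime (R : ℤ) x := fun h =>
    h.of_isCoprime_of_dvd_left hRabs.1
  have hR4' : IsCoprime (R : ℤ) (4 * D) := hcopR hR4
  have hRq' : IsCoprime (R : ℤ) q := hcopR hRq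
  have hR0 : R ≠ 0 := by
    intro h
    rw [h] at hR4'
    have := isCoprime_zero_left.mp (by simpa using hR4')
    rcases Int.isUnit_iff.mp this with h | h <;> omega
  have hR2 : ¬ 2 ∣ R := by
    intro h
    have h1 : (2 : ℤ) ∣ R := by exact_mod_cast h
    have h2 : (2 : ℤ) ∣ 4 * D := ⟨2 * D, by ring⟩
    have := (hR4'.isUnit_of_dvd' h1 h2)
    rcases Int.isUnit_iff.mp this with h | h <;> omega
  obtain ⟨W, J, hW0, hWR, hB⟩ := lemmaB R q hR0 hq.two_le
    (Nat.isCoprime_iff_coprime.mp hRq'.symm)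
  obtain ⟨Q2, Q1, J', hQ, hQ2, hQ1⟩ := decomp R (4 * D.natAbs * (q + 1)) (by
    have : D.natAbs ≠ 0 := by omega
    positivity)
  have hQ1R : IsCoprime (Q1 : ℤ) R := Nat.isCoprime_iff_coprime.mpr hQ1
  have hQ10 : Q1 ≠ 0 := by
    rintro rfl
    have : D.natAbs ≠ 0 := by omega
    simp at hQ; omega
  have hQint : (4 * D) * (q + 1) = Q2 * Q1 := by
    have : ((4 * D.natAbs * (q + 1) : ℕ) : ℤ) = Q2 * Q1 := by rw [hQ]; push_cast; rfl
    rw [← this]; push_cast; rw [abs_of_pos hD]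
  have h4D : (4 * D) ∣ (Q1 : ℤ) := by
    have h1 : IsCoprime (4 * D) (Q2 : ℤ) := by
      have : IsCoprime (4 * D) ((R : ℤ) ^ J') := (hR4'.symm).pow_right
      exact this.of_isCoprime_of_dvd_right (by exact_mod_cast hQ2)
    exact h1.dvd_of_dvd_mul_left ⟨_, hQint.symm⟩
  have hWRpow : ((W * R : ℕ) : ℤ) ∣ (R : ℤ) ^ (J + 1) := by
    rw [pow_succ]; push_cast; exact mul_dvd_mul (by exact_mod_cast hWR) dvd_rfl
  obtain ⟨p, hpbig, hp, hp1, hp2⟩ := dirichlet2 (A := Q1) (B := (W * R : ℕ))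
    (by exact_mod_cast hQ10) (by exact_mod_cast mul_ne_zero hW0 hR0)
    ((hQ1R.pow_right (n := J + 1)).of_isCoprime_of_dvd_right hWRpow) (-1) q
    (isCoprime_one_left.neg_left)
    (((hRq'.symm).pow_right (n := J + 1)).of_isCoprime_of_dvd_right hWRpow)
    (q + 1 + R)
  have hpp : Prime (p : ℤ) := Nat.prime_iff_prime_int.mp hp
  have hp4D : (4 * D) ∣ (p : ℤ) + 1 := by simpa using h4D.trans hp1
  obtain ⟨h, hh, hhodd⟩ : ∃ h : ℕ, p = 2 * h + 1 ∧ Odd h := by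
    obtain ⟨t, ht⟩ := hp4D
    have h4 : (4 : ℤ) ∣ p + 1 := ⟨D * t, by linear_combination ht⟩
    have : 4 ∣ p + 1 := by exact_mod_cast h4
    exact ⟨p / 2, by omega, ⟨p / 4, by omega⟩⟩
  have hpodd : Odd p := ⟨h, hh⟩
  have hJp : jacobiSym D p = 1 := jac_neg_one hD hp4D
  have hpR : IsCoprime (p : ℤ) (m * Ne) := by
    refine (Prime.coprime_iff_not_dvd hpp).mpr (fun hdvd => ?_)
    have h1 : (p : ℤ) ∣ R := hdvd.trans hRabs.2
    have h2 : p ∣ R := by exact_mod_cast h1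
    have := Nat.le_of_dvd (Nat.pos_of_ne_zero hR0) h2
    omega
  have hpm : IsCoprime (p : ℤ) m := hpR.of_isCoprime_of_dvd_right (dvd_mul_right _ _)
  have hpN : IsCoprime (p : ℤ) Ne := hpR.of_isCoprime_of_dvd_right (dvd_mul_left _ _)
  obtain ⟨w, hw⟩ := lemmaA (a := a) (b := b) hD hsq p hp
  have hcop : Nat.Coprime (h * p ^ w) (q + 1) := by
    apply Nat.Coprime.mul_left
    · apply Nat.coprime_of_dvd
      intro l hl h1 h2
      have hl2 : l ≠ 2 := by
        rintro rfl
        exact (Nat.not_even_iff_odd.mpr hhodd) (even_iff_two_dvd.mpr h1)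
      have hp1' : (l : ℤ) ∣ (p : ℤ) + 1 := by
        have h3 : (l : ℤ) ∣ Q2 * Q1 := by
          rw [← hQint]
          exact Dvd.dvd.mul_left (by exact_mod_cast h2) _
        have hlp : Prime (l : ℤ) := Nat.prime_iff_prime_int.mp hl
        rcases hlp.dvd_or_dvd h3 with h4 | h4
        · have h5 : (l : ℤ) ∣ R :=
            hlp.dvd_of_dvd_pow (h4.trans (by exact_mod_cast hQ2 : (Q2 : ℤ) ∣ (R : ℤ) ^ J'))
          have h6 : (l : ℤ) ∣ p - q := h5.trans ((by push_cast; exact dvd_mul_left _ _ :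
            (R : ℤ) ∣ ((W * R : ℕ) : ℤ)).trans hp2)
          have h7 : (l : ℤ) ∣ (q : ℤ) + 1 := by exact_mod_cast h2
          have h8 := dvd_add h6 h7
          have h9 : (p : ℤ) - q + (q + 1) = p + 1 := by ring
          rwa [h9] at h8
        · simpa using h4.trans hp1
      have hp2' : l ∣ p + 1 := by exact_mod_cast hp1'
      have : l ∣ 2 := by
        have h8 : l ∣ (p + 1) - 2 * h := Nat.dvd_sub hp2' (h1.mul_left 2)
        have : p + 1 - 2 * h = 2 := by omega
        rwa [this] at h8
      exact hl2 ((Nat.prime_dvd_prime_iff_eq hl Nat.prime_two).mp this)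
    · apply Nat.Coprime.pow_left
      rw [Nat.Prime.coprime_iff_not_dvd hp]
      intro h1
      have := Nat.le_of_dvd (by omega) h1
      omega
  obtain ⟨s0, s1, hs⟩ := exists_nat_solve ((q + 1 : ℕ) : ℤ) (by positivity) (-1)
    ((h * p ^ w : ℕ) : ℤ) (Nat.isCoprime_iff_coprime.mpr hcop)
  obtain ⟨s', rfl⟩ : ∃ s' : ℕ, s1 = s' := by
    refine ⟨s1.toNat, (Int.toNat_of_nonneg ?_).symm⟩
    by_contra hneg
    have h1 : s1 ≤ -1 := by omega
    have h2 : (0 : ℤ) ≤ s0 * ((h * p ^ w : ℕ) : ℤ) := by positivity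
    have h3 : (2 : ℤ) ≤ ((q + 1 : ℕ) : ℤ) := by have := hq.two_le; push_cast; omega
    nlinarith
  have hs' : s0 * (h * p ^ w) = 1 + (q + 1) * s' := by
    zify; push_cast at hs; linear_combination hs
  set l : ℕ := (p - 1) * s0 * p ^ w with hl
  have hl2 : l = 2 + (q + 1) * (2 * s') := by
    have : p - 1 = 2 * h := by omega
    rw [hl, this]; linear_combination 2 * hs'
  have hE : (((p : ℤ) ^ (w + 1) : ℤ) : QuadraticAlgebra ℤ a b) ∣ e ^ l - 1 := by
    have h1 := frob_split p hp hpodd hJp e hpN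
    have h2 : ((p : ℤ) : QuadraticAlgebra ℤ a b) ∣ e ^ ((p - 1) * s0) - 1 := by
      rw [pow_mul]
      have := sub_dvd_pow_sub_pow (e ^ (p - 1)) 1 s0
      rw [one_pow] at this
      exact h1.trans this
    have h3 := dvd_sub_pow_of_dvd_sub (R := QuadraticAlgebra ℤ a b) (p := p) (a := e ^ ((p - 1) * s0)) (b := 1)
      (by simpa using h2) w
    rw [one_pow, ← pow_mul] at h3
    rw [hl]
    simpa using h3
  rw [int_dvd_iff] at hE
  simp only [re_sub, im_sub, re_one, im_one, sub_zero] at hE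
  set j : ℕ := (q - 2) * (2 * s') with hj
  obtain ⟨k, hk⟩ := hB p hp2 (1 + j + l)
  obtain ⟨u, v, huv, hi, him⟩ := hw (e ^ l) (by
    intro h1
    have h2 : (p : ℤ) ∣ (e ^ l).re - 1 := (dvd_pow_self _ (by omega)).trans hE.1
    have := dvd_sub h1 h2
    simp only [sub_sub_cancel] at this
    exact hpp.not_isUnit (isUnit_of_dvd_one this)) ((pow_dvd_pow _ (by omega)).trans hE.2) k
  have g1 : Good (((p : ℤ) ^ k : ℤ) : QuadraticAlgebra ℤ a b)
      ((m * Ne ^ j * (u * e ^ l).re : ℤ) : QuadraticAlgebra ℤ a b) := by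
    apply good_int
    apply IsCoprime.pow_left
    exact (hpm.mul_right hpN.pow_right).mul_right ((Prime.coprime_iff_not_dvd hpp).mpr hi)
  have g2 : Good (((p : ℤ) ^ k : ℤ) : QuadraticAlgebra ℤ a b)
      (((m * Ne ^ j : ℤ) : QuadraticAlgebra ℤ a b) * (u * e ^ l)) := by
    refine g1.mod_right ?_
    have : ((m * Ne ^ j : ℤ) : QuadraticAlgebra ℤ a b) * (u * e ^ l) -
        ((m * Ne ^ j * (u * e ^ l).re : ℤ) : QuadraticAlgebra ℤ a b) =
        ((m * Ne ^ j : ℤ) : QuadraticAlgebra ℤ a b) *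
          (u * e ^ l - (((u * e ^ l).re : ℤ) : QuadraticAlgebra ℤ a b)) := by
      push_cast; ring
    rw [this]
    apply Dvd.dvd.mul_left
    rw [int_dvd_iff]
    constructor
    · rw [re_sub, re_intCast]; simp
    · rw [im_sub, im_intCast, sub_zero]; exact him
  have g3 : Good (((p : ℤ) ^ k : ℤ) : QuadraticAlgebra ℤ a b)
      (((m * Ne ^ j : ℤ) : QuadraticAlgebra ℤ a b) * e ^ l) :=
    (g2.unit_right (u := v) (v := u) (by rw [mul_comm, huv])).congr rfl (by
      linear_combination ((m * Ne ^ j : ℤ) : QuadraticAlgebra ℤ a b) * e ^ l * huv)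
  have g4 : Good (q : QuadraticAlgebra ℤ a b)
      (((m * Ne ^ j : ℤ) : QuadraticAlgebra ℤ a b) * e ^ l) := by
    refine g3.mod_left ?_
    have c0 : ∀ {x y : ℤ}, x ∣ y → (x : QuadraticAlgebra ℤ a b) ∣ (y : QuadraticAlgebra ℤ a b) :=
      fun h => Int.cast_dvd_cast _ _ h
    have c1 : (((R : ℤ) ^ (1 + j + l) : ℤ) : QuadraticAlgebra ℤ a b) ∣
        (((p : ℤ) ^ k - q : ℤ) : QuadraticAlgebra ℤ a b) := c0 hk
    have c2 : ((m * Ne ^ j : ℤ) : QuadraticAlgebra ℤ a b) * e ^ l ∣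
        (((R : ℤ) ^ (1 + j + l) : ℤ) : QuadraticAlgebra ℤ a b) := by
      have hm : m ∣ (R : ℤ) ^ 1 := by rw [pow_one]; exact (dvd_mul_right _ _).trans hRabs.2
      have hN : Ne ∣ (R : ℤ) := (dvd_mul_left _ _).trans hRabs.2
      have := mul_dvd_mul (c0 (mul_dvd_mul hm (pow_dvd_pow_of_dvd hN j)))
        (pow_dvd_pow_of_dvd ((dvd_norm_self e).trans (c0 hN)) l)
      convert this using 1
      push_cast
      ring
    have := (c2.trans c1)
    rw [← dvd_neg] at this
    convert this using 1
    push_cast; ring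
  have hqN : IsCoprime (q : ℤ) Ne := (hRq.of_isCoprime_of_dvd_left (dvd_mul_left _ _)).symm
  refine g4.mod_right ?_
  obtain ⟨t1, ht1⟩ : ((q : ℤ) : QuadraticAlgebra ℤ a b) ∣
      (e ^ (q + 1)) ^ (2 * s') - ((Ne : ℤ) : QuadraticAlgebra ℤ a b) ^ (2 * s') :=
    (frob_inert q hq hqodd hJ e).trans (sub_dvd_pow_sub_pow _ _ _)
  obtain ⟨t2, ht2⟩ : (q : ℤ) ∣ Ne ^ (j + 2 * s') - 1 := by
    have h1 : Ne ^ (q - 1) ≡ 1 [ZMOD q] :=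
      Int.ModEq.pow_card_sub_one_eq_one hq hqN.symm
    have h2 : j + 2 * s' = (q - 1) * (2 * s') := by
      rw [hj]
      obtain ⟨r, hr⟩ : ∃ r, q = r + 2 := ⟨q - 2, by have := hq.two_le; omega⟩
      rw [hr]; simp only [Nat.add_sub_cancel]
      have : r + 2 - 1 = r + 1 := rfl
      rw [this]; ring
    rw [h2, pow_mul]
    have := (h1.pow (2 * s')).symm.dvd
    simpa using this
  have ht2' : ((Ne : ℤ) : QuadraticAlgebra ℤ a b) ^ (j + 2 * s') - 1 = (q : QuadraticAlgebra ℤ a b) * t2 := by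
    have := congrArg (fun z : ℤ => (z : QuadraticAlgebra ℤ a b)) ht2
    push_cast at this
    exact this
  rw [hl2]
  refine ⟨- m * (t1 * Ne ^ j * e ^ 2 + t2 * e ^ 2), ?_⟩
  push_cast at ht1 ⊢
  rw [pow_add, pow_mul]
  rw [pow_add] at ht2'
  linear_combination (-m * Ne ^ j * e ^ 2 : QuadraticAlgebra ℤ a b) * ht1 - m * e ^ 2 * ht2'

end core
end S7
namespace S7

open QuadraticAlgebra

section red
variable {a b : ℤ}

theorem norm_congr {n : ℤ} {e f : QuadraticAlgebra ℤ a b}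
    (h : (n : QuadraticAlgebra ℤ a b) ∣ e - f) : n ∣ norm e - norm f := by
  rw [int_dvd_iff] at h
  obtain ⟨⟨x, hx⟩, ⟨y, hy⟩⟩ := h
  simp only [re_sub, im_sub] at hx hy
  have hx' : e.re = f.re + n * x := by linear_combination hx
  have hy' : e.im = f.im + n * y := by linear_combination hy
  rw [norm_val, norm_val, hx', hy']
  exact ⟨2 * f.re * x + n * x ^ 2 + b * (f.re * y + x * f.im + n * x * y)
    - a * (2 * f.im * y + n * y ^ 2), by ring⟩

theorem crt_quad {A B : ℤ} (h : IsCoprime A B) (u v : QuadraticAlgebra ℤ a b) :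
    ∃ c : QuadraticAlgebra ℤ a b, (A : QuadraticAlgebra ℤ a b) ∣ c - u ∧
      (B : QuadraticAlgebra ℤ a b) ∣ c - v := by
  obtain ⟨x, hx1, hx2⟩ := crt_int h u.re v.re
  obtain ⟨y, hy1, hy2⟩ := crt_int h u.im v.im
  exact ⟨⟨x, y⟩, by rw [int_dvd_iff]; exact ⟨hx1, hy1⟩, by rw [int_dvd_iff]; exact ⟨hx2, hy2⟩⟩

theorem isCoprime_of_jac {D : ℤ} {q : ℕ} (hq : q ≠ 0) (h : jacobiSym D q = -1) :
    IsCoprime D q := by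
  rw [Int.isCoprime_iff_gcd_eq_one]
  have : NeZero q := ⟨hq⟩
  by_contra hg
  rw [jacobiSym.eq_zero_iff_not_coprime.mpr hg] at h
  norm_num at h

theorem odd_coprime_four {q : ℕ} (h : Odd q) : IsCoprime (q : ℤ) 4 := by
  have := two_coprime_odd h
  have h4 : (4 : ℤ) = 2 * 2 := by norm_num
  rw [h4]; exact this.mul_right this

theorem step4 (hD : 0 < b ^ 2 + 4 * a) (hsq : ¬ IsSquare (b ^ 2 + 4 * a)) (q : ℕ) (hq : q.Prime)
    (hqodd : Odd q) (hJ : jacobiSym (b ^ 2 + 4 * a) q = -1) (c : QuadraticAlgebra ℤ a b) (s : ℤ)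
    (hs : (q : ℤ) ∣ norm c - s ^ 2) (hc : ¬ (q : ℤ) ∣ norm c) :
    Good (q : QuadraticAlgebra ℤ a b) c := by
  have hqp : Prime (q : ℤ) := Nat.prime_iff_prime_int.mp hq
  have hq4D : IsCoprime (q : ℤ) (4 * (b ^ 2 + 4 * a)) :=
    (odd_coprime_four hqodd).mul_right (isCoprime_of_jac hq.ne_zero hJ).symm
  set T : ℤ := 2 * c.re + b * c.im with hT
  have hs0 : ¬ (q : ℤ) ∣ s := fun h => hc (by
    have := dvd_add hs (h.mul_left s)
    have h2 : norm c - s ^ 2 + s * s = norm c := by ring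
    rwa [h2] at this)
  wlog hτ : ¬ (q : ℤ) ∣ T + 2 * s generalizing s
  · have hτ' : (q : ℤ) ∣ T + 2 * s := not_not.mp hτ
    refine this (-s) (by simpa using hs) (by simpa using hs0) (fun h => ?_)
    have h1 := dvd_sub hτ' h
    have h2 : T + 2 * s - (T + 2 * -s) = 4 * s := by ring
    rw [h2] at h1
    exact hs0 ((odd_coprime_four hqodd).dvd_of_dvd_mul_left h1)
  obtain ⟨m0, y0, hm0⟩ := ((Prime.coprime_iff_not_dvd hqp).mpr hτ).symm
  obtain ⟨e, he1, he2⟩ := crt_quad hq4D (c + (s : QuadraticAlgebra ℤ a b)) 1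
  obtain ⟨m, hm1, hm2⟩ := crt_int hq4D m0 1
  have hNe0 : norm (c + (s : QuadraticAlgebra ℤ a b)) = norm c + s * T + s ^ 2 := by
    rw [norm_val, norm_val, hT]; simp only [re_add, im_add, re_intCast, im_intCast, Int.cast_id]
    ring
  have hNe : IsCoprime (norm e) (q : ℤ) := by
    apply isCoprime_of_dvd_sub (norm_congr he1)
    apply ((Prime.coprime_iff_not_dvd hqp).mpr _).symm
    intro h
    rw [hNe0] at h
    have h1 := dvd_sub h hs
    have h2 : norm c + s * T + s ^ 2 - (norm c - s ^ 2) = s * (T + 2 * s) := by ring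
    rw [h2] at h1
    rcases hqp.dvd_or_dvd h1 with h | h
    · exact hs0 h
    · exact hτ h
  have hmq : IsCoprime m (q : ℤ) := isCoprime_of_dvd_sub hm1 ⟨T + 2 * s, y0, by linear_combination hm0⟩
  have g := core hD hsq q hq hqodd hJ e m
    (IsCoprime.mul_left (isCoprime_of_dvd_sub hm2 isCoprime_one_left)
      (isCoprime_of_dvd_sub (by simpa using norm_congr he2) isCoprime_one_left))
    (IsCoprime.mul_left hmq hNe)
  refine g.mod_right ?_
  obtain ⟨t1, ht1⟩ := he1
  obtain ⟨t2, ht2⟩ : ((q : ℤ) : QuadraticAlgebra ℤ a b) ∣ ((m - m0 : ℤ) : QuadraticAlgebra ℤ a b) :=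
    Int.cast_dvd_cast _ _ hm1
  obtain ⟨t3, ht3⟩ : ((q : ℤ) : QuadraticAlgebra ℤ a b) ∣
    ((norm c - s ^ 2 : ℤ) : QuadraticAlgebra ℤ a b) := Int.cast_dvd_cast _ _ hs
  have hc2 : c ^ 2 = (T : QuadraticAlgebra ℤ a b) * c - ((norm c : ℤ) : QuadraticAlgebra ℤ a b) := by
    rw [norm_val]
    ext <;> simp only [pow_two, re_mul, im_mul, re_sub, im_sub, re_intCast, im_intCast, Int.cast_id, hT] <;> ring
  have hm0' : (m0 : QuadraticAlgebra ℤ a b) * (T + 2 * s) + y0 * q = 1 := by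
    have := congrArg (fun z : ℤ => (z : QuadraticAlgebra ℤ a b)) hm0
    push_cast at this
    exact this
  push_cast at ht1 ht2 ht3
  set f : QuadraticAlgebra ℤ a b := c + s with hf
  have hf2 : f ^ 2 = c * (T + 2 * s) - q * t3 := by
    rw [hf]; linear_combination hc2 - ht3
  have hef : e = f + q * t1 := by linear_combination ht1
  have hmm : (m : QuadraticAlgebra ℤ a b) = m0 + q * t2 := by linear_combination ht2
  rw [hef, hmm]
  refine ⟨c * y0 + m0 * t3 - m0 * (2 * f * t1 + q * t1 ^ 2) - t2 * (f + q * t1) ^ 2, ?_⟩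
  linear_combination (-m0 : QuadraticAlgebra ℤ a b) * hf2 - c * hm0'

theorem step3 (hD : 0 < b ^ 2 + 4 * a) (hsq : ¬ IsSquare (b ^ 2 + 4 * a))
    (hα : ∃ α : ℕ, α % 4 = 1 ∧ jacobiSym (b ^ 2 + 4 * a) α = -1)
    (n : ℤ) (c : QuadraticAlgebra ℤ a b)
    (hc1 : ((4 * (b ^ 2 + 4 * a) : ℤ) : QuadraticAlgebra ℤ a b) ∣ c - 1) (hcneg : norm c < 0)
    (hn : IsCoprime n (norm c)) : Good (n : QuadraticAlgebra ℤ a b) c := by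
  obtain ⟨α, hα1, hα2⟩ := hα
  obtain ⟨M, hM⟩ : ∃ M : ℕ, norm c = -(M : ℤ) := ⟨(norm c).natAbs, by omega⟩
  set D : ℤ := b ^ 2 + 4 * a with hDdef
  have hM0 : 0 < M := by omega
  have hMD : (4 * D) ∣ (M : ℤ) + 1 := by
    have := norm_congr hc1
    rw [hM, QuadraticAlgebra.norm_one, ← dvd_neg] at this
    have h9 : -(-(M:ℤ) - 1) = M + 1 := by ring
    rwa [h9] at this
  have hM4 : M % 4 = 3 := by
    have : (4 : ℤ) ∣ (M : ℤ) + 1 := (dvd_mul_right 4 D).trans hMD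
    omega
  have hMcop : IsCoprime (M : ℤ) (4 * D) :=
    isCoprime_of_dvd_sub (u := -1) (by simpa using hMD) isCoprime_one_left.neg_left
  have hnM : IsCoprime n (M : ℤ) := by
    rw [hM] at hn; exact (IsCoprime.neg_right_iff _ _).mp hn
  have hMdvd : c ∣ ((M : ℤ) : QuadraticAlgebra ℤ a b) := by
    have := dvd_norm_self c
    rw [hM] at this
    simpa using this
  have hαne : α ≠ 0 := by rintro rfl; simp at hα1
  have fin : ∀ (t : ℤ) (β : ℕ), IsCoprime t (M : ℤ) → Odd β → jacobiSym D β = -1 →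
      (∀ q : ℕ, q % 4 = β % 4 → (M : ℤ) ∣ q - t → jacobiSym (-M) q = 1) →
      Good (t : QuadraticAlgebra ℤ a b) c := by
    intro t β ht hβ hJβ hfin
    have hβ0 : β ≠ 0 := by rintro rfl; simp at hβ
    obtain ⟨q, hqM, hq, hq1, hq2⟩ := dirichlet2 (A := M) (B := 4 * D) (by omega) (by omega) hMcop
      t β ht ((odd_coprime_four hβ).mul_right (isCoprime_of_jac hβ0 hJβ).symm) M
    have hq4 : q % 4 = β % 4 := by
      have : (4 : ℤ) ∣ (q : ℤ) - β := (dvd_mul_right 4 D).trans hq2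
      omega
    have hqodd : Odd q := by
      rw [Nat.odd_iff] at hβ ⊢; omega
    have hJq : jacobiSym D q = -1 := by rw [jac_congr hqodd hβ hq2, hJβ]
    have hJM := hfin q hq4 hq1
    have : Fact q.Prime := ⟨hq⟩
    obtain ⟨s, hs⟩ := ZMod.isSquare_of_jacobiSym_eq_one hJM
    obtain ⟨s', rfl⟩ := ZMod.intCast_surjective s
    have hs' : (q : ℤ) ∣ norm c - s' ^ 2 := by
      rw [hM, ← ZMod.intCast_zmod_eq_zero_iff_dvd, Int.cast_sub, hs]
      push_cast; ring
    have g := step4 hD hsq q hq hqodd hJq c s' hs' (by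
      rw [hM, dvd_neg]
      intro h
      have : q ∣ M := by exact_mod_cast h
      have := Nat.le_of_dvd hM0 this
      omega)
    refine g.mod_left ?_
    have h1 : ((M : ℤ) : QuadraticAlgebra ℤ a b) ∣ ((q - t : ℤ) : QuadraticAlgebra ℤ a b) :=
      Int.cast_dvd_cast _ _ hq1
    have h2 := hMdvd.trans h1
    rw [← dvd_neg] at h2
    convert h2 using 1
    push_cast; ring
  have hMne : (n.gcd M) = 1 := Int.isCoprime_iff_gcd_eq_one.mp hnM
  have hModdN : Odd M := by rw [Nat.odd_iff]; omega
  have hcong : ∀ {q : ℕ} {t : ℤ}, (M : ℤ) ∣ q - t → jacobiSym q M = jacobiSym t M := by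
    intro q t h
    exact jacobiSym.mod_left' (Int.modEq_iff_dvd.mpr h).symm
  rcases jacobiSym.eq_one_or_neg_one hMne with hJ | hJ
  · refine fin n α hnM (by rw [Nat.odd_iff]; omega) hα2 ?_
    intro q hq4 hqn
    have hqo : Odd q := by rw [Nat.odd_iff]; omega
    rw [jacobiSym.neg _ hqo, ZMod.χ₄_nat_one_mod_four (by omega), one_mul,
      jacobiSym.quadratic_reciprocity_one_mod_four' hModdN (by omega), hcong hqn, hJ]
  · have hd4 : ((4 * D.natAbs - 1 : ℕ) : ℤ) = 4 * D - 1 := by omega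
    have hβ : (α * (4 * D.natAbs - 1)) % 4 = 3 := by
      rw [Nat.mul_mod, hα1]; omega
    have g := fin (-n) (α * (4 * D.natAbs - 1)) hnM.neg_left (by rw [Nat.odd_iff]; omega) (by
      have : NeZero α := ⟨hαne⟩
      have : NeZero (4 * D.natAbs - 1) := ⟨by omega⟩
      rw [jacobiSym.mul_right, hα2, jac_neg_one hD (p := 4 * D.natAbs - 1) (by rw [hd4]; simp)]
      norm_num) (by
      intro q hq4 hqn
      have hqo : Odd q := by rw [Nat.odd_iff]; omega
      rw [jacobiSym.neg _ hqo, ZMod.χ₄_nat_three_mod_four (by omega),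
        jacobiSym.quadratic_reciprocity_three_mod_four (by omega) (by omega), hcong hqn,
        jacobiSym.neg _ hModdN, hJ, ZMod.χ₄_nat_three_mod_four (by omega)]
      norm_num)
    have := g.neg_left
    simpa using this

theorem step2 (hD : 0 < b ^ 2 + 4 * a) (hsq : ¬ IsSquare (b ^ 2 + 4 * a))
    (hα : ∃ α : ℕ, α % 4 = 1 ∧ jacobiSym (b ^ 2 + 4 * a) α = -1)
    (n : ℤ) (c : QuadraticAlgebra ℤ a b) (hn0 : n ≠ 0)
    (hn4 : IsCoprime n (4 * (b ^ 2 + 4 * a)))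
    (hn : IsCoprime n (norm c)) : Good (n : QuadraticAlgebra ℤ a b) c := by
  obtain ⟨f, hf1, hf2⟩ := crt_quad hn4 c 1
  set D : ℤ := b ^ 2 + 4 * a with hDdef
  set A : ℤ := 8 * D * n with hA
  set T : ℤ := 2 * f.re + b * f.im with hT
  set k : ℤ := A * (|T| + |f.im| + 1) with hk
  set z : QuadraticAlgebra ℤ a b := ⟨-b * k, 2 * k⟩ with hz
  set g : QuadraticAlgebra ℤ a b := f + ((n * (4 * D) : ℤ) : QuadraticAlgebra ℤ a b) * z with hg
  have hg1 : (n : QuadraticAlgebra ℤ a b) ∣ g - c := by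
    have : g - c = (f - c) + (n : QuadraticAlgebra ℤ a b) * (((4 * D : ℤ) : QuadraticAlgebra ℤ a b) * z) := by
      rw [hg]; push_cast; ring
    rw [this]; exact dvd_add hf1 (dvd_mul_right _ _)
  have hg2 : ((4 * D : ℤ) : QuadraticAlgebra ℤ a b) ∣ g - 1 := by
    have : g - 1 = (f - 1) + ((4 * D : ℤ) : QuadraticAlgebra ℤ a b) * (((n : ℤ) : QuadraticAlgebra ℤ a b) * z) := by
      rw [hg]; push_cast; ring
    rw [this]; exact dvd_add hf2 (dvd_mul_right _ _)
  have hgre : g.re = f.re - n * (4 * D) * b * k := by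
    rw [hg, re_add, re_mul, re_intCast, im_intCast]; simp [hz]; ring
  have hgim : g.im = f.im + A * k := by
    rw [hg, im_add, im_mul, re_intCast, im_intCast]; simp [hz, hA]; ring
  have hneg : norm g < 0 := by
    have h4 : 4 * norm g = T ^ 2 - D * g.im ^ 2 := by
      rw [norm_val, hgre, hgim, hT, hA, hDdef]; ring
    have hA0 : A ≠ 0 := by
      rw [hA]; exact mul_ne_zero (by omega) hn0
    have hA2 : 1 ≤ A * A := by
      have : 0 < A * A := mul_self_pos.mpr hA0
      omega
    have h5 : |T| < g.im := by
      rw [hgim, hk]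
      have h6 : (|T| + |f.im| + 1) ≤ A * A * (|T| + |f.im| + 1) :=
        le_mul_of_one_le_left (by positivity) hA2
      have h7 := neg_abs_le f.im
      linarith
    have h6 : T ^ 2 < g.im ^ 2 := by
      rw [← sq_abs T]; exact pow_lt_pow_left₀ h5 (abs_nonneg _) (by norm_num)
    have h7 : g.im ^ 2 ≤ D * g.im ^ 2 := le_mul_of_one_le_left (by positivity) (by omega)
    linarith
  have hng : IsCoprime n (norm g) :=
    (isCoprime_of_dvd_sub (norm_congr hg1) hn.symm).symm
  have := step3 hD hsq hα n g hg2 hneg hng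
  refine this.mod_right ?_
  rw [← dvd_neg]
  simpa using hg1

end red
end S7
namespace S7

open QuadraticAlgebra

section first
variable {a b : ℤ}

theorem norm_ne_zero' (hsq : ¬ IsSquare (b ^ 2 + 4 * a)) {e : QuadraticAlgebra ℤ a b}
    (he : e ≠ 0) : norm e ≠ 0 := by
  intro h
  rw [norm_val] at h
  have h4 : (2 * e.re + b * e.im) ^ 2 = (b ^ 2 + 4 * a) * e.im ^ 2 := by linear_combination 4 * h
  by_cases him : e.im = 0
  · rw [him] at h
    apply he
    ext
    · simpa using h
    · simpa using him
  · have h5 : e.im ^ 2 ∣ (2 * e.re + b * e.im) ^ 2 := ⟨b ^ 2 + 4 * a, by rw [h4]; ring⟩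
    obtain ⟨r, hr⟩ := (Int.pow_dvd_pow_iff (by norm_num)).mp h5
    apply hsq
    refine ⟨r, ?_⟩
    rw [hr] at h4
    have : e.im ^ 2 ≠ 0 := pow_ne_zero 2 him
    apply mul_right_cancel₀ this
    linear_combination -h4

theorem isUnit_of_dvd_norm {c β : QuadraticAlgebra ℤ a b} (h : IsCoprime c β) {l : ℤ}
    (h1 : l ∣ norm c) (h2 : (l : QuadraticAlgebra ℤ a b) ∣ β) : l ∣ 1 := by
  obtain ⟨u, v, huv⟩ := h
  have h1' : (l : QuadraticAlgebra ℤ a b) ∣ c * star c := by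
    rw [mul_star_eq]; exact Int.cast_dvd_cast _ _ h1
  have h3 : (l : QuadraticAlgebra ℤ a b) ∣ star c := by
    have : star c = u * (c * star c) + β * (v * star c) := by
      linear_combination (-star c) * huv
    rw [this]; exact dvd_add (h1'.mul_left _) (h2.mul_right _)
  have h4 : (l : QuadraticAlgebra ℤ a b) ∣ c := by
    rw [int_dvd_iff] at h3 ⊢
    simp only [re_star, im_star] at h3
    have h5 : l ∣ c.im := by simpa using h3.2
    refine ⟨?_, h5⟩
    have := dvd_sub h3.1 (h5.mul_left b)
    simpa using this
  have h5 : (l : QuadraticAlgebra ℤ a b) ∣ 1 := by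
    rw [← huv]; exact dvd_add (h4.mul_left _) (h2.mul_left _)
  rw [int_dvd_iff] at h5
  simpa using h5.1

theorem isCoprime_of_gcd_dvd {x y : ℤ} (h : ∀ l : ℤ, l ∣ x → l ∣ y → l ∣ 1) : IsCoprime x y := by
  rw [Int.isCoprime_iff_gcd_eq_one]
  have := h (x.gcd y) (Int.gcd_dvd_left _ _) (Int.gcd_dvd_right _ _)
  exact Nat.dvd_one.mp (by exact_mod_cast this)

theorem coprime_translate {X Y N : ℤ} (hN : N ≠ 0) (hY : Y ≠ 0)
    (h : ∀ l : ℤ, l ∣ X → l ∣ Y → l ∣ N → l ∣ 1) : ∃ j : ℤ, IsCoprime (X + j * N) Y := by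
  have hg0 : (0 : ℤ) < X.gcd N := by exact_mod_cast Int.gcd_pos_of_ne_zero_right _ hN
  obtain ⟨X0, hX0⟩ : ((X.gcd N : ℕ) : ℤ) ∣ X := Int.gcd_dvd_left _ _
  obtain ⟨N0, hN0⟩ : ((X.gcd N : ℕ) : ℤ) ∣ N := Int.gcd_dvd_right _ _
  set g : ℤ := ((X.gcd N : ℕ) : ℤ) with hg
  have hcop : IsCoprime X0 N0 := by
    have hb := Int.gcd_eq_gcd_ab X N
    refine ⟨Int.gcdA X N, Int.gcdB X N, ?_⟩
    apply mul_left_cancel₀ hg0.ne'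
    linear_combination (-Int.gcdA X N) * hX0 - Int.gcdB X N * hN0 - hb
  have hN00 : N0 ≠ 0 := by rintro rfl; simp at hN0; exact hN hN0
  obtain ⟨p, hpY, hp, j, hj⟩ := dirichlet1 hN00 X0 hcop Y.natAbs
  refine ⟨j, ?_⟩
  have : X + j * N = g * p := by
    linear_combination hX0 + j * hN0 - g * hj
  rw [this]
  apply IsCoprime.mul_left
  · apply isCoprime_of_gcd_dvd
    intro l h1 h2
    exact h l (h1.trans ⟨_, hX0⟩) h2 (h1.trans ⟨_, hN0⟩)
  · refine (Prime.coprime_iff_not_dvd (Nat.prime_iff_prime_int.mp hp)).mpr (fun h => ?_)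
    have := Nat.le_of_dvd (Int.natAbs_pos.mpr hY) (Int.natCast_dvd.mp h)
    omega

theorem good_main (hD : 0 < b ^ 2 + 4 * a) (hsq : ¬ IsSquare (b ^ 2 + 4 * a))
    (hα : ∃ α : ℕ, α % 4 = 1 ∧ jacobiSym (b ^ 2 + 4 * a) α = -1)
    (x y : QuadraticAlgebra ℤ a b) (hxy : IsCoprime x y) : Good x y := by
  have main : ∀ x y : QuadraticAlgebra ℤ a b, IsCoprime x y → x ≠ 0 → y.im ≠ 0 → Good x y := by
    intro x y hxy hx hy
    have hN := norm_ne_zero' hsq hx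
    obtain ⟨j, hj⟩ := coprime_translate (X := y.re) (Y := y.im) hN hy (fun l h1 h2 h3 =>
      isUnit_of_dvd_norm hxy h3 ((int_dvd_iff l y).mpr ⟨h1, h2⟩))
    set X : ℤ := y.re + j * norm x with hX
    set c : QuadraticAlgebra ℤ a b := ⟨X, y.im⟩ with hc
    have hxc : x ∣ y - c := by
      have : y - c = ((norm x : ℤ) : QuadraticAlgebra ℤ a b) * ((-j : ℤ) : QuadraticAlgebra ℤ a b) := by
        ext
        · rw [re_sub, re_mul, re_intCast, im_intCast, re_intCast]; simp [hc, hX]; ring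
        · rw [im_sub, im_mul, im_intCast, im_intCast]; simp [hc]
      rw [this]; exact (dvd_norm_self x).mul_right _
    have hc0 : c ≠ 0 := fun h => hy (by have := congrArg QuadraticAlgebra.im h; simpa [hc] using this)
    have hNc := norm_ne_zero' hsq hc0
    obtain ⟨z, z', hz⟩ : IsCoprime y.im (norm c) := by
      have : norm c = X ^ 2 + y.im * (b * X - a * y.im) := by rw [norm_val]; simp [hc]; ring
      rw [this]
      exact (IsCoprime.add_mul_left_left hj.pow_left _).symm
    set n0 : ℤ := x.re - x.im * z * X with hn0
    have hn0c : c ∣ x - (n0 : QuadraticAlgebra ℤ a b) := by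
      have hz' : (z : QuadraticAlgebra ℤ a b) * y.im + z' * (c * star c) = 1 := by
        rw [mul_star_eq]
        have := congrArg (fun z : ℤ => (z : QuadraticAlgebra ℤ a b)) hz
        push_cast at this
        exact this
      set w : QuadraticAlgebra ℤ a b := ⟨0, 1⟩ with hw
      have hxw : x = (x.re : QuadraticAlgebra ℤ a b) + x.im * w := by ext <;> simp [hw]
      have hcw : c = (X : QuadraticAlgebra ℤ a b) + y.im * w := by 
        ext <;> simp only [re_add, im_add, re_mul, im_mul, re_intCast, im_intCast, Int.cast_id, hw, hc] <;> ring
      have hn0' : (n0 : QuadraticAlgebra ℤ a b) = x.re - x.im * z * X := by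
        rw [hn0]; push_cast; rfl
      refine ⟨x.im * (z + z' * star c * w), ?_⟩
      rw [hn0']
      nth_rewrite 1 [hxw]
      linear_combination (-(x.im : QuadraticAlgebra ℤ a b) * w) * hz' - x.im * z * hcw
    have hcop : IsCoprime c (n0 : QuadraticAlgebra ℤ a b) := by
      have h1 : IsCoprime x c := by
        obtain ⟨t, ht⟩ := hxc
        have : c = y + x * (-t) := by linear_combination -ht
        rw [this]; exact IsCoprime.add_mul_left_right hxy _
      obtain ⟨t, ht⟩ := hn0c
      have : (n0 : QuadraticAlgebra ℤ a b) = x + c * (-t) := by linear_combination -ht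
      rw [this]; exact IsCoprime.add_mul_left_right h1.symm _
    have hn0N : IsCoprime n0 (norm c) := isCoprime_of_gcd_dvd (fun l h1 h2 =>
      isUnit_of_dvd_norm hcop h2 (Int.cast_dvd_cast _ _ h1))
    obtain ⟨p, hpbig, hp, hpn⟩ := dirichlet1 hNc n0 hn0N (4 * (b ^ 2 + 4 * a)).natAbs
    have g := step2 hD hsq hα p c (by exact_mod_cast hp.ne_zero)
      ((Prime.coprime_iff_not_dvd (Nat.prime_iff_prime_int.mp hp)).mpr (fun h => by
        have := Nat.le_of_dvd (Int.natAbs_pos.mpr (by omega)) (Int.natCast_dvd.mp h)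
        omega)) (isCoprime_of_dvd_sub hpn hn0N)
    refine (g.mod_left (a' := x) ?_).mod_right hxc
    have h1 : c ∣ ((p - n0 : ℤ) : QuadraticAlgebra ℤ a b) :=
      (dvd_norm_self c).trans (Int.cast_dvd_cast _ _ hpn)
    have := dvd_sub hn0c h1
    convert this using 1
    push_cast; ring
  have main2 : ∀ x y : QuadraticAlgebra ℤ a b, IsCoprime x y → x ≠ 0 → Good x y := by
    intro x y hxy hx
    by_cases hy : y.im = 0
    · have hN := norm_ne_zero' hsq hx
      set w : QuadraticAlgebra ℤ a b := ⟨0, 1⟩ with hw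
      have g := main x (y + x * (star x * w)) (IsCoprime.add_mul_left_right hxy _) hx (by
        rw [← mul_assoc, mul_star_eq, im_add, im_mul, re_intCast, im_intCast, hy]
        simp [hw]; exact hN)
      refine g.mod_right ⟨-(star x * w), by ring⟩
    · exact main x y hxy hx hy
  by_cases hx : x = 0
  · subst hx
    have hu := isCoprime_zero_left.mp hxy
    have hy : y ≠ 0 := hu.ne_zero
    have g := main2 y y (by
      obtain ⟨v, hv⟩ := hu.exists_left_inv
      exact ⟨v, 0, by simp [hv]⟩) hy
    exact g.mod_left ⟨-1, by ring⟩
  · exact main2 x y hxy hx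

end first
end S7
namespace S7

theorem jac_four {d : ℤ} {α : ℕ} (h : Odd α) : jacobiSym (4 * d) α = jacobiSym d α := by
  have h2 : jacobiSym 2 α * jacobiSym 2 α = 1 := by
    have : (2 : ℤ).gcd (α : ℤ) = 1 := by
      rw [← Int.isCoprime_iff_gcd_eq_one]
      exact (two_coprime_odd h).symm
    rcases jacobiSym.eq_one_or_neg_one this with h | h <;> rw [h] <;> norm_num
  have : (4 * d : ℤ) = 2 * 2 * d := by ring
  rw [this, jacobiSym.mul_left, jacobiSym.mul_left, h2, one_mul]

theorem jac_of_dvd {α : ℕ} {m : ℕ} {u : ℤ} (h : (m : ℤ) ∣ (α : ℤ) - u) :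
    jacobiSym α m = jacobiSym u m := by
  rw [jacobiSym.mod_left' (a₂ := u)]
  exact Int.emod_eq_emod_iff_emod_sub_eq_zero.mpr (Int.emod_eq_zero_of_dvd h)

theorem exists_alpha {d : ℕ} (hd : Squarefree d) (hd1 : 1 < d) :
    ∃ α : ℕ, α % 4 = 1 ∧ jacobiSym (d : ℤ) α = -1 := by
  rcases Nat.even_or_odd d with he | ho
  · obtain ⟨e, rfl⟩ := even_iff_two_dvd.mp he
    have heo : Odd e := by
      rw [← Nat.not_even_iff_odd]
      intro h
      obtain ⟨f, rfl⟩ := even_iff_two_dvd.mp h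
      have := hd 2 ⟨f, by ring⟩
      norm_num at this
    obtain ⟨α, -, hα, h1, h2⟩ := dirichlet2 (A := 8) (B := e) (by norm_num)
      (by have := heo.pos; positivity) (by
        have := (two_coprime_odd heo).symm.pow_left (m := 3)
        norm_num at this
        exact this) 5 1 (by norm_num) isCoprime_one_left 0
    refine ⟨α, by omega, ?_⟩
    have ho : Odd α := Nat.odd_iff.mpr (by omega)
    push_cast
    rw [jacobiSym.mul_left, jacobiSym.at_two ho,
      jacobiSym.quadratic_reciprocity_one_mod_four' heo (by omega), jac_of_dvd h2,
      jacobiSym.one_left]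
    rw [ZMod.χ₈_nat_eq_if_mod_eight]
    have h3 : α % 8 = 5 := by omega
    have h4 : α % 2 = 1 := by omega
    simp [h3, h4]
  · obtain ⟨r, hr, e, rfl⟩ := Nat.exists_prime_and_dvd (show d ≠ 1 by omega)
    have hr2 : r ≠ 2 := by
      rintro rfl
      exact (Nat.not_even_iff_odd.mpr ho) ⟨e, by ring⟩
    have hro : Odd r := hr.odd_of_ne_two hr2
    have heo : Odd e := (Nat.odd_mul.mp ho).2
    haveI := Fact.mk hr
    obtain ⟨x, hx⟩ := FiniteField.exists_nonsquare (F := ZMod r) (by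
      rw [ZMod.ringChar_zmod_n]; exact hr2)
    obtain ⟨u, rfl⟩ := ZMod.intCast_surjective x
    have hu0 : ((u : ℤ) : ZMod r) ≠ 0 := by
      intro h; rw [h] at hx; exact hx (IsSquare.zero)
    have hju : jacobiSym u r = -1 := by
      rw [← jacobiSym.legendreSym.to_jacobiSym]
      exact (legendreSym.eq_neg_one_iff r).mpr hx
    have hre : IsCoprime (r : ℤ) e := by
      exact Nat.isCoprime_iff_coprime.mpr (Nat.coprime_of_squarefree_mul hd)
    have hr4 : IsCoprime (r : ℤ) 4 := by
      have := (two_coprime_odd hro).pow_right (n := 2)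
      norm_num at this
      exact this
    have hur : IsCoprime u r := by
      refine ((Prime.coprime_iff_not_dvd (Nat.prime_iff_prime_int.mp hr)).mpr (fun h => ?_)).symm
      exact hu0 ((ZMod.intCast_zmod_eq_zero_iff_dvd _ _).mpr h)
    obtain ⟨α, -, hα, h1, h2⟩ := dirichlet2 (A := r) (B := 4 * e) (by exact_mod_cast hr.ne_zero)
      (by have := heo.pos; positivity) (hr4.mul_right hre) u 1 hur isCoprime_one_left 0
    have h4 : (4 : ℤ) ∣ α - 1 := (dvd_mul_right _ _).trans h2
    have hee : (e : ℤ) ∣ α - 1 := (dvd_mul_left _ _).trans h2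
    refine ⟨α, by omega, ?_⟩
    rw [jacobiSym.quadratic_reciprocity_one_mod_four' ho (by omega)]
    haveI : NeZero r := ⟨hr.ne_zero⟩
    haveI : NeZero e := ⟨heo.pos.ne'⟩
    rw [jacobiSym.mul_right, jac_of_dvd h1, jac_of_dvd hee, hju, jacobiSym.one_left]
    norm_num

end S7
namespace S7

open NumberField

theorem Good.map {R S : Type*} [CommRing R] [CommRing S] (e : R ≃+* S) {x y : R}
    (h : Good x y) : Good (e x) (e y) := by
  intro g
  obtain ⟨l, hl, hp⟩ := h (e.symm g)
  refine ⟨l.map (RingHom.mapMatrix (e : R →+* S)), ?_, ?_⟩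
  · intro T hT
    obtain ⟨U, hU, rfl⟩ := List.mem_map.mp hT
    rw [← map_mul, hl U hU]
  · rw [← map_list_prod, ← hp]
    ext i j
    fin_cases i <;> fin_cases j <;> simp

theorem equiv_exists (a b : ℤ) (K : IntermediateField ℚ ℝ) (θ : ℝ) (hθK : θ ∈ K)
    (hθ : θ ^ 2 = a + b * θ) (hirr : Irrational θ)
    (hsurj : ∀ v : ℝ, v ∈ K → IsIntegral ℤ v → ∃ m n : ℤ, v = m + n * θ) :
    Nonempty (QuadraticAlgebra ℤ a b ≃+* 𝓞 K) := by
  have hIntg : IsIntegral ℤ (⟨θ, hθK⟩ : K) := by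
    refine ⟨Polynomial.X ^ 2 + (Polynomial.C (-b) * Polynomial.X + Polynomial.C (-a)), ?_, ?_⟩
    · apply Polynomial.monic_X_pow_add
      exact lt_of_le_of_lt Polynomial.degree_linear_le (by norm_num)
    · apply Subtype.ext
      rw [Polynomial.eval₂_add, Polynomial.eval₂_add, Polynomial.eval₂_mul, Polynomial.eval₂_pow,
        Polynomial.eval₂_X, Polynomial.eval₂_C, Polynomial.eval₂_C]
      simp
      linear_combination hθ
  obtain ⟨w, hwθ⟩ : ∃ w : 𝓞 K, ((w : K) : ℝ) = θ := ⟨⟨⟨θ, hθK⟩, hIntg⟩, rfl⟩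
  have hw : w * w = a • (1 : 𝓞 K) + b • w := by
    apply RingOfIntegers.ext
    apply Subtype.ext
    simp [hwθ]
    linear_combination hθ
  let f : QuadraticAlgebra ℤ a b →ₐ[ℤ] 𝓞 K := QuadraticAlgebra.lift ⟨w, hw⟩
  have hf : ∀ z, (((f z : 𝓞 K) : K) : ℝ) = z.re + z.im * θ := by
    intro z
    simp [f, QuadraticAlgebra.lift, hwθ]
  refine ⟨RingEquiv.ofBijective f ⟨?_, ?_⟩⟩
  · rw [injective_iff_map_eq_zero]
    intro z hz
    have h1 := hf z
    rw [hz] at h1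
    simp at h1
    have him : z.im = 0 := by
      by_contra hne
      have hne' : (z.im : ℝ) ≠ 0 := by exact_mod_cast hne
      apply hirr
      refine ⟨(-z.re : ℚ) / z.im, ?_⟩
      push_cast
      field_simp
      linear_combination h1
    rw [him] at h1
    have hre : z.re = 0 := by
      have : (z.re : ℝ) = 0 := by simpa using h1.symm
      exact_mod_cast this
    ext
    · simpa using hre
    · simpa using him
  · intro v
    obtain ⟨m, n, hmn⟩ := hsurj ((v : K) : ℝ) (v : K).2 (by
      have := RingOfIntegers.isIntegral_coe v
      exact map_isIntegral_int (algebraMap K ℝ) this)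
    refine ⟨⟨m, n⟩, ?_⟩
    apply RingOfIntegers.ext
    apply Subtype.ext
    rw [hf, hmn]

theorem exists_coords {d : ℕ} (hd : Squarefree d) (hd1 : 1 < d) {v : ℝ}
    (hv : v ∈ ℚ⟮(Real.sqrt d)⟯) (hIntg : IsIntegral ℤ v) :
    ∃ r s : ℚ, v = r + s * Real.sqrt d ∧ (∃ t : ℤ, 2 * r = t) ∧ ∃ n : ℤ, r ^ 2 - d * s ^ 2 = n := by
  have hsq : Real.sqrt d * Real.sqrt d = d := Real.mul_self_sqrt (by positivity)
  have hirr : Irrational (Real.sqrt d) := by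
    rw [irrational_sqrt_natCast_iff]
    rintro ⟨r, hr⟩
    have := Nat.isUnit_iff.mp (hd r ⟨1, by rw [hr]; ring⟩)
    subst this; omega
  let ψ : QuadraticAlgebra ℚ (d : ℚ) 0 →ₐ[ℚ] ℝ :=
    QuadraticAlgebra.lift ⟨Real.sqrt d, by rw [hsq]; simp [Algebra.smul_def]⟩
  have hψ : ∀ z, ψ z = z.re + z.im * Real.sqrt d := by
    intro z; simp [ψ, QuadraticAlgebra.lift, Algebra.smul_def]
  have hinj : Function.Injective ψ := by
    rw [injective_iff_map_eq_zero]
    intro z hz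
    have h1 := hψ z
    rw [hz] at h1
    have him : z.im = 0 := by
      by_contra hne
      have hne' : (z.im : ℝ) ≠ 0 := by exact_mod_cast hne
      apply hirr
      refine ⟨(-z.re : ℚ) / z.im, ?_⟩
      push_cast
      field_simp
      linear_combination h1
    rw [him] at h1
    have hre : z.re = 0 := by
      have : (z.re : ℝ) = 0 := by simpa using h1.symm
      exact_mod_cast this
    ext
    · simpa using hre
    · simpa using him
  obtain ⟨z, rfl⟩ : ∃ z, ψ z = v := by
    have halg : IsAlgebraic ℚ (Real.sqrt d) := by
      refine IsIntegral.isAlgebraic (IsIntegral.of_pow (n := 2) (by norm_num) ?_)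
      rw [sq, hsq]
      have := isIntegral_algebraMap (R := ℚ) (A := ℝ) (x := (d : ℚ))
      simpa using this
    rw [← IntermediateField.mem_toSubalgebra,
      IntermediateField.adjoin_simple_toSubalgebra_of_isAlgebraic halg] at hv
    have hle : Algebra.adjoin ℚ {Real.sqrt d} ≤ ψ.range := by
      rw [Algebra.adjoin_le_iff, Set.singleton_subset_iff]
      exact ⟨⟨0, 1⟩, by change ψ _ = _; rw [hψ]; simp⟩
    exact hle hv
  have hz : IsIntegral ℤ z := (isIntegral_algHom_iff (ψ.restrictScalars ℤ) hinj).mp hIntg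
  have hsz : IsIntegral ℤ (star z) := map_isIntegral_int (starRingEnd _) hz
  refine ⟨z.re, z.im, hψ z, ?_, ?_⟩
  · have h := hz.add hsz
    rw [← QuadraticAlgebra.algebraMap_trace_eq_add_star] at h
    have h2 := (isIntegral_algebraMap_iff (R := ℤ) QuadraticAlgebra.algebraMap_injective).mp h
    obtain ⟨t, ht⟩ := IsIntegrallyClosed.isIntegral_iff.mp h2
    refine ⟨t, ?_⟩
    simp [QuadraticAlgebra.trace] at ht
    linarith
  · have h := hz.mul hsz
    rw [← QuadraticAlgebra.algebraMap_norm_eq_mul_star] at h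
    have h2 := (isIntegral_algebraMap_iff (R := ℤ) QuadraticAlgebra.algebraMap_injective).mp h
    obtain ⟨t, ht⟩ := IsIntegrallyClosed.isIntegral_iff.mp h2
    refine ⟨t, ?_⟩
    simp [QuadraticAlgebra.norm] at ht
    linarith

theorem exists_int {d : ℕ} (hd : Squarefree d) {q : ℚ} {N : ℤ} (h : d * q ^ 2 = N) :
    ∃ u : ℤ, q = u := by
  have hden : (q.den : ℚ) ≠ 0 := by exact_mod_cast q.den_ne_zero
  have hq : q * q.den = q.num := Rat.mul_den_eq_num q
  have h1 : (d : ℤ) * q.num ^ 2 = N * (q.den : ℤ) ^ 2 := by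
    have : (d : ℚ) * q.num ^ 2 = N * (q.den : ℚ) ^ 2 := by
      rw [← hq, ← h]; ring
    exact_mod_cast this
  have hc : IsCoprime ((q.den : ℤ) ^ 2) (q.num ^ 2) := by
    apply IsCoprime.pow
    rw [Int.isCoprime_iff_gcd_eq_one, Int.gcd_comm]
    simpa [Int.gcd] using q.reduced
  have h2 : (q.den : ℤ) ^ 2 ∣ d := hc.dvd_of_dvd_mul_right ⟨N, by rw [h1]; ring⟩
  have h3 : q.den * q.den ∣ d := by
    rw [← sq]; exact_mod_cast h2
  have h4 := Nat.isUnit_iff.mp (hd _ h3)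
  refine ⟨q.num, ?_⟩
  rw [← hq, h4]; simp

theorem exists_coords_int {d : ℕ} (hd : Squarefree d) (hd1 : 1 < d) {v : ℝ}
    (hv : v ∈ ℚ⟮(Real.sqrt d)⟯) (hIntg : IsIntegral ℤ v) :
    ∃ t u n : ℤ, 2 * v = t + u * Real.sqrt d ∧ t ^ 2 - d * u ^ 2 = 4 * n := by
  obtain ⟨r, s, h1, ⟨t, ht⟩, n, hn⟩ := exists_coords hd hd1 hv hIntg
  obtain ⟨u, hu⟩ := exists_int hd (q := 2 * s) (N := t ^ 2 - 4 * n) (by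
    push_cast; rw [← ht, ← hn]; ring)
  refine ⟨t, u, n, ?_, ?_⟩
  · have h2 : (2 : ℝ) * r = t := by exact_mod_cast ht
    have h3 : (2 : ℝ) * s = u := by exact_mod_cast hu
    rw [h1, ← h2, ← h3]; ring
  · have : (t : ℚ) ^ 2 - d * u ^ 2 = 4 * n := by rw [← ht, ← hu, ← hn]; ring
    exact_mod_cast this

theorem irr_sqrt {d : ℕ} (hd : Squarefree d) (hd1 : 1 < d) : Irrational (Real.sqrt d) := by
  rw [irrational_sqrt_natCast_iff]
  rintro ⟨r, hr⟩
  have := Nat.isUnit_iff.mp (hd r ⟨1, by rw [hr]; ring⟩)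
  subst this; omega

theorem exists_model {d : ℕ} (hd : Squarefree d) (hd1 : 1 < d) :
    ∃ a b : ℤ, 0 < b ^ 2 + 4 * a ∧ ¬ IsSquare (b ^ 2 + 4 * a) ∧
      (∃ α : ℕ, α % 4 = 1 ∧ jacobiSym (b ^ 2 + 4 * a) α = -1) ∧
      Nonempty (QuadraticAlgebra ℤ a b ≃+* 𝓞 (ℚ⟮(Real.sqrt d)⟯ : IntermediateField ℚ ℝ)) := by
  have hns : ¬ IsSquare (d : ℤ) := by
    rintro ⟨r, hr⟩
    have h1 : d = r.natAbs * r.natAbs := by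
      have := congrArg Int.natAbs hr
      rwa [Int.natAbs_mul, Int.natAbs_natCast] at this
    have := Nat.isUnit_iff.mp (hd r.natAbs ⟨1, by rw [← h1]; ring⟩)
    rw [this] at h1; omega
  obtain ⟨α, hα1, hα2⟩ := exists_alpha hd hd1
  have hsq : Real.sqrt d ^ 2 = d := Real.sq_sqrt (by positivity)
  have hmem : Real.sqrt d ∈ ℚ⟮(Real.sqrt d)⟯ := IntermediateField.mem_adjoin_simple_self _ _
  by_cases h4 : d % 4 = 1
  · obtain ⟨a, ha⟩ : ∃ a : ℤ, (d : ℤ) = 1 ^ 2 + 4 * a := ⟨((d : ℤ) - 1) / 4, by omega⟩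
    have haR : (d : ℝ) = 1 ^ 2 + 4 * a := by exact_mod_cast ha
    refine ⟨a, 1, by omega, by rwa [← ha], ⟨α, hα1, by rwa [← ha]⟩, ?_⟩
    apply equiv_exists a 1 _ ((1 + Real.sqrt d) / 2)
    · exact div_mem (add_mem (one_mem _) hmem) (ofNat_mem _ 2)
    · push_cast; linear_combination (1 / 4) * hsq + (1 / 4) * haR
    · have := ((irr_sqrt hd hd1).natCast_add 1).div_natCast (m := 2) (by norm_num)
      simpa using this
    · intro v hv hIntg
      obtain ⟨t, u, n, h1, h2⟩ := exists_coords_int hd hd1 hv hIntg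
      have h3 : (2 : ℤ) ∣ t - u := by
        have h5 : t ^ 2 - u ^ 2 = 4 * (n + a * u ^ 2) := by rw [ha] at h2; linear_combination h2
        rw [← even_iff_two_dvd]
        have : Even (t ^ 2 - u ^ 2) := ⟨2 * (n + a * u ^ 2), by rw [h5]; ring⟩
        simpa [Int.even_sub, Int.even_pow] using this
      obtain ⟨m, hm⟩ := h3
      refine ⟨m, u, ?_⟩
      have hm' : (t : ℝ) - u = 2 * m := by exact_mod_cast hm
      linear_combination (1 / 2) * h1 + (1 / 2) * hm'
  · have hns4 : ¬ IsSquare ((0 : ℤ) ^ 2 + 4 * d) := by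
      rintro ⟨r, hr⟩
      have h2 : Even r := by
        have : Even (r * r) := ⟨2 * d, by rw [← hr]; ring⟩
        simpa [Int.even_mul] using this
      obtain ⟨s, rfl⟩ := h2
      exact hns ⟨s, by linarith⟩
    have hd40 : d % 4 ≠ 0 := by
      intro h
      have := hd 2 (by norm_num; omega)
      norm_num at this
    refine ⟨d, 0, by omega, hns4, ⟨α, hα1, ?_⟩, ?_⟩
    · have : (0 : ℤ) ^ 2 + 4 * d = 4 * d := by ring
      rw [this, jac_four (Nat.odd_iff.mpr (by omega))]
      exact hα2
    apply equiv_exists d 0 _ (Real.sqrt d) hmem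
    · push_cast; linear_combination hsq
    · exact irr_sqrt hd hd1
    · intro v hv hIntg
      obtain ⟨t, u, n, h1, h2⟩ := exists_coords_int hd hd1 hv hIntg
      have hu : Even u := by
        by_contra hu
        rw [Int.not_even_iff_odd] at hu
        obtain ⟨k, rfl⟩ := hu
        obtain ⟨e, he⟩ : ∃ e : ℤ, (d : ℤ) = 4 * e + 2 ∨ (d : ℤ) = 4 * e + 3 :=
          ⟨d / 4, by omega⟩
        rcases Int.even_or_odd' t with ⟨j, rfl | rfl⟩ <;> rcases he with he | he <;>
          rw [he] at h2 <;> ring_nf at h2 <;> omega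
      obtain ⟨k, rfl⟩ := hu
      have ht : Even t := by
        have : Even (t ^ 2) := ⟨2 * (n + d * k ^ 2), by linear_combination h2⟩
        simpa [Int.even_pow] using this
      obtain ⟨j, rfl⟩ := ht
      refine ⟨j, k, ?_⟩
      push_cast at h1
      linear_combination (1 / 2) * h1

theorem final {R : Type*} [CommRing R] [IsDomain R] (hgood : ∀ x y : R, IsCoprime x y → Good x y)
    (x y : R) (hxy : (Ideal.span {x, y}).IsPrincipal) : IsIdemProd !![x, y; 0, 0] := by
  obtain ⟨g, hg⟩ := hxy
  change Ideal.span {x, y} = Ideal.span {g} at hg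
  have hx : x ∈ Ideal.span {g} := hg ▸ Ideal.subset_span (by simp)
  have hy : y ∈ Ideal.span {g} := hg ▸ Ideal.subset_span (by simp)
  obtain ⟨x', rfl⟩ := Ideal.mem_span_singleton.mp hx
  obtain ⟨y', rfl⟩ := Ideal.mem_span_singleton.mp hy
  by_cases hg0 : g = 0
  · subst hg0
    refine ⟨[!![0 * x', 0 * y'; 0, 0]], ?_, by simp⟩
    intro T hT
    rw [List.mem_singleton] at hT
    subst hT
    ext i j
    fin_cases i <;> fin_cases j <;> simp
  · have hgm : g ∈ Ideal.span {g * x', g * y'} := hg ▸ Ideal.mem_span_singleton_self g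
    obtain ⟨u, v, huv⟩ := Ideal.mem_span_pair.mp hgm
    refine hgood x' y' ⟨u, v, ?_⟩ g
    apply mul_left_cancel₀ hg0
    linear_combination huv

end S7

theorem stmt_7 (d : ℕ) (hd : Squarefree d) (hd1 : 1 < d)
    (K : IntermediateField ℚ ℝ) (hK : K = ℚ⟮(Real.sqrt d)⟯) [NumberField K]
    (x y : NumberField.RingOfIntegers K)
    (hxy : (Ideal.span {x, y}).IsPrincipal) :
    IsIdemProd !![x, y; 0, 0] := by
  subst hK
  obtain ⟨a, b, h1, h2, h3, ⟨e⟩⟩ := S7.exists_model hd hd1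
  refine S7.final (fun x y hc => ?_) x y hxy
  have hc' : IsCoprime (e.symm x) (e.symm y) := hc.map e.symm.toRingHom
  have := (S7.good_main h1 h2 h3 _ _ hc').map e
  simpa using this
end

section
/- Let D be the ring of integers of a real quadratic number field Q(√d) with d > 0 square-free. Then every 2×2 matrix over D with second row zero (i.e., of the form with first row (x, y) and second row (0, 0)) is a product of idempotent matrices over D. -/
open scoped IntermediateField

namespace IdemRow

/-- Rows obtained from `(1,0)` by elementary column operations. -/
inductive U {R : Type*} [CommRing R] : R → R → Prop
  | base : U 1 0
  | left (a b t : R) : U a b → U (a + t * b) b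
  | right (a b t : R) : U a b → U a (b + t * a)

section general
variable {R : Type*} [CommRing R]

lemma U.left_iff (a b t : R) : U (a + t * b) b ↔ U a b := by
  refine ⟨fun h => ?_, U.left a b t⟩
  have := U.left _ _ (-t) h
  simpa using this

lemma U.right_iff (a b t : R) : U a (b + t * a) ↔ U a b := by
  refine ⟨fun h => ?_, U.right a b t⟩
  have := U.right _ _ (-t) h
  simpa using this

lemma U.congr_left {a a' b : R} (h : b ∣ a - a') : U a b ↔ U a' b := by
  obtain ⟨t, ht⟩ := h
  have : a = a' + t * b := by linear_combination ht
  rw [this, U.left_iff]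

lemma U.congr_right {a b b' : R} (h : a ∣ b - b') : U a b ↔ U a b' := by
  obtain ⟨t, ht⟩ := h
  have : b = b' + t * a := by linear_combination ht
  rw [this, U.right_iff]

lemma U.unit_right {a b u v : R} (huv : u * v = 1) (h : U a b) : U a (u * b) := by
  induction h with
  | base => simpa using U.base
  | left a b t _ ih =>
    have := U.left _ _ (t * v) ih
    have e : a + t * v * (u * b) = a + t * b := by linear_combination t * b * huv
    rwa [e] at this
  | right a b t _ ih =>
    have := U.right _ _ (t * u) ih
    have e : u * b + t * u * a = u * (b + t * a) := by ring
    rwa [e] at this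

lemma U.unit_right_iff {a b u v : R} (huv : u * v = 1) : U a (u * b) ↔ U a b := by
  refine ⟨fun h => ?_, U.unit_right huv⟩
  have := U.unit_right (u := v) (v := u) (by rw [mul_comm]; exact huv) h
  have e : v * (u * b) = b := by linear_combination b * huv
  rwa [e] at this

lemma U.neg_right_iff {a b : R} : U a (-b) ↔ U a b := by
  have := U.unit_right_iff (a := a) (b := b) (u := -1) (v := -1) (by ring)
  simpa using this

lemma U.swap {a b : R} (h : U a b) : U b a := by
  have h1 := U.right _ _ 1 h
  have h2 := U.left _ _ (-1) h1
  have e : a + -1 * (b + 1 * a) = -b := by ring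
  rw [e] at h2
  have h3 := U.right _ _ 1 h2
  have e : b + 1 * a + 1 * (-b) = a := by ring
  rw [e] at h3
  have key : ∀ x y : R, U x y → U (-x) y := by
    intro x y hxy
    induction hxy with
    | base =>
      have k1 := U.right _ _ 1 (U.base (R := R))
      have k2 := U.left _ _ (-2) k1
      have k3 := U.right _ _ 1 k2
      have e1 : (1 : R) + -2 * (0 + 1 * 1) = -1 := by ring
      have e2 : (0 + 1 * 1 + 1 * (1 + -2 * (0 + 1 * 1)) : R) = 0 := by ring
      rw [e2, e1] at k3
      exact k3
    | left a b t _ ih =>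
      have := U.left _ _ (-t) ih
      have e : -a + -t * b = -(a + t * b) := by ring
      rwa [e] at this
    | right a b t _ ih =>
      have := U.right _ _ (-t) ih
      have e : b + -t * -a = b + t * a := by ring
      rwa [e] at this
  simpa using key _ _ h3

lemma U.unit_left_iff {a b u v : R} (huv : u * v = 1) : U (u * a) b ↔ U a b :=
  ⟨fun h => ((U.unit_right_iff huv).1 h.swap).swap, fun h => ((U.unit_right_iff huv).2 h.swap).swap⟩

lemma U.one_left (b : R) : U 1 b := by
  have := U.right _ _ b (U.base (R := R)); simpa using this

lemma U.of_unit_left {u v : R} (b : R) (huv : u * v = 1) : U u b := by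
  have := (U.unit_left_iff (a := 1) (b := b) huv).2 (U.one_left b); simpa using this

lemma U.int_cast (a b : ℤ) (h : IsCoprime a b) : U (a : R) (b : R) := by
  have key : ∀ n : ℕ, ∀ a b : ℤ, b.natAbs = n → IsCoprime a b → U (a : R) (b : R) := by
    intro n
    induction n using Nat.strong_induction_on with
    | _ n ih =>
      intro a b hb h
      by_cases h0 : b = 0
      · subst h0
        rw [isCoprime_zero_right] at h
        rcases Int.isUnit_iff.1 h with rfl | rfl
        · simpa using U.base
        · exact U.of_unit_left (v := -1) _ (by push_cast; ring)
      · have h1 : U ((a % b : ℤ) : R) (b : R) := by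
          apply U.swap
          apply ih (a % b).natAbs _ _ _ rfl
          · have := (isCoprime_comm.1 h)
            rw [← Int.emod_add_mul_ediv a b] at this
            exact IsCoprime.of_add_mul_left_right this
          · subst hb
            have h3 := Int.emod_lt_abs a h0
            have h4 := Int.emod_nonneg a h0
            rw [Int.abs_eq_natAbs] at h3
            omega
        refine (U.congr_left ?_).1 h1
        refine ⟨-(a / b : ℤ), ?_⟩
        have := Int.emod_add_mul_ediv a b
        have h2 : ((a % b + b * (a / b) : ℤ) : R) = (a : R) := by rw [this]
        push_cast at h2 ⊢
        linear_combination h2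
  exact key _ a b rfl h

/-- `(x,y;0,0)` is a product of idempotents -/
abbrev P (x y : R) : Prop := IsIdemProd !![x, y; 0, 0]

lemma P.step {x y x' y' : R} (h : P x y) (T : Matrix (Fin 2) (Fin 2) R) (hT : T * T = T)
    (h1 : x' = x * T 0 0 + y * T 1 0) (h2 : y' = x * T 0 1 + y * T 1 1) : P x' y' := by
  obtain ⟨l, hl, hM⟩ := h
  refine ⟨l ++ [T], ?_, ?_⟩
  · intro S hS
    simp only [List.mem_append, List.mem_singleton] at hS
    rcases hS with hS | rfl
    · exact hl _ hS
    · exact hT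
  · rw [List.prod_append, ← hM, List.prod_singleton]
    ext i j
    fin_cases i <;> fin_cases j <;> simp [Matrix.mul_apply, Fin.sum_univ_two, h1, h2]

lemma P.add {a b c d : R} (hdet : a * d - b * c = 1) (h : P a b) (s : R) :
    P (a + s * c) (b + s * d) := by
  refine h.step !![d * (a + s * c), d * (b + s * d); -c * (a + s * c), -c * (b + s * d)] ?_ ?_ ?_
  · ext i j
    fin_cases i <;> fin_cases j <;> simp [Matrix.mul_apply, Fin.sum_univ_two]
    · linear_combination (d * (a + s * c)) * hdet
    · linear_combination (d * (b + s * d)) * hdet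
    · linear_combination (-c * (a + s * c)) * hdet
    · linear_combination (-c * (b + s * d)) * hdet
  · simp; linear_combination (-(a + s * c)) * hdet
  · simp; linear_combination (-(b + s * d)) * hdet

lemma P.other {a b c d : R} (hdet : a * d - b * c = 1) (h : P a b) : P c d := by
  have h1 := P.add hdet h 1
  have h2 := P.add (a := a + 1 * c) (b := b + 1 * d) (c := -a) (d := -b)
    (by linear_combination hdet) h1 1
  have e1 : a + 1 * c + 1 * -a = c := by ring
  have e2 : b + 1 * d + 1 * -b = d := by ring
  rwa [e1, e2] at h2

/-- closure of elementary moves acting on the left (on rows). `V a b c d` -/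
inductive V : R → R → R → R → Prop
  | base : V 1 0 0 1
  | left (a b c d t : R) : V a b c d → V (a + t * b) b (c + t * d) d
  | right (a b c d t : R) : V a b c d → V a (b + t * a) c (d + t * c)

lemma V.of_U {a b : R} (h : U a b) : ∃ c d, V a b c d := by
  induction h with
  | base => exact ⟨_, _, V.base⟩
  | left a b t _ ih => obtain ⟨c, d, h⟩ := ih; exact ⟨_, _, V.left _ _ _ _ t h⟩
  | right a b t _ ih => obtain ⟨c, d, h⟩ := ih; exact ⟨_, _, V.right _ _ _ _ t h⟩

lemma V.spec {a b c d : R} (h : V a b c d) : ∀ x y z w : R, x * w - y * z = 1 →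
    P x y → P (a * x + b * z) (a * y + b * w) := by
  induction h with
  | base => intro x y z w _ h; simpa using h
  | left a b c d t _ ih =>
    intro x y z w hd h
    have := ih x y (z + t * x) (w + t * y) (by linear_combination hd) h
    have e1 : a * x + b * (z + t * x) = (a + t * b) * x + b * z := by ring
    have e2 : a * y + b * (w + t * y) = (a + t * b) * y + b * w := by ring
    rwa [e1, e2] at this
  | right a b c d t _ ih =>
    intro x y z w hd h
    have := ih (x + t * z) (y + t * w) z w (by linear_combination hd) (P.add hd h t)
    have e1 : a * (x + t * z) + b * z = a * x + (b + t * a) * z := by ring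
    have e2 : a * (y + t * w) + b * w = a * y + (b + t * a) * w := by ring
    rwa [e1, e2] at this

lemma U.isIdemProd {a b : R} (h : U a b) : P a b := by
  obtain ⟨c, d, hV⟩ := V.of_U h
  have h0 : P (1 : R) 0 := ⟨[!![1, 0; 0, 0]], by
    intro T hT
    rw [List.mem_singleton] at hT
    subst hT
    ext i j; fin_cases i <;> fin_cases j <;> simp [Matrix.mul_apply, Fin.sum_univ_two], by simp⟩
  have := hV.spec 1 0 0 1 (by ring) h0
  simpa using this

end general


section quad
open QuadraticAlgebra
variable {s t : ℤ}

lemma coprime_shift (a n m : ℤ) (hm : m ≠ 0)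
    (h : ∀ p : ℕ, p.Prime → (p : ℤ) ∣ a → (p : ℤ) ∣ n → ¬ (p : ℤ) ∣ m) :
    ∃ k : ℤ, IsCoprime (a + n * k) m := by
  classical
  let F : Finset ℕ := m.natAbs.primeFactors.filter (fun p : ℕ => ¬ (p : ℤ) ∣ a)
  refine ⟨∏ p ∈ F, (p : ℤ), ?_⟩
  rw [Int.isCoprime_iff_nat_coprime]
  apply Nat.Coprime.symm
  apply Nat.coprime_of_dvd
  intro p hp h1 h2
  have h1' : (p : ℤ) ∣ m := Int.natCast_dvd.2 h1
  have h2' := Int.natCast_dvd.2 h2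
  have hpi : Prime (p : ℤ) := Nat.prime_iff_prime_int.1 hp
  by_cases hpa : (p : ℤ) ∣ a
  · have h3 : (p : ℤ) ∣ n * ∏ p ∈ F, (p : ℤ) := (dvd_add_right hpa).1 h2'
    rcases hpi.dvd_or_dvd h3 with h4 | h4
    · exact h p hp hpa h4 h1'
    · rw [Prime.dvd_finsetProd_iff hpi] at h4
      obtain ⟨r, hr, hpr⟩ := h4
      simp only [F, Finset.mem_filter, Nat.mem_primeFactors] at hr
      have : p = r := (Nat.prime_dvd_prime_iff_eq hp hr.1.1).1 (by exact_mod_cast hpr)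
      subst this
      exact hr.2 hpa
  · have hpF : p ∈ F := by
      simp only [F, Finset.mem_filter, Nat.mem_primeFactors]
      exact ⟨⟨hp, h1, by simpa using hm⟩, hpa⟩
    have h3 : (p : ℤ) ∣ ∏ p ∈ F, (p : ℤ) := Finset.dvd_prod_of_mem _ hpF
    exact hpa ((dvd_add_left (h3.mul_left n)).1 h2')

lemma dvd_norm (b : QuadraticAlgebra ℤ s t) : b ∣ ((norm b : ℤ) : QuadraticAlgebra ℤ s t) := by
  refine ⟨star b, ?_⟩
  have := algebraMap_norm_eq_mul_star b
  simpa using this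

lemma norm_ne_zero (hns : ¬ IsSquare (t ^ 2 + 4 * s)) {b : QuadraticAlgebra ℤ s t} (hb : b ≠ 0) :
    norm b ≠ 0 := by
  intro h
  rw [norm_def] at h
  have h1 : (t ^ 2 + 4 * s) * b.im ^ 2 = (2 * b.re + t * b.im) ^ 2 := by
    linear_combination (-4) * h
  by_cases him : b.im = 0
  · rw [him] at h1
    have : b.re = 0 := by
      have h2 : (2 * b.re + t * 0) ^ 2 = 0 := by rw [← h1]; ring
      have h3 := pow_eq_zero_iff (two_ne_zero) |>.1 h2
      linarith
    exact hb (by ext <;> simp [this, him])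
  · have h2 : b.im ^ 2 ∣ (2 * b.re + t * b.im) ^ 2 := ⟨t ^ 2 + 4 * s, by rw [← h1]; ring⟩
    rw [Int.pow_dvd_pow_iff two_ne_zero] at h2
    obtain ⟨k, hk⟩ := h2
    rw [hk] at h1
    apply hns
    refine ⟨k, ?_⟩
    have h3 : b.im ^ 2 ≠ 0 := pow_ne_zero _ him
    apply mul_left_cancel₀ h3
    linear_combination h1

/-- norm congruences -/
lemma norm_congr {k : ℤ} {x y : QuadraticAlgebra ℤ s t}
    (h : (k : QuadraticAlgebra ℤ s t) ∣ x - y) : k ∣ norm x - norm y := by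
  obtain ⟨z, hz⟩ := h
  have hx : x = y + k * z := by linear_combination hz
  subst hx
  simp only [norm_def, re_add, im_add, re_mul, im_mul, re_intCast, im_intCast]
  simp only [Int.cast_id]
  refine ⟨2 * y.re * z.re + k * z.re ^ 2 + t * (y.re * z.im + z.re * y.im + k * z.re * z.im) -
    s * (2 * y.im * z.im + k * z.im ^ 2), ?_⟩
  ring

lemma intCast_dvd {k : ℤ} {z : QuadraticAlgebra ℤ s t} :
    (k : QuadraticAlgebra ℤ s t) ∣ z ↔ k ∣ z.re ∧ k ∣ z.im := by
  have := algebraMap_dvd_iff (a := s) (b := t) (r := k) (z := z)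
  simpa using this

lemma reduce (hns : ¬ IsSquare (t ^ 2 + 4 * s)) (a b : QuadraticAlgebra ℤ s t)
    (hab : IsCoprime a b) :
    ∃ (x : QuadraticAlgebra ℤ s t) (n : ℤ), IsCoprime x (n : QuadraticAlgebra ℤ s t) ∧
      (U x (n : QuadraticAlgebra ℤ s t) → U a b) := by
  by_cases hb : b = 0
  · subst hb
    exact ⟨a, 0, by simpa using hab, by simp⟩
  set n0 := norm b with hn0
  have hn : n0 ≠ 0 := norm_ne_zero hns hb
  have hp : ∀ p : ℕ, p.Prime → ¬ ((p : ℤ) ∣ a.re ∧ (p : ℤ) ∣ a.im ∧ (p : ℤ) ∣ n0) := by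
    rintro p hp ⟨h1, h2, h3⟩
    obtain ⟨u, v, huv⟩ := hab
    have h4 : ((p : ℤ) : QuadraticAlgebra ℤ s t) ∣ a := intCast_dvd.2 ⟨h1, h2⟩
    have h5 : ((p : ℤ) : QuadraticAlgebra ℤ s t) ∣ 1 - v * b := by
      rw [← huv]; simpa using h4.mul_left u
    have h6 := norm_congr h5
    rw [map_mul, QuadraticAlgebra.norm_one, ← hn0] at h6
    have h7 : (p : ℤ) ∣ 1 := (dvd_sub_left (h3.mul_left _)).1 h6
    have := Int.natAbs_dvd_natAbs.2 h7
    simp at this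
    exact hp.one_lt.ne' this
  obtain ⟨k1, hk1⟩ : ∃ k1 : ℤ, a.im + n0 * k1 ≠ 0 := by
    by_cases h : a.im = 0
    · exact ⟨1, by rw [h]; simpa using hn⟩
    · exact ⟨0, by simpa using h⟩
  obtain ⟨k0, hk0⟩ := coprime_shift a.re n0 (a.im + n0 * k1) hk1 (by
    intro p hpp h1 h2 h3
    exact hp p hpp ⟨h1, (dvd_add_left (h2.mul_right k1)).1 h3, h2⟩)
  let κ : QuadraticAlgebra ℤ s t := ⟨k0, k1⟩
  obtain ⟨b', hb'⟩ := dvd_norm b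
  set a' := a + b * (b' * κ) with ha'
  have hab' : IsCoprime a' b := hab.add_mul_left_left _
  have ea : a' = a + ((n0 : ℤ) : QuadraticAlgebra ℤ s t) * κ := by
    rw [ha', hn0, hb']; ring
  have hre : a'.re = a.re + n0 * k0 := by rw [ea]; simp [κ]
  have him : a'.im = a.im + n0 * k1 := by rw [ea]; simp [κ]
  rw [← hre, ← him] at hk0
  obtain ⟨u, v, huv⟩ := hk0
  -- an element `τ` with `im (τ * a') = 1`
  let τ : QuadraticAlgebra ℤ s t := ⟨v - u * t, u⟩
  have hτ : (τ * a').im = 1 := by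
    simp only [im_mul, τ]; linear_combination huv
  set c := b + a' * (-(b.im : QuadraticAlgebra ℤ s t) * τ) with hc
  have hcim : c.im = 0 := by
    have : c = b - (b.im : QuadraticAlgebra ℤ s t) * (τ * a') := by rw [hc]; ring
    rw [this]
    simp only [im_sub, im_mul _ (τ * a'), hτ, im_intCast, re_intCast]
    simp
  have hcc : c = ((c.re : ℤ) : QuadraticAlgebra ℤ s t) := by
    ext <;> simp [hcim]
  refine ⟨a', c.re, ?_, ?_⟩
  · rw [← hcc]; exact hab'.add_mul_left_right _
  · rw [← hcc]
    intro h
    have h1 : U a' b := (U.congr_right (a := a') (b := c) (b' := b) ⟨-(b.im : QuadraticAlgebra ℤ s t) * τ, by rw [hc]; ring⟩).1 h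
    exact (U.congr_left (a := a') (a' := a) (b := b) ⟨b' * κ, by rw [ha']; ring⟩).1 h1

lemma exists_pow_congr_one (x : QuadraticAlgebra ℤ s t) (n : ℤ) (hn : n ≠ 0)
    (h : IsCoprime x (n : QuadraticAlgebra ℤ s t)) :
    ∃ l : ℕ, 0 < l ∧ (n : QuadraticAlgebra ℤ s t) ∣ x ^ l - 1 := by
  have : NeZero n.natAbs := ⟨by simpa using hn⟩
  let f : ℕ → ZMod n.natAbs × ZMod n.natAbs := fun k => ((x ^ k).re, (x ^ k).im)
  obtain ⟨i, j, hij, hf⟩ := Finite.exists_ne_map_eq_of_infinite f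
  wlog hlt : i < j generalizing i j
  · exact this j i hij.symm hf.symm (by omega)
  simp only [f, Prod.mk.injEq, ZMod.intCast_eq_intCast_iff_dvd_sub, Int.natAbs_dvd] at hf
  refine ⟨j - i, by omega, ?_⟩
  have h1 : (n : QuadraticAlgebra ℤ s t) ∣ x ^ i * (x ^ (j - i) - 1) := by
    rw [mul_sub, ← pow_add, Nat.add_sub_cancel' hlt.le, mul_one, intCast_dvd]
    simpa using hf
  exact (h.pow_left (m := i)).symm.dvd_of_dvd_mul_left h1

end quad


section quad
open QuadraticAlgebra
variable {s t : ℤ}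

lemma isCoprime_norm {x : QuadraticAlgebra ℤ s t} {n : ℤ}
    (h : IsCoprime x (n : QuadraticAlgebra ℤ s t)) : IsCoprime (norm x) n := by
  obtain ⟨u, v, huv⟩ := h
  have h1 : (n : QuadraticAlgebra ℤ s t) ∣ 1 - u * x := ⟨v, by rw [← huv]; ring⟩
  obtain ⟨k, hk⟩ := norm_congr h1
  rw [map_mul, QuadraticAlgebra.norm_one] at hk
  exact ⟨norm u, k, by linear_combination -hk⟩

lemma isCoprime_congr {a b n : ℤ} (h : n ∣ a - b) (hb : IsCoprime b n) : IsCoprime a n := by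
  obtain ⟨k, hk⟩ := h
  have : a = b + n * k := by linear_combination hk
  rw [this]
  exact hb.add_mul_left_left k

lemma exists_aux_modulus (n L : ℤ) (hL : L ≠ 0) :
    ∃ k : ℤ, IsCoprime n k ∧ ∀ p : ℕ, p.Prime → (p : ℤ) ∣ L → (p : ℤ) ∣ n ∨ (p : ℤ) ∣ k := by
  classical
  let F : Finset ℕ := L.natAbs.primeFactors.filter (fun p : ℕ => ¬ (p : ℤ) ∣ n)
  refine ⟨∏ p ∈ F, (p : ℤ), ?_, ?_⟩
  · apply IsCoprime.prod_right
    intro p hp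
    simp only [F, Finset.mem_filter, Nat.mem_primeFactors] at hp
    have hpi : Prime (p : ℤ) := Nat.prime_iff_prime_int.1 hp.1.1
    exact ((Prime.coprime_iff_not_dvd hpi).2 hp.2).symm
  · intro p hp h
    by_cases hpn : (p : ℤ) ∣ n
    · exact Or.inl hpn
    · right
      apply Finset.dvd_prod_of_mem (fun p : ℕ => (p : ℤ))
      simp only [F, Finset.mem_filter, Nat.mem_primeFactors]
      exact ⟨⟨hp, Int.natCast_dvd.1 h, by simpa using hL⟩, hpn⟩

lemma exists_coprime_lift (x0 : QuadraticAlgebra ℤ s t) (n L : ℤ) (hL : L ≠ 0)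
    (hc : IsCoprime x0 (n : QuadraticAlgebra ℤ s t)) :
    ∃ x : QuadraticAlgebra ℤ s t, (n : QuadraticAlgebra ℤ s t) ∣ x - x0 ∧
      IsCoprime (norm x) L := by
  obtain ⟨k, ⟨α, β, hab⟩, hk⟩ := exists_aux_modulus n L hL
  have hab' : (α : QuadraticAlgebra ℤ s t) * n + β * k = 1 := by exact_mod_cast hab
  refine ⟨x0 + α * n * (1 - x0), ⟨α * (1 - x0), by ring⟩, ?_⟩
  set x := x0 + (α : QuadraticAlgebra ℤ s t) * n * (1 - x0) with hx
  have h1 : (n : QuadraticAlgebra ℤ s t) ∣ x - x0 := ⟨α * (1 - x0), by rw [hx]; ring⟩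
  have h2 : (k : QuadraticAlgebra ℤ s t) ∣ x - 1 :=
    ⟨β * (x0 - 1), by rw [hx]; linear_combination (1 - x0) * hab'⟩
  have c1 : IsCoprime (norm x) n := isCoprime_congr (norm_congr h1) (isCoprime_norm hc)
  have c2 : IsCoprime (norm x) k := by
    have := norm_congr h2
    rw [QuadraticAlgebra.norm_one] at this
    exact isCoprime_congr this isCoprime_one_left
  rw [Int.isCoprime_iff_nat_coprime]
  apply Nat.coprime_of_dvd
  intro p hp e1 e2
  have e1' := Int.natCast_dvd.2 e1
  have hpi : Prime (p : ℤ) := Nat.prime_iff_prime_int.1 hp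
  rcases hk p hp (Int.natCast_dvd.2 e2) with h | h
  · exact hpi.not_isUnit (c1.isUnit_of_dvd' e1' h)
  · exact hpi.not_isUnit (c2.isUnit_of_dvd' e1' h)

lemma choose_x (hΔ : 0 < t ^ 2 + 4 * s) (x0 : QuadraticAlgebra ℤ s t) (n L : ℤ) (hn : n ≠ 0)
    (hL : L ≠ 0) (hL2 : 2 ∣ L) (hc : IsCoprime x0 (n : QuadraticAlgebra ℤ s t)) :
    ∃ (x : QuadraticAlgebra ℤ s t) (q : ℕ), (n : QuadraticAlgebra ℤ s t) ∣ x - x0 ∧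
      q % 4 = 3 ∧ (norm x = q ∨ norm x = -q) ∧ IsCoprime (norm x) L := by
  obtain ⟨x1, hx1, hcop⟩ := exists_coprime_lift x0 n L hL hc
  have hodd : norm x1 % 4 = 3 ∨ norm x1 % 4 = 1 := by
    have : ¬ (2 : ℤ) ∣ norm x1 := fun h => by
      have := hcop.isUnit_of_dvd' h hL2
      rw [Int.isUnit_iff] at this
      omega
    omega
  set W := 4 * n * L with hW
  have hW1 : 1 ≤ W ^ 2 := by
    have : W ≠ 0 := by rw [hW]; positivity
    have : 0 < W ^ 2 := by positivity
    omega
  have main : ∀ κ : QuadraticAlgebra ℤ s t, ∃ x, x = x1 + ((W ^ 2 : ℤ) : QuadraticAlgebra ℤ s t) * κ ∧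
      (n : QuadraticAlgebra ℤ s t) ∣ x - x0 ∧ IsCoprime (norm x) L ∧
      (4 : ℤ) ∣ norm x - norm x1 := by
    intro κ
    have h : ∀ k : ℤ, k ∣ W → (k : QuadraticAlgebra ℤ s t) ∣
        (x1 + ((W ^ 2 : ℤ) : QuadraticAlgebra ℤ s t) * κ) - x1 := by
      rintro k ⟨j, hj⟩
      refine ⟨j * W * κ, ?_⟩
      have : (W : QuadraticAlgebra ℤ s t) = k * j := by rw [hj]; push_cast; ring
      push_cast
      linear_combination (W * κ) * this
    refine ⟨_, rfl, ?_, ?_, ?_⟩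
    · have := dvd_add (h n ⟨4 * L, by rw [hW]; ring⟩) hx1
      rwa [sub_add_sub_cancel] at this
    · exact isCoprime_congr (norm_congr (h L ⟨4 * n, by rw [hW]; ring⟩)) hcop
    · exact norm_congr (h 4 ⟨n * L, by rw [hW]; ring⟩)
  set w := W ^ 2 with hw
  have hsize : ∀ N A : ℤ, |N| < (|N| + |A| + 1) * w * (A + (|N| + |A| + 1) * w) := by
    intro N A
    have h1 : |N| + |A| + 1 ≤ (|N| + |A| + 1) * w := by
      nlinarith [abs_nonneg N, abs_nonneg A]
    have h2 : 1 ≤ A + (|N| + |A| + 1) * w := by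
      have := neg_abs_le A
      have := abs_nonneg N
      linarith
    have := abs_nonneg N
    have := abs_nonneg A
    nlinarith
  rcases hodd with h | h
  · obtain ⟨x, hx, h1, h2, h3⟩ := main ((|norm x1| + |2 * x1.re + t * x1.im| + 1 : ℤ) :
      QuadraticAlgebra ℤ s t)
    have hN : norm x = norm x1 + (|norm x1| + |2 * x1.re + t * x1.im| + 1) * w *
        ((2 * x1.re + t * x1.im) + (|norm x1| + |2 * x1.re + t * x1.im| + 1) * w) := by
      generalize |norm x1| + |2 * x1.re + t * x1.im| + 1 = k at hx
      rw [hx]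
      simp only [norm_def, re_add, im_add, re_mul, im_mul, re_intCast, im_intCast, Int.cast_id]
      ring
    have hpos : 0 < norm x := by
      have := hsize (norm x1) (2 * x1.re + t * x1.im)
      have := neg_abs_le (norm x1)
      linarith
    refine ⟨x, (norm x).toNat, h1, ?_, Or.inl ?_, h2⟩ <;> omega
  · obtain ⟨x, hx, h1, h2, h3⟩ := main ((|norm x1| + |x1.im| + 1 : ℤ) * ⟨-t, 2⟩)
    have hN : norm x = norm x1 - (t ^ 2 + 4 * s) * ((|norm x1| + |x1.im| + 1) * w *
        (x1.im + (|norm x1| + |x1.im| + 1) * w)) := by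
      generalize |norm x1| + |x1.im| + 1 = k at hx
      rw [hx]
      simp only [norm_def, re_add, im_add, re_mul, im_mul, re_intCast, im_intCast, Int.cast_id]
      ring
    have hneg : norm x < 0 := by
      have e1 := hsize (norm x1) x1.im
      have e2 := le_abs_self (norm x1)
      have e3 := abs_nonneg (norm x1)
      rw [hN]
      nlinarith
    refine ⟨x, (-norm x).toNat, h1, ?_, Or.inr ?_, h2⟩ <;> omega

end quad


section arith

lemma split_coprime (q : ℕ) (n : ℕ) (hn : n ≠ 0) :
    ∃ A B k : ℕ, n = A * B ∧ A ∣ q ^ k ∧ Nat.Coprime B q := by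
  induction n using Nat.strong_induction_on with
  | _ n ih =>
    by_cases h : Nat.Coprime n q
    · exact ⟨1, n, 0, by simp, by simp, h⟩
    · have hg : 1 < Nat.gcd n q := by
        have : Nat.gcd n q ≠ 0 := fun h0 => hn (Nat.gcd_eq_zero_iff.1 h0).1
        have : Nat.gcd n q ≠ 1 := h
        omega
      obtain ⟨c, hc⟩ := Nat.gcd_dvd_left n q
      have hc0 : c ≠ 0 := by rintro rfl; simp at hc; exact hn hc
      have hlt : c < n := by
        conv_rhs => rw [hc]
        nlinarith [Nat.pos_of_ne_zero hc0]
      obtain ⟨A, B, k, h1, h2, h3⟩ := ih c hlt hc0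
      refine ⟨Nat.gcd n q * A, B, k + 1, ?_, ?_, h3⟩
      · conv_lhs => rw [hc, h1]
        ring
      · rw [pow_succ, mul_comm]
        exact mul_dvd_mul h2 (Nat.gcd_dvd_right n q)

lemma one_add_pow_odd {R : Type*} [CommRing R] (a : R) (h : ℕ) :
    ∃ w : R, (1 + a) ^ (2 * h + 1) =
      1 + (2 * h + 1) * a + (2 * h + 1) * h * a ^ 2 + a ^ 3 * w := by
  induction h with
  | zero => exact ⟨0, by simp⟩
  | succ h ih =>
    obtain ⟨w, hw⟩ := ih
    refine ⟨w * (1 + 2 * a + a ^ 2) + ((2 * h + 1) + 2 * (2 * h + 1) * h) +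
      (2 * h + 1) * h * a, ?_⟩
    have : (1 + a) ^ (2 * (h + 1) + 1) = (1 + a) ^ (2 * h + 1) * (1 + 2 * a + a ^ 2) := by ring
    rw [this, hw]
    push_cast
    ring

lemma pow_level (Q : ℕ) (hQ : Odd Q) (P z : ℤ) (hP : P = 1 + Q * z) (hz : IsCoprime z (Q : ℤ))
    (i : ℕ) : ∃ z' : ℤ, IsCoprime z' (Q : ℤ) ∧ P ^ (Q ^ i) = 1 + Q ^ (i + 1) * z' := by
  induction i with
  | zero => exact ⟨z, hz, by simp [hP]⟩
  | succ i ih =>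
    obtain ⟨z', hz', h⟩ := ih
    obtain ⟨h0, hh⟩ := hQ
    obtain ⟨w, hw⟩ := one_add_pow_odd ((Q : ℤ) ^ (i + 1) * z') h0
    rw [← hh] at hw
    have hQ' : (Q : ℤ) = 2 * h0 + 1 := by exact_mod_cast hh
    refine ⟨z' + Q * (h0 * Q ^ i * z' ^ 2 + Q ^ (2 * i) * z' ^ 3 * w), ?_, ?_⟩
    · exact hz'.add_mul_left_left _
    · rw [pow_succ, pow_mul, h, hw, ← hQ']
      ring

lemma pow_reach (Q : ℕ) (hQ : Odd Q) (P z : ℤ) (hP : P = 1 + Q * z) (hz : IsCoprime z (Q : ℤ))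
    (y : ℤ) (hy : (Q : ℤ) ∣ 1 - y) (m : ℕ) : ∃ k : ℕ, (Q : ℤ) ^ (m + 1) ∣ P ^ k - y := by
  induction m with
  | zero => exact ⟨0, by simpa using hy⟩
  | succ m ih =>
    obtain ⟨k, c, hc⟩ := ih
    obtain ⟨z', ⟨u, v, huv⟩, hz'⟩ := pow_level Q hQ P z hP hz m
    have hQpos : 0 < (Q : ℤ) := by exact_mod_cast hQ.pos
    -- choose a natural `j` with `c + j z' ≡ 0 mod Q`
    obtain ⟨j, e, hj⟩ : ∃ (j : ℕ) (e : ℤ), (j : ℤ) = -c * u + Q * e := by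
      refine ⟨((-c * u) % Q).toNat, -((-c * u) / Q), ?_⟩
      rw [Int.toNat_of_nonneg (Int.emod_nonneg _ hQpos.ne')]
      have := Int.emod_add_mul_ediv (-c * u) Q
      linear_combination this
    obtain ⟨w, hw⟩ : ∃ w : ℤ, (1 + (Q : ℤ) ^ (m + 1) * z') ^ j =
        1 + j * ((Q : ℤ) ^ (m + 1) * z') + ((Q : ℤ) ^ (m + 1)) ^ 2 * w := by
      obtain ⟨w, hw⟩ := (Polynomial.powAddExpansion (1 : ℤ) ((Q : ℤ) ^ (m + 1) * z') j)
      refine ⟨w * z' ^ 2, ?_⟩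
      rw [hw]; simp; ring
    obtain ⟨g, hg⟩ : (Q : ℤ) ∣ P ^ k - 1 := by
      have : (Q : ℤ) ∣ P - 1 := ⟨z, by rw [hP]; ring⟩
      have h2 := sub_dvd_pow_sub_pow P 1 k
      rw [one_pow] at h2
      exact this.trans h2
    refine ⟨k + Q ^ m * j, c * v + z' * e + g * z' * j + P ^ k * Q ^ m * w, ?_⟩
    rw [pow_add, pow_mul, hz', hw]
    have e1 : P ^ k = 1 + Q * g := by linear_combination hg
    have e2 : P ^ k = y + Q ^ (m + 1) * c := by linear_combination hc
    have e3 : P ^ k * (1 + j * ((Q : ℤ) ^ (m + 1) * z') + ((Q : ℤ) ^ (m + 1)) ^ 2 * w) - y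
      = (P ^ k - y) + (P ^ k) * (j * ((Q : ℤ) ^ (m + 1) * z')) +
       P ^ k * (((Q : ℤ) ^ (m + 1)) ^ 2 * w) := by ring
    rw [e3]
    rw [show (P ^ k) * (j * ((Q : ℤ) ^ (m + 1) * z')) =
      (1 + Q * g) * (j * ((Q : ℤ) ^ (m + 1) * z')) by rw [e1]]
    rw [hc]
    have hcc : c = c * u * z' + c * v * Q := by linear_combination (-c) * huv
    have e4 : (Q : ℤ) ^ (m + 1) * c + (Q : ℤ) ^ (m + 1) * z' * j =
      (Q : ℤ) ^ (m + 2) * (c * v + z' * e) := by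
      rw [hj]
      linear_combination (Q : ℤ) ^ (m + 1) * hcc
    linear_combination e4

end arith


section arith2

lemma pow_half_of_jacobi {p : ℕ} (hp : p.Prime) {a : ℤ} (h : jacobiSym a p = 1) :
    (p : ℤ) ∣ a ^ (p / 2) - 1 := by
  have : Fact p.Prime := ⟨hp⟩
  have h1 := legendreSym.eq_pow p a
  rw [jacobiSym.legendreSym.to_jacobiSym, h] at h1
  rw [← ZMod.intCast_zmod_eq_zero_iff_dvd]
  push_cast
  rw [← h1]; simp

lemma jacobi_neg {a : ℤ} {b : ℕ} (hb : b % 4 = 3) : jacobiSym (-a) b = - jacobiSym a b := by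
  have hodd : Odd b := Nat.odd_iff.2 (by omega)
  rw [jacobiSym.neg a hodd, ZMod.χ₄_nat_three_mod_four hb]; ring

lemma jacobi_disc {p D : ℕ} (hD : 0 < D) (h : (4 * D : ℤ) ∣ p + 1) : jacobiSym D p = 1 := by
  obtain ⟨k, hk⟩ := h
  have hodd : Odd p := by
    rw [Nat.odd_iff]
    have : (p : ℤ) + 1 = 2 * (2 * D * k) := by rw [hk]; ring
    generalize 2 * (D : ℤ) * k = j at this
    omega
  have hmod : p % (4 * (D : ℤ).natAbs) = 4 * D - 1 := by
    have h1 : (p : ℤ) % (4 * D) = 4 * D - 1 := by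
      have : (p : ℤ) = (4 * D - 1) + (4 * D) * (k - 1) := by linear_combination hk
      rw [this, Int.add_mul_emod_self_left]
      apply Int.emod_eq_of_lt <;> omega
    rw [Int.natAbs_natCast]
    zify
    rw [Nat.cast_sub (by omega), h1]
    push_cast; rfl
  rw [jacobiSym.mod_right _ hodd, hmod]
  have hodd' : Odd (4 * D - 1) := by rw [Nat.odd_iff]; omega
  have h4 := jacobiSym.at_four hodd'
  have h5 : jacobiSym ((4 : ℤ) * D) (4 * D - 1) = jacobiSym 1 (4 * D - 1) := by
    apply jacobiSym.mod_left'
    apply Int.ModEq.symm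
    rw [Int.modEq_iff_dvd, Nat.cast_sub (by omega)]
    push_cast
    exact dvd_rfl
  rw [jacobiSym.one_left, jacobiSym.mul_left, h4, one_mul] at h5
  exact h5

lemma exists_sign (n : ℤ) (q : ℕ) (hq : q % 4 = 3) (hqn : IsCoprime (q : ℤ) n) (e : ℤ)
    (he : e = 1 ∨ e = -1) : ∃ sg : ℤ, sg * sg = 1 ∧ jacobiSym (sg * n) q = e := by
  have hg : n.gcd q = 1 := Int.isCoprime_iff_gcd_eq_one.1 hqn.symm
  have h := jacobiSym.eq_one_or_neg_one hg
  by_cases h1 : jacobiSym n q = e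
  · exact ⟨1, by norm_num, by simpa using h1⟩
  · refine ⟨-1, by norm_num, ?_⟩
    rw [neg_one_mul, jacobi_neg hq]
    rcases h with h | h <;> rcases he with rfl | rfl <;> simp_all

lemma exists_prime (n : ℤ) (hn : 2 ≤ |n|) (q : ℕ) (hq : q % 4 = 3) (hqn : IsCoprime (q : ℤ) n)
    (D l : ℕ) (hD : 0 < D) (hl : 0 < l) (hqD : IsCoprime (q : ℤ) (2 * D * l)) (N : ℤ)
    (hN : N = q ∨ N = -q) :
    ∃ (sg : ℤ) (p : ℕ), sg * sg = 1 ∧ p.Prime ∧ (4 * D * l : ℤ) ∣ p + 1 ∧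
      (p : ℤ) ∣ N ^ (p / 2) - 1 ∧ (p : ℤ) ∣ D ^ (p / 2) - 1 ∧
      ∀ m : ℕ, ∃ M : ℕ, (q : ℤ) ^ m ∣ sg * n - p ^ M := by
  obtain ⟨sg, hsg, hJ⟩ := exists_sign n q hq hqn (if N = q then -1 else 1) (by
    split_ifs <;> simp)
  set E := sg * n with hE
  have hE2 : 2 ≤ |E| := by
    have : |sg| = 1 := by
      rcases mul_self_eq_one_iff.1 hsg with h | h <;> simp [h]
    rw [hE, abs_mul, this, one_mul]; exact hn
  have hqE : IsCoprime (q : ℤ) E := IsCoprime.mul_right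
    (IsCoprime.of_isCoprime_of_dvd_right isCoprime_one_right ⟨sg, hsg.symm⟩) hqn
  have hq0 : 0 < q := by omega
  have hf : 0 < Nat.totient q := Nat.totient_pos.2 hq0
  obtain ⟨f, hfdef⟩ : ∃ f, f = Nat.totient q := ⟨_, rfl⟩
  rw [← hfdef] at hf
  have hq1 : (q : ℤ) ∣ E ^ f - 1 := by
    rw [← ZMod.intCast_zmod_eq_zero_iff_dvd]
    have : NeZero q := ⟨hq0.ne'⟩
    have hu : IsUnit (E : ZMod q) := by
      rw [ZMod.coe_int_isUnit_iff_isCoprime]; exact hqE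
    obtain ⟨u, hu⟩ := hu
    push_cast
    rw [← hu, hfdef, ← Units.val_pow_eq_pow_val, ZMod.pow_totient]; simp
  have hQ0 : E ^ f - 1 ≠ 0 := by
    intro h
    have h1 : |E| ^ f = 1 := by rw [← abs_pow, sub_eq_zero.1 h]; simp
    have h2 := one_lt_pow₀ (a := |E|) (by omega) hf.ne'
    omega
  obtain ⟨A, B, k, hAB, hAk, hB⟩ := split_coprime q (E ^ f - 1).natAbs (by simpa using hQ0)
  have hqA : q ∣ A := by
    have : q ∣ A * B := by rw [← hAB]; exact Int.natCast_dvd.1 hq1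
    exact hB.symm.dvd_of_dvd_mul_right this
  have hAcop : ∀ x : ℤ, IsCoprime (q : ℤ) x → IsCoprime (A : ℤ) x := fun x hx =>
    (hx.pow_left (m := k)).of_isCoprime_of_dvd_left (by exact_mod_cast hAk)
  have hA0 : A ≠ 0 := by rintro rfl; simp at hAB; exact hQ0 hAB
  have hAodd : Odd A := by
    have : Odd q := Nat.odd_iff.2 (by omega)
    exact (this.pow (n := k)).of_dvd_nat hAk
  obtain ⟨B', hB', hB'c⟩ : ∃ B' : ℤ, E ^ f - 1 = A * B' ∧ IsCoprime B' (A : ℤ) := by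
    have hBA : IsCoprime (B : ℤ) (A : ℤ) := (hAcop B (by
      rw [Nat.isCoprime_iff_coprime]; exact hB.symm)).symm
    rcases Int.natAbs_eq (E ^ f - 1) with h | h
    · exact ⟨B, by rw [h, hAB]; push_cast; ring, hBA⟩
    · exact ⟨-B, by rw [h, hAB]; push_cast; ring, hBA.neg_left⟩
  -- choose the residue
  have hcopM : IsCoprime ((A : ℤ) ^ 2) (4 * D * l) := by
    apply IsCoprime.pow_left
    apply hAcop
    have h2 : IsCoprime (q : ℤ) 2 := hqD.of_isCoprime_of_dvd_right ⟨D * l, by ring⟩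
    have := h2.mul_right hqD
    have e : (2 : ℤ) * (2 * D * l) = 4 * D * l := by ring
    rwa [e] at this
  obtain ⟨α, β, hαβ⟩ := id hcopM
  -- a = E + α A^2 (-1 - E)
  have hmod0 : A ^ 2 * (4 * D * l) ≠ 0 := by positivity
  set a : ℤ := E + α * (A : ℤ) ^ 2 * (-1 - E) with ha
  have ha1 : a = E + (A : ℤ) ^ 2 * (α * (-1 - E)) := by rw [ha]; ring
  have ha2 : a = -1 + (4 * D * l : ℤ) * (β * (1 + E)) := by
    rw [ha]; linear_combination (-1 - E) * hαβ
  have hacop : IsCoprime a ((A ^ 2 * (4 * D * l) : ℕ) : ℤ) := by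
    push_cast
    apply IsCoprime.mul_right
    · rw [ha1]
      exact ((hAcop E hqE).symm.pow_right).add_mul_left_left _
    · rw [ha2]
      exact (isCoprime_one_left.neg_left).add_mul_left_left _
  obtain ⟨p, -, hp, hpa⟩ := Nat.forall_exists_prime_gt_and_zmodEq 0 hmod0 hacop
  have hpa' := (Int.modEq_iff_dvd.1 hpa.symm)
  push_cast at hpa'
  obtain ⟨c, hc⟩ := hpa'
  have hp1 : (p : ℤ) = E + (A : ℤ) ^ 2 * (α * (-1 - E) + 4 * D * l * c) := by
    linear_combination hc + ha1
  have hp2 : (4 * D * l : ℤ) ∣ p + 1 := ⟨β * (1 + E) + A ^ 2 * c, by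
    linear_combination hc + ha2⟩
  have hp4 : p % 4 = 3 := by
    obtain ⟨j, hj⟩ := hp2
    have : (p : ℤ) + 1 = 4 * (D * l * j) := by rw [hj]; ring
    generalize (D : ℤ) * l * j = i at this
    omega
  have hqA' : (q : ℤ) ∣ A := by exact_mod_cast hqA
  have hJp : jacobiSym p q = jacobiSym E q := by
    apply jacobiSym.mod_left'
    apply Int.ModEq.symm
    rw [Int.modEq_iff_dvd, hp1, add_sub_cancel_left]
    exact (hqA'.trans (dvd_pow_self _ two_ne_zero)).mul_right _
  have hrec : jacobiSym q p = - jacobiSym p q :=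
    jacobiSym.quadratic_reciprocity_three_mod_four hq hp4
  refine ⟨sg, p, hsg, hp, hp2, ?_, ?_, ?_⟩
  · apply pow_half_of_jacobi hp
    rcases hN with h | h
    · rw [if_pos h] at hJ
      rw [h, hrec, hJp, hJ]; norm_num
    · have hne : N ≠ q := by omega
      rw [if_neg hne] at hJ
      rw [h, jacobi_neg hp4, hrec, hJp, hJ]; norm_num
  · exact pow_half_of_jacobi hp (jacobi_disc hD ((Dvd.intro _ rfl).trans hp2))
  · intro m
    -- p ^ f = 1 + A z
    obtain ⟨g, hg⟩ : ((A : ℤ) ^ 2) ∣ p ^ f - E ^ f :=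
      dvd_trans ⟨α * (-1 - E) + 4 * D * l * c, by rw [hp1]; ring⟩ (sub_dvd_pow_sub_pow (p : ℤ) E f)
    have hpA : IsCoprime (p : ℤ) (A : ℤ) := by
      rw [hp1, pow_two, mul_assoc]
      exact (hAcop E hqE).symm.add_mul_left_left _
    have hP : (p : ℤ) ^ f = 1 + A * (B' + A * g) := by
      linear_combination hg + hB'
    obtain ⟨u, v, huv⟩ := hpA.pow_right (n := m + 1)
    obtain ⟨k, w, hw⟩ := pow_reach A hAodd ((p : ℤ) ^ f) (B' + A * g) hP
      (hB'c.add_mul_left_left g) (E * u) (by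
        refine ⟨v * A ^ m + A * (α * (-1 - E) + 4 * D * l * c) * u, ?_⟩
        have hp1' := hp1
        linear_combination (-1) * huv + u * hp1') m
    refine ⟨f * k + 1, ?_⟩
    have h1 : (A : ℤ) ^ (m + 1) ∣ E - p ^ (f * k + 1) := by
      refine ⟨E * v - p * w, ?_⟩
      rw [pow_succ, pow_mul]
      linear_combination (-E) * huv - p * hw
    exact ((pow_dvd_pow_of_dvd hqA' m).trans (pow_dvd_pow _ (Nat.le_succ m))).trans h1

end arith2


section local_p
open QuadraticAlgebra
variable {s t : ℤ}

lemma pow_expand (z : QuadraticAlgebra ℤ s t) (u b : ℤ) (h : z.im = u * b) (n : ℕ) :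
    ∃ k k' : ℤ, (z ^ (n + 1)).im = (n + 1) * z.re ^ n * (u * b) + u ^ 2 * k ∧
      (z ^ (n + 1)).re = z.re ^ (n + 1) + u ^ 2 * k' := by
  induction n with
  | zero => exact ⟨0, 0, by simp [h], by simp⟩
  | succ n ih =>
    obtain ⟨k, k', h1, h2⟩ := ih
    refine ⟨k' * u * b + k * z.re + t * b * ((n + 1) * z.re ^ n * b + u * k),
      k' * z.re + s * b * ((n + 1) * z.re ^ n * b + u * k), ?_, ?_⟩
    · rw [pow_succ, im_mul, h1, h2, h]; push_cast; ring
    · rw [pow_succ, re_mul, h1, h2, h]; ring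

variable {p : ℕ}

lemma two_cancel (hp2 : Odd p) {a : ℤ} (h : (p : ℤ) ∣ 2 * a) : (p : ℤ) ∣ a := by
  have : IsCoprime (p : ℤ) 2 := by
    obtain ⟨k, hk⟩ := hp2
    exact ⟨1, -k, by rw [hk]; push_cast; ring⟩
  exact this.dvd_of_dvd_mul_left h

lemma fermat (hp : p.Prime) (a : ℤ) : (p : ℤ) ∣ a ^ p - a := by
  have : Fact p.Prime := ⟨hp⟩
  rw [← ZMod.intCast_zmod_eq_zero_iff_dvd]
  push_cast
  rw [ZMod.pow_card, sub_self]

lemma fermat_cast (hp : p.Prime) (a : ℤ) :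
    (p : QuadraticAlgebra ℤ s t) ∣ (a : QuadraticAlgebra ℤ s t) ^ p - a := by
  obtain ⟨k, hk⟩ := fermat hp a
  exact ⟨k, by exact_mod_cast congrArg (Int.cast : ℤ → QuadraticAlgebra ℤ s t) hk⟩

lemma natCast_dvd {k : ℕ} {z : QuadraticAlgebra ℤ s t} :
    (k : QuadraticAlgebra ℤ s t) ∣ z ↔ (k : ℤ) ∣ z.re ∧ (k : ℤ) ∣ z.im := by
  have := intCast_dvd (s := s) (t := t) (k := k) (z := z)
  simpa using this

lemma frob (hp : p.Prime) (hp2 : Odd p) (hΔ : (p : ℤ) ∣ (t ^ 2 + 4 * s) ^ (p / 2) - 1)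
    (z : QuadraticAlgebra ℤ s t) : (p : QuadraticAlgebra ℤ s t) ∣ z ^ p - z := by
  let θ : QuadraticAlgebra ℤ s t := ⟨-t, 2⟩
  have hθ : θ ^ 2 = ((t ^ 2 + 4 * s : ℤ) : QuadraticAlgebra ℤ s t) := by
    rw [pow_two]
    ext <;> simp only [re_mul, im_mul, re_intCast, im_intCast, θ, Int.cast_id] <;> ring
  set A : ℤ := 2 * z.re + t * z.im with hA
  have hz : 2 * z = A + z.im * θ := by
    ext
    · simp [θ, hA]; ring
    · simp [θ, hA]; ring
  obtain ⟨k, hk⟩ := hΔ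
  have hk' : ((t ^ 2 + 4 * s : ℤ) : QuadraticAlgebra ℤ s t) ^ (p / 2) = 1 + p * k := by
    have := congrArg (Int.cast : ℤ → QuadraticAlgebra ℤ s t) hk
    push_cast at this ⊢
    linear_combination this
  have hθp : θ ^ p = θ + p * (k * θ) := by
    have : p = 2 * (p / 2) + 1 := by obtain ⟨j, hj⟩ := hp2; omega
    conv_lhs => rw [this]
    rw [pow_succ, pow_mul, hθ, hk']; ring
  obtain ⟨r, hr⟩ := exists_add_pow_prime_eq hp (A : QuadraticAlgebra ℤ s t) (z.im * θ)
  obtain ⟨a1, ha1⟩ := fermat_cast (s := s) (t := t) hp A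
  obtain ⟨a2, ha2⟩ := fermat_cast (s := s) (t := t) hp z.im
  obtain ⟨a3, ha3⟩ := fermat_cast (s := s) (t := t) hp 2
  push_cast at ha3
  rw [← hz, mul_pow, mul_pow, hθp] at hr
  have h2 : (p : QuadraticAlgebra ℤ s t) ∣ 2 * (z ^ p - z) := by
    refine ⟨a1 + a2 * (θ + p * (k * θ)) + z.im * (k * θ) + A * (z.im * θ) * r - a3 * z ^ p, ?_⟩
    linear_combination hr + ha1 + ha2 * (θ + p * (k * θ)) - z ^ p * ha3 - hz
  rw [natCast_dvd] at h2 ⊢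
  have e1 : (2 * (z ^ p - z)).re = 2 * (z ^ p - z).re := by simp
  have e2 : (2 * (z ^ p - z)).im = 2 * (z ^ p - z).im := by simp
  rw [e1, e2] at h2
  exact ⟨two_cancel hp2 h2.1, two_cancel hp2 h2.2⟩

lemma mul_star_self (x : QuadraticAlgebra ℤ s t) :
    x * star x = ((norm x : ℤ) : QuadraticAlgebra ℤ s t) := by
  have := algebraMap_norm_eq_mul_star x
  simpa using this.symm

lemma cancel_of_norm (hp : p.Prime) {x z : QuadraticAlgebra ℤ s t} (hx : ¬ (p : ℤ) ∣ norm x)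
    (h : (p : QuadraticAlgebra ℤ s t) ∣ x * z) : (p : QuadraticAlgebra ℤ s t) ∣ z := by
  have h1 := h.mul_left (star x)
  have e : star x * (x * z) = ((norm x : ℤ) : QuadraticAlgebra ℤ s t) * z := by
    rw [← mul_star_self]; ring
  rw [e, natCast_dvd] at h1
  have hpi : Prime (p : ℤ) := Nat.prime_iff_prime_int.1 hp
  simp only [re_mul, im_mul, re_intCast, im_intCast, Int.cast_id, mul_zero, zero_mul, add_zero] at h1
  rw [natCast_dvd]
  exact ⟨(hpi.dvd_or_dvd h1.1).resolve_left hx, (hpi.dvd_or_dvd h1.2).resolve_left hx⟩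

lemma pow_pred_congr (hp : p.Prime) (hp2 : Odd p)
    (hΔ : (p : ℤ) ∣ (t ^ 2 + 4 * s) ^ (p / 2) - 1)
    (x : QuadraticAlgebra ℤ s t) (hx : ¬ (p : ℤ) ∣ norm x) :
    (p : QuadraticAlgebra ℤ s t) ∣ x ^ (p - 1) - 1 := by
  apply cancel_of_norm hp hx
  have := frob hp hp2 hΔ x
  have e : x * (x ^ (p - 1) - 1) = x ^ p - x := by
    rw [mul_sub, mul_one, ← pow_succ', Nat.sub_add_cancel hp.one_lt.le]
  rwa [e]

lemma half_pow_im (hp : p.Prime) (hp2 : Odd p) (hΔ : (p : ℤ) ∣ (t ^ 2 + 4 * s) ^ (p / 2) - 1)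
    (x : QuadraticAlgebra ℤ s t) (hx : (p : ℤ) ∣ norm x ^ (p / 2) - 1) :
    (p : ℤ) ∣ (x ^ (p / 2)).im := by
  have hpi : Prime (p : ℤ) := Nat.prime_iff_prime_int.1 hp
  have hnx : ¬ (p : ℤ) ∣ norm x := by
    intro h
    have h1 : (p : ℤ) ∣ norm x ^ (p / 2) := dvd_pow h (by
      have := hp.two_le; omega)
    exact hpi.not_dvd_one ((dvd_sub_right h1).1 hx)
  have h1 := pow_pred_congr hp hp2 hΔ x hnx
  set y := x ^ (p / 2) with hy
  have hyy : x ^ (p - 1) = y * y := by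
    rw [hy, ← pow_add]; congr 1
    obtain ⟨j, hj⟩ := hp2; omega
  have hny : ¬ (p : ℤ) ∣ norm y := by
    rw [hy, map_pow]
    intro h; exact hnx (hpi.dvd_of_dvd_pow h)
  obtain ⟨k, hk⟩ := hx
  have hys : y * star y = 1 + p * k := by
    rw [mul_star_self, hy, map_pow]
    have : norm x ^ (p / 2) = 1 + p * k := by linear_combination hk
    rw [this]; push_cast; ring
  obtain ⟨r, hr⟩ := h1
  have h2 : (p : QuadraticAlgebra ℤ s t) ∣ y * (y - star y) :=
    ⟨r - k, by linear_combination hr - hyy - hys⟩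
  have h3 := (natCast_dvd.1 (cancel_of_norm hp hny h2)).2
  apply two_cancel hp2
  simpa [two_mul] using h3

lemma not_dvd_re {x : QuadraticAlgebra ℤ s t} {k : ℤ} (h : ¬ k ∣ norm x) (him : k ∣ x.im) :
    ¬ k ∣ x.re := by
  intro hre
  apply h
  rw [norm_def]
  obtain ⟨a, ha⟩ := him
  obtain ⟨b, hb⟩ := hre
  rw [ha, hb]
  exact ⟨b * (k * b) + t * b * (k * a) - s * a * (k * a), by ring⟩

lemma im_pow_level (hp : p.Prime) (z : QuadraticAlgebra ℤ s t) (hz : (p : ℤ) ∣ z.im) (e : ℕ) :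
    (p : ℤ) ^ (e + 1) ∣ (z ^ (p ^ e)).im := by
  induction e with
  | zero => simpa using hz
  | succ e ih =>
    obtain ⟨b, hb⟩ := ih
    obtain ⟨k, k', h1, -⟩ := pow_expand (z ^ (p ^ e)) _ b hb (p - 1)
    rw [Nat.sub_add_cancel hp.one_lt.le] at h1
    rw [pow_succ p, pow_mul, h1]
    have hpp : (((p - 1 : ℕ) : ℤ) + 1) = p := by
      have := hp.one_lt; push_cast [Nat.cast_sub this.le]; ring
    rw [hpp]
    refine ⟨(z ^ (p ^ e)).re ^ (p - 1) * b + p ^ e * k, ?_⟩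
    ring

/-- exact level of `v ^ (p ^ i)` -/
lemma exact_level (hp : p.Prime) (v : QuadraticAlgebra ℤ s t) (c : ℕ) (hc : 2 ≤ c)
    (b : ℤ) (hv : v.im = p ^ c * b) (hb : ¬ (p : ℤ) ∣ b) (hn : ¬ (p : ℤ) ∣ norm v) (i : ℕ) :
    ∃ b' : ℤ, (v ^ (p ^ i)).im = p ^ (c + i) * b' ∧ ¬ (p : ℤ) ∣ b' := by
  have hpi : Prime (p : ℤ) := Nat.prime_iff_prime_int.1 hp
  induction i with
  | zero => exact ⟨b, by simpa using hv, hb⟩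
  | succ i ih =>
    obtain ⟨b', h1, h2⟩ := ih
    obtain ⟨k, k', h3, -⟩ := pow_expand (v ^ (p ^ i)) _ b' h1 (p - 1)
    rw [Nat.sub_add_cancel hp.one_lt.le] at h3
    have hpp : (((p - 1 : ℕ) : ℤ) + 1) = p := by
      have := hp.one_lt; push_cast [Nat.cast_sub this.le]; ring
    rw [hpp] at h3
    obtain ⟨c', rfl⟩ := Nat.exists_eq_add_of_le hc
    refine ⟨(v ^ (p ^ i)).re ^ (p - 1) * b' + p * (p ^ (c' + i) * k), ?_, ?_⟩
    · rw [pow_succ p, pow_mul, h3]; ring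
    · intro h
      have h4 := (dvd_add_left (Dvd.intro _ rfl)).1 h
      rcases hpi.dvd_or_dvd h4 with h5 | h5
      · have hn' : ¬ (p : ℤ) ∣ norm (v ^ (p ^ i)) := by
          rw [map_pow]; intro h; exact hn (hpi.dvd_of_dvd_pow h)
        refine not_dvd_re hn' ?_ (hpi.dvd_of_dvd_pow h5)
        rw [h1]
        exact (dvd_pow_self _ (by omega)).mul_right _
      · exact h2 h5

lemma kill_im (hp : p.Prime) (v : QuadraticAlgebra ℤ s t) (c : ℕ) (hc : 2 ≤ c)
    (b : ℤ) (hv : v.im = p ^ c * b) (hb : ¬ (p : ℤ) ∣ b) (hn : ¬ (p : ℤ) ∣ norm v)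
    (X : QuadraticAlgebra ℤ s t) (hX : (p : ℤ) ^ c ∣ X.im) (hnX : ¬ (p : ℤ) ∣ norm X) (i : ℕ) :
    ∃ j : ℕ, (p : ℤ) ^ (c + i) ∣ (X * v ^ j).im := by
  have hpi : Prime (p : ℤ) := Nat.prime_iff_prime_int.1 hp
  induction i with
  | zero => exact ⟨0, by simpa using hX⟩
  | succ i ih =>
    obtain ⟨j, a, ha⟩ := ih
    set Y := X * v ^ j with hY
    obtain ⟨β, h1, h2⟩ := exact_level hp v c hc b hv hb hn i
    set V := v ^ (p ^ i) with hV
    have hpc : (p : ℤ) ∣ p ^ (c + i) := dvd_pow_self _ (by omega)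
    have hrY : ¬ (p : ℤ) ∣ Y.re := by
      apply not_dvd_re
      · rw [hY, map_mul, map_pow]
        intro h
        rcases hpi.dvd_or_dvd h with h | h
        · exact hnX h
        · exact hn (hpi.dvd_of_dvd_pow h)
      · rw [ha]; exact hpc.mul_right _
    have hcop : IsCoprime (Y.re * β) (p : ℤ) := by
      apply IsCoprime.symm
      rw [Prime.coprime_iff_not_dvd hpi]
      intro h
      rcases hpi.dvd_or_dvd h with h | h
      · exact hrY h
      · exact h2 h
    obtain ⟨u, w, huw⟩ := hcop
    have hppos : 0 < (p : ℤ) := by exact_mod_cast hp.pos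
    obtain ⟨k, e, hk⟩ : ∃ (k : ℕ) (e : ℤ), (k : ℤ) = (-a * V.re * u - 1) + p * e := by
      refine ⟨((-a * V.re * u - 1) % p).toNat, -((-a * V.re * u - 1) / p), ?_⟩
      rw [Int.toNat_of_nonneg (Int.emod_nonneg _ hppos.ne')]
      have := Int.emod_add_mul_ediv (-a * V.re * u - 1) p
      linear_combination this
    obtain ⟨g, g', h3, h4⟩ := pow_expand V _ β h1 k
    refine ⟨j + p ^ i * (k + 1), ?_⟩
    have e5 : X * v ^ (j + p ^ i * (k + 1)) = Y * V ^ (k + 1) := by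
      rw [hY, hV, pow_add, pow_mul, mul_assoc]
    rw [e5, im_mul, h3, h4, ha]
    obtain ⟨c', hc'⟩ : ∃ c', c + i = c' + 1 := ⟨c + i - 1, by omega⟩
    rw [← add_assoc, hc']
    have key : Y.re * (k + 1) * β + a * V.re = p * (Y.re * β * e + a * V.re * w) := by
      rw [hk]; linear_combination (-a * V.re) * huw
    refine ⟨V.re ^ k * (Y.re * β * e + a * V.re * w) + p ^ c' * Y.re * g + a * p ^ c' * p ^ (c' + 1) * g' +
      t * a * p ^ c' * ((k + 1) * V.re ^ k * β + p ^ (c' + 1) * g), ?_⟩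
    linear_combination (p : ℤ) ^ (c' + 1) * V.re ^ k * key

end local_p


section pell
open QuadraticAlgebra
variable {s t : ℤ}

/-- A unit of norm one all of whose positive powers are irrational. -/
lemma exists_unit (hΔ : 0 < t ^ 2 + 4 * s) (hns : ¬ IsSquare (t ^ 2 + 4 * s)) :
    ∃ ε ε' : QuadraticAlgebra ℤ s t, ε * ε' = 1 ∧ norm ε = 1 ∧
      ∀ k : ℕ, 0 < k → (ε ^ k).im ≠ 0 := by
  obtain ⟨a, hx, hy⟩ := Pell.Solution₁.exists_pos_of_not_isSquare hΔ hns
  have hp := a.prop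
  set x := a.x
  set y := a.y
  have hn : norm (⟨x - t * y, 2 * y⟩ : QuadraticAlgebra ℤ s t) = 1 := by
    rw [norm_def]; simp only; linear_combination hp
  refine ⟨⟨x - t * y, 2 * y⟩, star ⟨x - t * y, 2 * y⟩, ?_, hn, ?_⟩
  · rw [mul_star_self, hn]; simp
  · have key : ∀ k : ℕ, ∃ u v : ℤ, 0 < u ∧ 0 < v ∧
        (⟨x - t * y, 2 * y⟩ : QuadraticAlgebra ℤ s t) ^ (k + 1) = ⟨u - t * v, 2 * v⟩ := by
      intro k
      induction k with
      | zero => exact ⟨x, y, by omega, hy, by simp⟩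
      | succ k ih =>
        obtain ⟨u, v, hu, hv, h⟩ := ih
        refine ⟨u * x + (t ^ 2 + 4 * s) * v * y, u * y + v * x, ?_, ?_, ?_⟩
        · have : 0 < x := by omega
          positivity
        · have : 0 < x := by omega
          positivity
        · rw [pow_succ, h]
          ext
          · simp only [re_mul]; ring
          · simp only [im_mul]; ring
    intro k hk
    obtain ⟨u, v, hu, hv, h⟩ := key (k - 1)
    rw [Nat.sub_add_cancel hk] at h
    rw [h]; simp only; omega

end pell


section main
open QuadraticAlgebra
variable {s t : ℤ}

/-- Every unimodular row over a real quadratic order is elementary. -/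
theorem unimodular_row (hΔ : 0 < t ^ 2 + 4 * s) (hns : ¬ IsSquare (t ^ 2 + 4 * s))
    (a b : QuadraticAlgebra ℤ s t) (hab : IsCoprime a b) : U a b := by
  obtain ⟨x0, n, hc, hU⟩ := reduce hns a b hab
  apply hU
  clear hU hab a b
  by_cases hn0 : n = 0
  · subst hn0
    rw [Int.cast_zero, isCoprime_zero_right] at hc
    obtain ⟨v, hv⟩ := hc.exists_right_inv
    exact U.of_unit_left _ hv
  by_cases hn1 : n = 1 ∨ n = -1
  · apply U.swap
    rcases hn1 with rfl | rfl
    · exact U.of_unit_left (v := 1) _ (by push_cast; ring)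
    · exact U.of_unit_left (v := -1) _ (by push_cast; ring)
  have hn2 : 2 ≤ |n| := by
    rw [Int.abs_eq_natAbs]; omega
  obtain ⟨l, hl, hxl⟩ := exists_pow_congr_one x0 n hn0 hc
  obtain ⟨D, hD⟩ : ∃ D : ℕ, (D : ℤ) = t ^ 2 + 4 * s := ⟨(t ^ 2 + 4 * s).toNat, by omega⟩
  have hD0 : 0 < D := by omega
  have hD' : (D : ℤ) ≠ 0 := by omega
  have hl' : (l : ℤ) ≠ 0 := by omega
  obtain ⟨x, q, hxx, hq, hnq, hnL⟩ := choose_x hΔ x0 n (2 * D * l) hn0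
    (by positivity) ⟨D * l, by ring⟩ hc
  have hqL : IsCoprime (q : ℤ) (2 * D * l) := by
    rcases hnq with h | h
    · rwa [h] at hnL
    · rw [h] at hnL; exact (IsCoprime.neg_left_iff _ _).1 hnL
  have hnn : IsCoprime (norm x) n := isCoprime_congr (norm_congr hxx) (isCoprime_norm hc)
  have hqn : IsCoprime (q : ℤ) n := by
    rcases hnq with h | h
    · rwa [h] at hnn
    · rw [h] at hnn; exact (IsCoprime.neg_left_iff _ _).1 hnn
  obtain ⟨sg, p, hsg, hp, hp4, hNp, hDp, hM⟩ :=
    exists_prime n hn2 q hq hqn D l hD0 hl hqL (norm x) hnq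
  have hpi : Prime (p : ℤ) := Nat.prime_iff_prime_int.1 hp
  rw [hD] at hDp
  obtain ⟨w, hw⟩ := hp4
  have hp2 : Odd p := by
    have h4 : (4 : ℤ) ∣ p + 1 := ⟨D * l * w, by rw [hw]; ring⟩
    rw [Nat.odd_iff]; omega
  obtain ⟨ε, ε', hε, hnε, him⟩ := exists_unit hΔ hns
  have hε1 : ¬ (p : ℤ) ∣ norm ε := by rw [hnε]; exact hpi.not_dvd_one
  -- the unit `v`
  obtain ⟨v, v', hvv, hnv, hv0, hvp⟩ : ∃ v v' : QuadraticAlgebra ℤ s t, v * v' = 1 ∧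
      norm v = 1 ∧ v.im ≠ 0 ∧ (p : ℤ) ^ 2 ∣ v.im := by
    refine ⟨(ε ^ (p - 1)) ^ (p ^ 1), (ε' ^ (p - 1)) ^ (p ^ 1), ?_, ?_, ?_, ?_⟩
    · rw [← mul_pow, ← mul_pow, hε, one_pow, one_pow]
    · rw [map_pow, map_pow, hnε, one_pow, one_pow]
    · rw [← pow_mul]
      apply him
      have := hp.two_le
      exact Nat.mul_pos (by omega) (by positivity)
    · apply im_pow_level hp
      have := (natCast_dvd.1 (pow_pred_congr hp hp2 hDp ε hε1)).2
      simpa using this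
  have hnv1 : ¬ (p : ℤ) ∣ norm v := by rw [hnv]; exact hpi.not_dvd_one
  have hfin : FiniteMultiplicity (p : ℤ) v.im :=
    Int.finiteMultiplicity_iff.2 ⟨by simpa using hp.one_lt.ne', hv0⟩
  obtain ⟨b, hb, hpb⟩ := hfin.exists_eq_pow_mul_and_not_dvd
  set c := multiplicity (p : ℤ) v.im with hc'
  have hc2 : 2 ≤ c := hfin.le_multiplicity_of_pow_dvd hvp
  -- the exponent `m`
  obtain ⟨m, hm⟩ : ∃ m, m = (p / 2) * p ^ (2 * c + 1) := ⟨_, rfl⟩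
  have hnp : ¬ (p : ℤ) ∣ norm x := by
    intro h
    have h1 : (p : ℤ) ∣ norm x ^ (p / 2) := dvd_pow h (by have := hp.two_le; omega)
    exact hpi.not_dvd_one ((dvd_sub_right h1).1 hNp)
  have hX : (p : ℤ) ^ c ∣ (x ^ m).im := by
    rw [hm, pow_mul]
    exact (pow_dvd_pow _ (by omega)).trans
      (im_pow_level hp _ (half_pow_im hp hp2 hDp x hNp) (2 * c + 1))
  have hnX : ¬ (p : ℤ) ∣ norm (x ^ m) := by
    rw [map_pow]; intro h; exact hnp (hpi.dvd_of_dvd_pow h)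
  have hm1 : (l : ℤ) ∣ m - 1 := by
    obtain ⟨h, hh⟩ := hp2
    have hhalf : p / 2 = h := by omega
    have e1 : (h : ℤ) ≡ -1 [ZMOD l] := by
      apply Int.ModEq.symm
      rw [Int.modEq_iff_dvd]
      refine ⟨2 * D * w, ?_⟩
      rw [hh] at hw; push_cast at hw
      linarith
    have e2 : (p : ℤ) ≡ -1 [ZMOD l] := by
      apply Int.ModEq.symm
      rw [Int.modEq_iff_dvd]
      exact ⟨4 * D * w, by linear_combination hw⟩
    have e3 : (m : ℤ) ≡ 1 [ZMOD l] := by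
      rw [hm, hhalf]; push_cast
      have := e1.mul (e2.pow (2 * c + 1))
      have e4 : (-1 : ℤ) * (-1) ^ (2 * c + 1) = 1 := by
        rw [pow_succ, pow_mul]; simp
      rwa [e4] at this
    exact Int.modEq_iff_dvd.1 e3.symm
  have hm0 : 0 < m := by
    rw [hm]
    have := hp.two_le
    exact Nat.mul_pos (by omega) (by positivity)
  obtain ⟨g, hg⟩ : ∃ g : ℕ, m = l * g + 1 := by
    have : l ∣ m - 1 := by
      have h : ((m - 1 : ℕ) : ℤ) = m - 1 := by omega
      rw [← h] at hm1
      exact_mod_cast hm1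
    obtain ⟨g, hg⟩ := this
    exact ⟨g, by omega⟩
  have hxm : (n : QuadraticAlgebra ℤ s t) ∣ x ^ m - x := by
    have h1 : (n : QuadraticAlgebra ℤ s t) ∣ x ^ l - x0 ^ l := hxx.trans (sub_dvd_pow_sub_pow _ _ _)
    have h2 : (n : QuadraticAlgebra ℤ s t) ∣ x ^ l - 1 := by
      have := dvd_add h1 hxl
      simpa using this
    have h3 : (n : QuadraticAlgebra ℤ s t) ∣ (x ^ l) ^ g - 1 ^ g :=
      h2.trans (sub_dvd_pow_sub_pow _ _ _)
    have e : x ^ m - x = ((x ^ l) ^ g - 1 ^ g) * x := by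
      rw [hg, pow_succ, pow_mul, one_pow]; ring
    rw [e]; exact h3.mul_right _
  obtain ⟨M, hM⟩ := hM m
  obtain ⟨j, hj⟩ := kill_im hp v c hc2 b hb hpb hnv1 (x ^ m) hX hnX M
  set Z := x ^ m * v ^ j with hZ
  have hpZ : (p : ℤ) ∣ Z.im := (dvd_pow_self _ (by omega)).trans hj
  have hnZ : ¬ (p : ℤ) ∣ norm Z := by
    rw [hZ, map_mul, map_pow _ v, hnv, one_pow, mul_one]; exact hnX
  have hre : ¬ (p : ℤ) ∣ Z.re := not_dvd_re hnZ hpZ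
  have hcop : IsCoprime Z.re ((p : ℤ) ^ M) :=
    (((Prime.coprime_iff_not_dvd hpi).2 hre).symm).pow_right
  have u1 : U (Z.re : QuadraticAlgebra ℤ s t) (((p : ℤ) ^ M : ℤ) : QuadraticAlgebra ℤ s t) :=
    U.int_cast _ _ hcop
  have u2 : U Z (((p : ℤ) ^ M : ℤ) : QuadraticAlgebra ℤ s t) := by
    refine (U.congr_left ?_).1 u1
    rw [intCast_dvd]
    constructor
    · simp
    · have h : (p : ℤ) ^ M ∣ Z.im := (pow_dvd_pow _ (by omega)).trans hj
      simpa using h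
  have u3 : U (x ^ m) (((p : ℤ) ^ M : ℤ) : QuadraticAlgebra ℤ s t) := by
    rw [hZ, mul_comm] at u2
    exact (U.unit_left_iff (v := v' ^ j) (by rw [← mul_pow, hvv, one_pow])).1 u2
  have u4 : U (x ^ m) ((sg * n : ℤ) : QuadraticAlgebra ℤ s t) := by
    refine (U.congr_right ?_).2 u3
    rw [← Int.cast_sub]
    refine (dvd_norm (x ^ m)).trans ?_
    obtain ⟨f, hf⟩ := hM
    have h1 : norm (x ^ m) ∣ sg * n - p ^ M := by
      rw [hf, map_pow]
      refine Dvd.dvd.mul_right (pow_dvd_pow_of_dvd ?_ m) _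
      rcases hnq with h | h <;> rw [h]
      exact (neg_dvd).2 dvd_rfl
    obtain ⟨f, hf⟩ := h1
    exact ⟨f, by rw [hf]; push_cast; ring⟩
  have u5 : U (x ^ m) (n : QuadraticAlgebra ℤ s t) := by
    rw [Int.cast_mul] at u4
    refine (U.unit_right_iff (v := (sg : QuadraticAlgebra ℤ s t)) ?_).1 u4
    exact_mod_cast congrArg (Int.cast : ℤ → QuadraticAlgebra ℤ s t) hsg
  exact (U.congr_left hxx).1 ((U.congr_left hxm).1 u5)

end main


section transfer

lemma U.map {R S : Type*} [CommRing R] [CommRing S] (f : R →+* S) {a b : R} (h : U a b) :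
    U (f a) (f b) := by
  induction h with
  | base => simpa using U.base
  | left a b t _ ih => rw [map_add, map_mul]; exact U.left _ _ _ ih
  | right a b t _ ih => rw [map_add, map_mul]; exact U.right _ _ _ ih

lemma finrank_eq_two (d : ℕ) (hd : Squarefree d) (hd1 : 1 < d)
    (K : IntermediateField ℚ ℝ) (hK : K = ℚ⟮(Real.sqrt d)⟯) : Module.finrank ℚ K = 2 := by
  have hns : ¬ IsSquare d := by
    rintro ⟨r, hr⟩
    have := hd r ⟨1, by rw [hr]; ring⟩
    rw [Nat.isUnit_iff] at this
    subst this
    omega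
  have hirr := irrational_sqrt_natCast_iff.2 hns
  have hsq : (Real.sqrt d) ^ 2 = d := Real.sq_sqrt (by positivity)
  let g : Polynomial ℚ := Polynomial.X ^ 2 - Polynomial.C (d : ℚ)
  have hg : g.Monic := Polynomial.monic_X_pow_sub_C _ (by norm_num)
  have hg0 : Polynomial.aeval (Real.sqrt d) g = 0 := by
    simp [g, hsq]
  have hinteg : IsIntegral ℚ (Real.sqrt d) := ⟨g, hg, hg0⟩
  rw [hK, IntermediateField.adjoin.finrank hinteg]
  apply le_antisymm
  · have h1 := Polynomial.natDegree_le_of_dvd (minpoly.dvd ℚ _ hg0) hg.ne_zero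
    rwa [Polynomial.natDegree_X_pow_sub_C] at h1
  · rw [minpoly.two_le_natDegree_iff hinteg]
    rintro ⟨r, hr⟩
    exact hirr ⟨r, by simpa using hr⟩

lemma exists_omega_aux (O : Type*) [CommRing O] [CharZero O] [IsDomain O] [Module.Free ℤ O]
    [Module.Finite ℤ O]
    (hfr : Module.finrank ℤ O = 2)
    (hsat' : ∀ (k : ℤ) (z : O), k ≠ 0 → (∃ m : ℤ, k * z = m) → ∃ m : ℤ, z = m) :
    ∃ w : O, (∀ z : O, ∃ a b : ℤ, z = a + b * w) ∧
      (∀ a b : ℤ, (a + b * w : O) = 0 → a = 0 ∧ b = 0) := by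
  obtain ⟨S, hSdef⟩ : ∃ S : Submodule ℤ O, S = Submodule.span ℤ {1} := ⟨_, rfl⟩
  have hS : ∀ z : O, z ∈ S ↔ ∃ m : ℤ, z = m := by
    intro z
    rw [hSdef, Submodule.mem_span_singleton]
    constructor
    · rintro ⟨m, rfl⟩; exact ⟨m, by simp⟩
    · rintro ⟨m, rfl⟩; exact ⟨m, by simp⟩
  have hsat : ∀ (k : ℤ) (z : O), k ≠ 0 → k • z ∈ S → z ∈ S := by
    intro k z hk hz
    rw [hS] at hz ⊢
    exact hsat' k z hk (by simpa using hz)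
  have : Module.IsTorsionFree ℤ (O ⧸ S) := by
    apply Module.IsTorsionFree.of_smul_eq_zero
    intro k q hkq
    by_contra! hcon
    obtain ⟨hk, hq⟩ := hcon
    obtain ⟨z, rfl⟩ := Submodule.Quotient.mk_surjective _ q
    apply hq
    rw [← Submodule.Quotient.mk_smul, Submodule.Quotient.mk_eq_zero] at hkq
    rw [Submodule.Quotient.mk_eq_zero]
    exact hsat k z hk hkq
  have : Module.Free ℤ (O ⧸ S) := inferInstance
  have hS1 : Module.finrank ℤ S = 1 := by
    rw [hSdef]; rw [← (LinearEquiv.toSpanNonzeroSingleton ℤ O 1 one_ne_zero).finrank_eq,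
      Module.finrank_self]
  have hQ : Module.finrank ℤ (O ⧸ S) = 1 := by
    have := Submodule.finrank_quotient_add_finrank S
    omega
  obtain ⟨bs⟩ : Nonempty (Module.Basis (Fin 1) ℤ (O ⧸ S)) :=
    ⟨Module.finBasisOfFinrankEq ℤ (O ⧸ S) hQ⟩
  obtain ⟨w, hw⟩ := Submodule.Quotient.mk_surjective S (bs 0)
  refine ⟨w, ?_, ?_⟩
  · intro z
    have h := bs.sum_repr (Submodule.Quotient.mk z)
    rw [Fin.sum_univ_one, ← hw, ← Submodule.Quotient.mk_smul, Submodule.Quotient.eq'] at h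
    obtain ⟨m, hm⟩ := (hS _).1 h
    refine ⟨m, bs.repr (Submodule.Quotient.mk z) 0, ?_⟩
    rw [zsmul_eq_mul] at hm
    linear_combination hm
  · intro a b hab
    have h1 : b • w ∈ S := by
      rw [hS]; refine ⟨-a, ?_⟩
      rw [zsmul_eq_mul]; push_cast; linear_combination hab
    rw [← Submodule.Quotient.mk_eq_zero, Submodule.Quotient.mk_smul, hw] at h1
    have hb : b = 0 := by
      rcases smul_eq_zero.1 h1 with h | h
      · exact h
      · exact absurd h (bs.ne_zero 0)
    subst hb
    simp only [Int.cast_zero, zero_mul, add_zero] at hab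
    exact ⟨by exact_mod_cast hab, rfl⟩

lemma exists_omega (K : IntermediateField ℚ ℝ) [NumberField K] (h2 : Module.finrank ℚ K = 2) :
    ∃ w : NumberField.RingOfIntegers K,
      (∀ z : NumberField.RingOfIntegers K, ∃ a b : ℤ, z = a + b * w) ∧
      (∀ a b : ℤ, (a + b * w : NumberField.RingOfIntegers K) = 0 → a = 0 ∧ b = 0) := by
  apply exists_omega_aux
  · rw [← h2]; exact NumberField.RingOfIntegers.rank K
  · intro k z hk hz
    obtain ⟨m, hm⟩ := hz
    have hm1 : (k : K) * (z : K) = (m : K) := by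
      have := congrArg (algebraMap (NumberField.RingOfIntegers K) K) hm
      simpa using this
    have hk' : (k : K) ≠ 0 := by exact_mod_cast hk
    have hzq : (z : K) = algebraMap ℚ K ((m : ℚ) / k) := by
      rw [map_div₀, map_intCast, map_intCast, eq_div_iff hk', mul_comm]; exact hm1
    have hi : IsIntegral ℤ (z : K) := z.2
    rw [hzq, isIntegral_algebraMap_iff (algebraMap ℚ K).injective,
      IsIntegrallyClosed.isIntegral_iff] at hi
    obtain ⟨n, hn⟩ := hi
    refine ⟨n, ?_⟩
    apply NumberField.RingOfIntegers.ext
    rw [hzq, ← hn]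
    simp

open QuadraticAlgebra in
lemma exists_quadratic (K : IntermediateField ℚ ℝ) [NumberField K]
    (h2 : Module.finrank ℚ K = 2) :
    ∃ s t : ℤ, 0 < t ^ 2 + 4 * s ∧ ¬ IsSquare (t ^ 2 + 4 * s) ∧
      Nonempty (QuadraticAlgebra ℤ s t ≃+* NumberField.RingOfIntegers K) := by
  obtain ⟨w, hw, hind⟩ := exists_omega K h2
  obtain ⟨s, t, hst⟩ := hw (w * w)
  have hns : ¬ IsSquare (t ^ 2 + 4 * s) := by
    rintro ⟨k, hk⟩
    have hk' : (t ^ 2 + 4 * s : NumberField.RingOfIntegers K) = k * k := by exact_mod_cast hk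
    have h0 : (((-t - k : ℤ) : NumberField.RingOfIntegers K) + (2 : ℤ) * w) *
        (((-t + k : ℤ) : NumberField.RingOfIntegers K) + (2 : ℤ) * w) = 0 := by
      push_cast
      linear_combination 4 * hst + hk'
    rcases mul_eq_zero.1 h0 with h | h
    · have := (hind _ _ h).2; omega
    · have := (hind _ _ h).2; omega
  refine ⟨s, t, ?_, hns, ?_⟩
  · have h1 : ((w : K) : ℝ) * ((w : K) : ℝ) = s + t * ((w : K) : ℝ) := by
      have := congrArg (fun z : NumberField.RingOfIntegers K => ((z : K) : ℝ)) hst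
      simpa using this
    have h3 : (0 : ℝ) ≤ ((t ^ 2 + 4 * s : ℤ) : ℝ) := by
      push_cast
      nlinarith [sq_nonneg (2 * ((w : K) : ℝ) - t)]
    have h4 : (0 : ℤ) ≤ t ^ 2 + 4 * s := by exact_mod_cast h3
    refine lt_of_le_of_ne h4 ?_
    intro h
    exact hns ⟨0, by rw [← h]; ring⟩
  · let f : QuadraticAlgebra ℤ s t →ₐ[ℤ] NumberField.RingOfIntegers K :=
      QuadraticAlgebra.lift ⟨w, by simp [hst]⟩
    have hf : ∀ z, f z = z.re + z.im * w := by
      intro z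
      simp [f, QuadraticAlgebra.lift]
    refine ⟨RingEquiv.ofBijective f ⟨?_, ?_⟩⟩
    · rw [injective_iff_map_eq_zero]
      intro z hz
      rw [hf] at hz
      have := hind _ _ hz
      ext
      · exact this.1
      · exact this.2
    · intro z
      obtain ⟨a, b, hab⟩ := hw z
      exact ⟨⟨a, b⟩, by rw [hf, hab]⟩

end transfer


section dedekind
variable {O : Type*} [CommRing O] [IsDedekindDomain O]

lemma row_of_unimodular (hA : ∀ a b : O, IsCoprime a b → U a b) (x y : O) : P x y := by
  by_cases h0 : x = 0 ∧ y = 0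
  · obtain ⟨rfl, rfl⟩ := h0
    refine ⟨[0], by simp, ?_⟩
    ext i j; fin_cases i <;> fin_cases j <;> simp
  set I : Ideal O := Ideal.span {x, y} with hI
  have hx : x ∈ I := Ideal.subset_span (by simp)
  have hy : y ∈ I := Ideal.subset_span (by simp)
  obtain ⟨c, hc0, hcI⟩ : ∃ c : O, c ≠ 0 ∧ c ∈ I := by
    by_cases hx0 : x = 0
    · exact ⟨y, fun h => h0 ⟨hx0, h⟩, hy⟩
    · exact ⟨x, hx0, hx⟩
  have hI0 : I ≠ 0 := by
    intro h
    rw [h] at hcI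
    exact hc0 (by simpa using hcI)
  have hII : I * I ≠ 0 := mul_ne_zero hI0 hI0
  obtain ⟨s, hs⟩ := IsDedekindDomain.exists_sup_span_eq (Ideal.mul_le_left : I * I ≤ I) hII
  have hsI : s ∈ I := by
    rw [← hs]; exact Ideal.mem_sup_right (Ideal.mem_span_singleton_self s)
  obtain ⟨J, hJ⟩ : I ∣ Ideal.span {c} := by
    rw [Ideal.dvd_iff_le, Ideal.span_singleton_le_iff_mem]; exact hcI
  have hdiv : ∀ i ∈ I, ∀ j ∈ J, ∃ e, i * j = c * e := by
    intro i hi j hj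
    have : i * j ∈ Ideal.span {c} := by rw [hJ]; exact Ideal.mul_mem_mul hi hj
    rwa [Ideal.mem_span_singleton] at this
  have hc1 : c ∈ I * J := by rw [← hJ]; exact Ideal.mem_span_singleton_self c
  have hc2 := hc1
  have e1 : I * J = Ideal.span {x} * J ⊔ Ideal.span {y} * J := by
    rw [hI, Ideal.span_insert, Ideal.sup_mul]
  have e2 : I * J = I * Ideal.span {c} ⊔ Ideal.span {s} * J := by
    conv_lhs => rw [← hs]
    rw [Ideal.sup_mul, mul_assoc, ← hJ]
  rw [e1] at hc1
  rw [e2] at hc2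
  obtain ⟨u1, hu1, u2, hu2, hu⟩ := Submodule.mem_sup.1 hc1
  obtain ⟨j1, hj1, rfl⟩ := Ideal.mem_span_singleton_mul.1 hu1
  obtain ⟨j2, hj2, rfl⟩ := Ideal.mem_span_singleton_mul.1 hu2
  obtain ⟨w1, hw1, w2, hw2, hw⟩ := Submodule.mem_sup.1 hc2
  obtain ⟨α, hα, rfl⟩ := Ideal.mem_mul_span_singleton.1 hw1
  obtain ⟨b, hb, rfl⟩ := Ideal.mem_span_singleton_mul.1 hw2
  obtain ⟨k1, hk1⟩ := hdiv s hsI j1 hj1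
  obtain ⟨k2, hk2⟩ := hdiv s hsI j2 hj2
  obtain ⟨e11, h11⟩ := hdiv x hx j1 hj1
  obtain ⟨e12, h12⟩ := hdiv y hy j1 hj1
  obtain ⟨e21, h21⟩ := hdiv x hx j2 hj2
  obtain ⟨e22, h22⟩ := hdiv y hy j2 hj2
  obtain ⟨p1, hp1⟩ := hdiv α hα j1 hj1
  obtain ⟨p2, hp2⟩ := hdiv α hα j2 hj2
  obtain ⟨f, hf⟩ := hdiv x hx b hb
  obtain ⟨g, hg⟩ := hdiv y hy b hb
  have hU : U (x - k2) (y + k1) := by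
    apply hA
    refine ⟨p1 - g, p2 + f, ?_⟩
    apply mul_left_cancel₀ hc0
    apply mul_left_cancel₀ hc0
    have : c * (c * ((p1 - g) * (x - k2) + (p2 + f) * (y + k1))) =
        (c * p1 - c * g) * (c * x - c * k2) + (c * p2 + c * f) * (c * y + c * k1) := by ring
    rw [this, ← hp1, ← hp2, ← hg, ← hf, ← hk1, ← hk2]
    linear_combination (c * α + s * b) * hu + c * hw
  refine hU.isIdemProd.step !![e11, e12; e21, e22] ?_ ?_ ?_
  · have aux : ∀ u v : O, c * (c * u) = c * (c * v) → u = v := fun u v h =>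
      mul_left_cancel₀ hc0 (mul_left_cancel₀ hc0 h)
    ext i j
    fin_cases i <;> fin_cases j <;> simp [Matrix.mul_apply, Fin.sum_univ_two] <;> apply aux
    · have : c * (c * (e11 * e11 + e12 * e21)) = c * e11 * (c * e11) + c * e12 * (c * e21) := by
        ring
      rw [this, ← h11, ← h12, ← h21]; linear_combination x * j1 * hu
    · have : c * (c * (e11 * e12 + e12 * e22)) = c * e11 * (c * e12) + c * e12 * (c * e22) := by
        ring
      rw [this, ← h11, ← h12, ← h22]; linear_combination y * j1 * hu
    · have : c * (c * (e21 * e11 + e22 * e21)) = c * e21 * (c * e11) + c * e22 * (c * e21) := by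
        ring
      rw [this, ← h11, ← h22, ← h21]; linear_combination x * j2 * hu
    · have : c * (c * (e21 * e12 + e22 * e22)) = c * e21 * (c * e12) + c * e22 * (c * e22) := by
        ring
      rw [this, ← h12, ← h22, ← h21]; linear_combination y * j2 * hu
  · apply mul_left_cancel₀ hc0
    apply mul_left_cancel₀ hc0
    simp only [Matrix.of_apply, Matrix.cons_val', Matrix.cons_val_zero, Matrix.cons_val_one,
      Matrix.cons_val_fin_one]
    have : c * (c * ((x - k2) * e11 + (y + k1) * e21)) =
      (c * x - c * k2) * (c * e11) + (c * y + c * k1) * (c * e21) := by ring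
    rw [this, ← hk1, ← hk2, ← h11, ← h21]
    linear_combination (-c * x) * hu
  · apply mul_left_cancel₀ hc0
    apply mul_left_cancel₀ hc0
    simp only [Matrix.of_apply, Matrix.cons_val', Matrix.cons_val_zero, Matrix.cons_val_one,
      Matrix.cons_val_fin_one]
    have : c * (c * ((x - k2) * e12 + (y + k1) * e22)) =
      (c * x - c * k2) * (c * e12) + (c * y + c * k1) * (c * e22) := by ring
    rw [this, ← hk1, ← hk2, ← h12, ← h22]
    linear_combination (-c * y) * hu

end dedekind


end IdemRow

theorem stmt_8 (d : ℕ) (hd : Squarefree d) (hd1 : 1 < d)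
    (K : IntermediateField ℚ ℝ) (hK : K = ℚ⟮(Real.sqrt d)⟯) [NumberField K]
    (x y : NumberField.RingOfIntegers K) :
    IsIdemProd !![x, y; 0, 0] := by
  obtain ⟨s, t, hΔ, hns, ⟨f⟩⟩ :=
    IdemRow.exists_quadratic K (IdemRow.finrank_eq_two d hd hd1 K hK)
  refine IdemRow.row_of_unimodular (fun a b hab => ?_) x y
  have h1 : IsCoprime (f.symm a) (f.symm b) := hab.map f.symm.toRingHom
  have h2 := (IdemRow.unimodular_row hΔ hns _ _ h1).map f.toRingHom
  simpa using h2
end
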